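/- arXiv:2408.05181 — 2 statements merged into one kernel-verified Lean document; each statement's English description precedes it below -/
import Mathlib

section
/- Let (H,A) be a compatible weak matched pair in which H and A are weak Hopf algebras with antipodes S_H and S_A. Assume that for all h ∈ H: (7) (1_{H1}h⁰·1_A) ⊗ S_A(h¹)εs((1_{H2})¹) ⊗ (1_{H2})⁰ = εt((1_{H1})⁰h⁰·1_A) ⊗ εt(h¹)εs((1_{H2})¹)(1_{H1})¹ ⊗ (1_{H2})⁰ in A⊗A⊗H, and (8) εs((h₁)¹(h₂)¹)(S_H((h₁)⁰)·1_A) ⊗ S_H((h₂)⁰)h₃ = εs(h¹(1_{H2})¹)εs(h⁰1_{H1}·1_A) ⊗ (1_{H2})⁰ in A⊗H, where Δ(1_H)=1_{H1}⊗1_{H2}. Then A♯♯H is a weak Hopf algebra with antipode S(x♯♯h) = (1_A♯♯S_H(h⁰))·((S_A(xh¹))♯♯1_H); that is, for all u ∈ A♯♯H one has u₁S(u₂)=εt(u), S(u₁)u₂=εs(u) and S(u₁)u₂S(u₃)=S(u), where εt, εs are computed in the weak bialgebra A♯♯H. -/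
open TensorProduct

noncomputable section

namespace WeakSmash

variable (k : Type*) [Field k]

/-- A weak bialgebra structure on the `k`-algebra `H`. -/
structure WeakBialgebra (H : Type*) [Ring H] [Algebra k H] where
  comul : H →ₗ[k] H ⊗[k] H
  counit : H →ₗ[k] k
  coassoc : ∀ h : H,
    (TensorProduct.assoc k H H H) ((LinearMap.rTensor H comul) (comul h)) =
      (LinearMap.lTensor H comul) (comul h)
  counit_comul : ∀ h : H,
    (TensorProduct.lid k H) ((LinearMap.rTensor H counit) (comul h)) = h
  comul_counit : ∀ h : H,
    (TensorProduct.rid k H) ((LinearMap.lTensor H counit) (comul h)) = h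
  comul_mul : ∀ h g : H, comul (h * g) = comul h * comul g
  counit_weak : ∀ h g l : H,
    counit (h * g * l) =
      LinearMap.mul' k k
        ((TensorProduct.map (counit ∘ₗ LinearMap.mulLeft k h)
            (counit ∘ₗ LinearMap.mulRight k l)) (comul g))
  counit_weak' : ∀ h g l : H,
    counit (h * g * l) =
      LinearMap.mul' k k
        ((TensorProduct.map (counit ∘ₗ LinearMap.mulLeft k h)
            (counit ∘ₗ LinearMap.mulRight k l)) ((TensorProduct.comm k H H) (comul g)))
  comul_one_left :
    ((TensorProduct.assoc k H H H) (comul 1 ⊗ₜ[k] (1 : H))) * ((1 : H) ⊗ₜ[k] comul 1) =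
      (LinearMap.lTensor H comul) (comul 1)
  comul_one_right :
    ((1 : H) ⊗ₜ[k] comul 1) * ((TensorProduct.assoc k H H H) (comul 1 ⊗ₜ[k] (1 : H))) =
      (LinearMap.lTensor H comul) (comul 1)

variable {k}

namespace WeakBialgebra

variable {H : Type*} [Ring H] [Algebra k H]

/-- The target counital map `εt h = ε(1₁ h) 1₂`. -/
def εt (W : WeakBialgebra k H) : H →ₗ[k] H :=
  (TensorProduct.lid k H).toLinearMap ∘ₗ LinearMap.rTensor H W.counit ∘ₗ
    LinearMap.mulLeft k (W.comul 1) ∘ₗ (TensorProduct.mk k H H).flip 1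

/-- The source counital map `εs h = 1₁ ε(h 1₂)`. -/
def εs (W : WeakBialgebra k H) : H →ₗ[k] H :=
  (TensorProduct.rid k H).toLinearMap ∘ₗ LinearMap.lTensor H W.counit ∘ₗ
    LinearMap.mulRight k (W.comul 1) ∘ₗ TensorProduct.mk k H H 1

/-- Cocommutativity of a weak bialgebra. -/
def Cocomm (W : WeakBialgebra k H) : Prop :=
  ∀ h : H, (TensorProduct.comm k H H) (W.comul h) = W.comul h

/-- `S` is an antipode for `W`, making it a weak Hopf algebra. -/
structure IsAntipode (W : WeakBialgebra k H) (S : H →ₗ[k] H) : Prop where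
  mul_antipode : ∀ h : H,
    LinearMap.mul' k H ((LinearMap.lTensor H S) (W.comul h)) = W.εt h
  antipode_mul : ∀ h : H,
    LinearMap.mul' k H ((LinearMap.rTensor H S) (W.comul h)) = W.εs h
  antipode_mid : ∀ h : H,
    LinearMap.mul' k H
      ((TensorProduct.map S (LinearMap.mul' k H ∘ₗ LinearMap.lTensor H S))
        ((LinearMap.lTensor H W.comul) (W.comul h))) = S h

/-- `α` is a left integral: `h α = εt(h) α`. -/
def IsLeftIntegral (W : WeakBialgebra k H) (α : H) : Prop :=
  ∀ h : H, h * α = W.εt h * α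

end WeakBialgebra

section MatchedPair

variable (k)
variable {H A : Type*} [Ring H] [Algebra k H] [Ring A] [Algebra k A]

/-- `A` is a left `H`-module algebra via the action `act`. -/
structure IsModuleAlgebra (WH : WeakBialgebra k H) (act : H →ₗ[k] A →ₗ[k] A) : Prop where
  one_act : ∀ a : A, act 1 a = a
  act_mul : ∀ (h : H) (a b : A),
    act h (a * b) =
      LinearMap.mul' k A ((TensorProduct.map (act.flip a) (act.flip b)) (WH.comul h))
  act_act : ∀ (h g : H) (a : A), act h (act g a) = act (h * g) a
  act_unit : ∀ h : H, act h 1 = act (WH.εt h) 1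

/-- The map `h ↦ ε(h⁰) h¹`. -/
def coactCounit (WH : WeakBialgebra k H) (coact : H →ₗ[k] H ⊗[k] A) : H →ₗ[k] A :=
  (TensorProduct.lid k A).toLinearMap ∘ₗ LinearMap.rTensor A WH.counit ∘ₗ coact

/-- `H` is a right `A`-comodule coalgebra via the coaction `coact`. -/
structure IsComoduleCoalgebra (WH : WeakBialgebra k H) (WA : WeakBialgebra k A)
    (coact : H →ₗ[k] H ⊗[k] A) : Prop where
  counit_coact : ∀ h : H,
    (TensorProduct.rid k H) ((LinearMap.lTensor H WA.counit) (coact h)) = h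
  comul_coact : ∀ h : H,
    (LinearMap.rTensor A WH.comul) (coact h) =
      (LinearMap.lTensor (H ⊗[k] H) (LinearMap.mul' k A))
        ((TensorProduct.tensorTensorTensorComm k H A H A)
          ((TensorProduct.map coact coact) (WH.comul h)))
  coact_coact : ∀ h : H,
    (TensorProduct.assoc k H A A) ((LinearMap.rTensor A coact) (coact h)) =
      (LinearMap.lTensor H WA.comul) (coact h)
  coact_counit : ∀ h : H,
    coactCounit k WH coact h = WA.εs (coactCounit k WH coact h)

/-- The map `(h₁ ⊗ h₂) ⊗ (x₁ ⊗ x₂) ↦ (h₁⁰ · x₁) ⊗ (h₁¹ (h₂ · x₂))`. -/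
def pairMapA (act : H →ₗ[k] A →ₗ[k] A) (coact : H →ₗ[k] H ⊗[k] A) :
    (H ⊗[k] H) ⊗[k] (A ⊗[k] A) →ₗ[k] A ⊗[k] A :=
  LinearMap.lTensor A (LinearMap.mul' k A) ∘ₗ
  (TensorProduct.assoc k A A A).toLinearMap ∘ₗ
  LinearMap.rTensor A
    (LinearMap.rTensor A (TensorProduct.lift act) ∘ₗ
      (TensorProduct.assoc k H A A).symm.toLinearMap ∘ₗ
      LinearMap.lTensor H (TensorProduct.comm k A A).toLinearMap ∘ₗ
      (TensorProduct.assoc k H A A).toLinearMap) ∘ₗ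
  TensorProduct.map (LinearMap.rTensor A coact) (TensorProduct.lift act) ∘ₗ
  (TensorProduct.tensorTensorTensorComm k H H A A).toLinearMap

/-- The map `(h₁ ⊗ h₂) ⊗ (g⁰ ⊗ g¹) ↦ (h₁⁰ g⁰) ⊗ (h₁¹ (h₂ · g¹))`. -/
def pairMapH (act : H →ₗ[k] A →ₗ[k] A) (coact : H →ₗ[k] H ⊗[k] A) :
    (H ⊗[k] H) ⊗[k] (H ⊗[k] A) →ₗ[k] H ⊗[k] A :=
  LinearMap.lTensor H (LinearMap.mul' k A) ∘ₗ
  (TensorProduct.assoc k H A A).toLinearMap ∘ₗ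
  LinearMap.rTensor A
    (LinearMap.rTensor A (LinearMap.mul' k H) ∘ₗ
      (TensorProduct.assoc k H H A).symm.toLinearMap ∘ₗ
      LinearMap.lTensor H (TensorProduct.comm k A H).toLinearMap ∘ₗ
      (TensorProduct.assoc k H A H).toLinearMap) ∘ₗ
  TensorProduct.map (LinearMap.rTensor H coact) (TensorProduct.lift act) ∘ₗ
  (TensorProduct.tensorTensorTensorComm k H H H A).toLinearMap

/-- The iterated comultiplication `h ↦ h₁ ⊗ (h₂ ⊗ h₃)`. -/
def twoComul (WH : WeakBialgebra k H) : H →ₗ[k] H ⊗[k] (H ⊗[k] H) :=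
  LinearMap.lTensor H WH.comul ∘ₗ WH.comul

/-- The iterated comultiplication `h ↦ h₁ ⊗ (h₂ ⊗ (h₃ ⊗ h₄))`. -/
def threeComul (WH : WeakBialgebra k H) : H →ₗ[k] H ⊗[k] (H ⊗[k] (H ⊗[k] H)) :=
  LinearMap.lTensor H (LinearMap.lTensor H WH.comul) ∘ₗ LinearMap.lTensor H WH.comul ∘ₗ WH.comul

/-- Left-hand side of the matched pair condition (iii):
`(h₁·x)₁ ⊗ (h₂ g)⁰ ⊗ (h₁·x)₂ (h₂ g)¹`. -/
def mpLHS (WH : WeakBialgebra k H) (WA : WeakBialgebra k A)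
    (act : H →ₗ[k] A →ₗ[k] A) (coact : H →ₗ[k] H ⊗[k] A) (h g : H) (x : A) :
    (A ⊗[k] H) ⊗[k] A :=
  LinearMap.lTensor (A ⊗[k] H) (LinearMap.mul' k A)
    ((TensorProduct.tensorTensorTensorComm k A A H A)
      ((TensorProduct.map (WA.comul ∘ₗ act.flip x) (coact ∘ₗ LinearMap.mulRight k g))
        (WH.comul h)))

/-- Right-hand side of the matched pair condition (iii):
`(h₁⁰ · x₁) ⊗ (h₃⁰ g⁰) ⊗ (h₁¹ (h₂ · x₂) h₃¹ (h₄ · g¹))`. -/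
def mpRHS (WH : WeakBialgebra k H) (WA : WeakBialgebra k A)
    (act : H →ₗ[k] A →ₗ[k] A) (coact : H →ₗ[k] H ⊗[k] A) (h g : H) (x : A) :
    (A ⊗[k] H) ⊗[k] A :=
  LinearMap.lTensor (A ⊗[k] H) (LinearMap.mul' k A)
    ((TensorProduct.tensorTensorTensorComm k A A H A)
      ((TensorProduct.map
          (pairMapA k act coact ∘ₗ
            (TensorProduct.mk k (H ⊗[k] H) (A ⊗[k] A)).flip (WA.comul x))
          (pairMapH k act coact ∘ₗ
            (TensorProduct.mk k (H ⊗[k] H) (H ⊗[k] A)).flip (coact g)))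
        ((TensorProduct.assoc k H H (H ⊗[k] H)).symm (threeComul k WH h))))

/-- `(H, A)` is a weak matched pair. -/
structure IsWeakMatchedPair (WH : WeakBialgebra k H) (WA : WeakBialgebra k A)
    (act : H →ₗ[k] A →ₗ[k] A) (coact : H →ₗ[k] H ⊗[k] A) : Prop where
  moduleAlgebra : IsModuleAlgebra k WH act
  comoduleCoalgebra : IsComoduleCoalgebra k WH WA coact
  cond3 : ∀ (h g : H) (x : A),
    mpLHS k WH WA act coact h g x = mpRHS k WH WA act coact h g x
  cond4 : ∀ (h : H) (x : A), WA.εs (act h x) = WA.εs (act h 1) * WA.εs x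
  cond5 :
    (LinearMap.rTensor H coact) (WH.comul 1) =
      (TensorProduct.map (LinearMap.lTensor H (coactCounit k WH coact))
          (LinearMap.mul' k H))
        ((TensorProduct.tensorTensorTensorComm k H H H H)
          (WH.comul 1 ⊗ₜ[k] WH.comul 1))

/-- `(H, A)` is a compatible (abelian) weak matched pair. -/
structure IsCompatiblePair (WH : WeakBialgebra k H) (WA : WeakBialgebra k A)
    (act : H →ₗ[k] A →ₗ[k] A) (coact : H →ₗ[k] H ⊗[k] A) : Prop where
  pair : IsWeakMatchedPair k WH WA act coact
  cocomm : WH.Cocomm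
  comm : ∀ a b : A, a * b = b * a
  compat1 : ∀ h : H,
    act h 1 =
      (TensorProduct.rid k A)
        ((TensorProduct.map (TensorProduct.lift act)
            (WA.counit ∘ₗ TensorProduct.lift act))
          ((TensorProduct.tensorTensorTensorComm k H H A A)
            (WH.comul h ⊗ₜ[k] WA.comul 1)))
  compat2 : ∀ h g : H,
    (TensorProduct.map (act h) (act g)) (WA.comul 1) =
      (TensorProduct.map (LinearMap.mulLeft k (act h 1))
        (LinearMap.mulLeft k (act g 1))) (WA.comul 1)

/-- The smash product multiplication on `A ⊗ H`:
`(x ⊗ h) (y ⊗ g) = x (h₁ · y) ⊗ h₂ g`. -/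
def smashMul (WH : WeakBialgebra k H) (act : H →ₗ[k] A →ₗ[k] A) :
    (A ⊗[k] H) ⊗[k] (A ⊗[k] H) →ₗ[k] A ⊗[k] H :=
  LinearMap.rTensor H (LinearMap.mul' k A) ∘ₗ
  (TensorProduct.assoc k A A H).symm.toLinearMap ∘ₗ
  LinearMap.lTensor A
    (TensorProduct.map (TensorProduct.lift act) (LinearMap.mul' k H) ∘ₗ
      (TensorProduct.tensorTensorTensorComm k H H A H).toLinearMap) ∘ₗ
  (TensorProduct.assoc k A (H ⊗[k] H) (A ⊗[k] H)).toLinearMap ∘ₗ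
  LinearMap.rTensor (A ⊗[k] H) (LinearMap.lTensor A WH.comul)

/-- The smash coproduct on `A ⊗ H`:
`Δ(x ⊗ h) = (x₁ ⊗ h₁⁰) ⊗ (x₂ h₁¹ ⊗ h₂)`. -/
def smashComul (WH : WeakBialgebra k H) (WA : WeakBialgebra k A)
    (coact : H →ₗ[k] H ⊗[k] A) :
    A ⊗[k] H →ₗ[k] (A ⊗[k] H) ⊗[k] (A ⊗[k] H) :=
  (TensorProduct.assoc k (A ⊗[k] H) A H).toLinearMap ∘ₗ
  LinearMap.rTensor H (LinearMap.lTensor (A ⊗[k] H) (LinearMap.mul' k A)) ∘ₗ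
  LinearMap.rTensor H (TensorProduct.tensorTensorTensorComm k A A H A).toLinearMap ∘ₗ
  (TensorProduct.assoc k (A ⊗[k] A) (H ⊗[k] A) H).symm.toLinearMap ∘ₗ
  LinearMap.lTensor (A ⊗[k] A) (LinearMap.rTensor H coact) ∘ₗ
  TensorProduct.map WA.comul WH.comul

/-- The smash counit `ε(x ⊗ h) = ε(x) ε(h)`. -/
def smashCounit (WH : WeakBialgebra k H) (WA : WeakBialgebra k A) :
    A ⊗[k] H →ₗ[k] k :=
  LinearMap.mul' k k ∘ₗ TensorProduct.map WA.counit WH.counit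

/-- The projection `u ↦ u (1_A # 1_H)` onto `A ♯ H`. -/
def projUnder (WH : WeakBialgebra k H) (act : H →ₗ[k] A →ₗ[k] A) :
    A ⊗[k] H →ₗ[k] A ⊗[k] H :=
  smashMul k WH act ∘ₗ
    (TensorProduct.mk k (A ⊗[k] H) (A ⊗[k] H)).flip ((1 : A) ⊗ₜ[k] (1 : H))

/-- The projection `u ↦ (id ⊗ ε) Δ(u)` onto `overline(A # H)`. -/
def projBar (WH : WeakBialgebra k H) (WA : WeakBialgebra k A)
    (coact : H →ₗ[k] H ⊗[k] A) : A ⊗[k] H →ₗ[k] A ⊗[k] H :=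
  (TensorProduct.rid k (A ⊗[k] H)).toLinearMap ∘ₗ
    LinearMap.lTensor (A ⊗[k] H) (smashCounit k WH WA) ∘ₗ smashComul k WH WA coact

/-- The projection onto `A ♯♯ H`, i.e. `u ↦ (id ⊗ ε) Δ (u (1#1))`. -/
def projBoth (WH : WeakBialgebra k H) (WA : WeakBialgebra k A)
    (act : H →ₗ[k] A →ₗ[k] A) (coact : H →ₗ[k] H ⊗[k] A) :
    A ⊗[k] H →ₗ[k] A ⊗[k] H :=
  projBar k WH WA coact ∘ₗ projUnder k WH act

/-- Componentwise smash multiplication on `(A⊗H) ⊗ (A⊗H)`. -/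
def smashMul2 (WH : WeakBialgebra k H) (act : H →ₗ[k] A →ₗ[k] A) :
    ((A ⊗[k] H) ⊗[k] (A ⊗[k] H)) ⊗[k] ((A ⊗[k] H) ⊗[k] (A ⊗[k] H)) →ₗ[k]
      (A ⊗[k] H) ⊗[k] (A ⊗[k] H) :=
  TensorProduct.map (smashMul k WH act) (smashMul k WH act) ∘ₗ
    (TensorProduct.tensorTensorTensorComm k (A ⊗[k] H) (A ⊗[k] H)
      (A ⊗[k] H) (A ⊗[k] H)).toLinearMap

/-- Componentwise smash multiplication on threefold tensors. -/
def smashMul3 (WH : WeakBialgebra k H) (act : H →ₗ[k] A →ₗ[k] A) :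
    ((A ⊗[k] H) ⊗[k] ((A ⊗[k] H) ⊗[k] (A ⊗[k] H))) ⊗[k]
      ((A ⊗[k] H) ⊗[k] ((A ⊗[k] H) ⊗[k] (A ⊗[k] H))) →ₗ[k]
      (A ⊗[k] H) ⊗[k] ((A ⊗[k] H) ⊗[k] (A ⊗[k] H)) :=
  TensorProduct.map (smashMul k WH act) (smashMul2 k WH act) ∘ₗ
    (TensorProduct.tensorTensorTensorComm k (A ⊗[k] H)
      ((A ⊗[k] H) ⊗[k] (A ⊗[k] H)) (A ⊗[k] H)
      ((A ⊗[k] H) ⊗[k] (A ⊗[k] H))).toLinearMap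

/-- The unit element `1_A ♯♯ 1_H` of `A ♯♯ H`. -/
def smashOne (WH : WeakBialgebra k H) (WA : WeakBialgebra k A)
    (act : H →ₗ[k] A →ₗ[k] A) (coact : H →ₗ[k] H ⊗[k] A) : A ⊗[k] H :=
  projBoth k WH WA act coact ((1 : A) ⊗ₜ[k] (1 : H))

/-- The map `εt` of the weak bialgebra `A ♯♯ H`: `u ↦ ε(e₁ u) e₂` where `e = 1_A ♯♯ 1_H`. -/
def smashEpsT (WH : WeakBialgebra k H) (WA : WeakBialgebra k A)
    (act : H →ₗ[k] A →ₗ[k] A) (coact : H →ₗ[k] H ⊗[k] A) (u : A ⊗[k] H) :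
    A ⊗[k] H :=
  (TensorProduct.lid k (A ⊗[k] H))
    ((LinearMap.rTensor (A ⊗[k] H)
        (smashCounit k WH WA ∘ₗ smashMul k WH act ∘ₗ
          (TensorProduct.mk k (A ⊗[k] H) (A ⊗[k] H)).flip u))
      (smashComul k WH WA coact (smashOne k WH WA act coact)))

/-- The map `εs` of the weak bialgebra `A ♯♯ H`: `u ↦ e₁ ε(u e₂)` where `e = 1_A ♯♯ 1_H`. -/
def smashEpsS (WH : WeakBialgebra k H) (WA : WeakBialgebra k A)
    (act : H →ₗ[k] A →ₗ[k] A) (coact : H →ₗ[k] H ⊗[k] A) (u : A ⊗[k] H) :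
    A ⊗[k] H :=
  (TensorProduct.rid k (A ⊗[k] H))
    ((LinearMap.lTensor (A ⊗[k] H)
        (smashCounit k WH WA ∘ₗ smashMul k WH act ∘ₗ
          TensorProduct.mk k (A ⊗[k] H) (A ⊗[k] H) u))
      (smashComul k WH WA coact (smashOne k WH WA act coact)))

/-- The antipode of `A ♯♯ H`:
`S(x ⊗ h) = (1_A ♯♯ S_H(h⁰)) ((S_A(x h¹)) ♯♯ 1_H)`. -/
def smashAntipode (WH : WeakBialgebra k H) (WA : WeakBialgebra k A)
    (act : H →ₗ[k] A →ₗ[k] A) (coact : H →ₗ[k] H ⊗[k] A)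
    (SH : H →ₗ[k] H) (SA : A →ₗ[k] A) : A ⊗[k] H →ₗ[k] A ⊗[k] H :=
  smashMul k WH act ∘ₗ
  TensorProduct.map
    (projBoth k WH WA act coact ∘ₗ TensorProduct.mk k A H 1)
    (projBoth k WH WA act coact ∘ₗ (TensorProduct.mk k A H).flip 1) ∘ₗ
  (TensorProduct.comm k A H).toLinearMap ∘ₗ
  TensorProduct.map (SA ∘ₗ LinearMap.mul' k A) SH ∘ₗ
  (TensorProduct.assoc k A A H).symm.toLinearMap ∘ₗ
  LinearMap.lTensor A ((TensorProduct.comm k H A).toLinearMap ∘ₗ coact)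

/-- LHS of condition (7): `(1_{H1} h⁰ · 1_A) ⊗ S_A(h¹) εs(1_{H2}¹) ⊗ 1_{H2}⁰`. -/
def cond7LHS (WH : WeakBialgebra k H) (WA : WeakBialgebra k A)
    (act : H →ₗ[k] A →ₗ[k] A) (coact : H →ₗ[k] H ⊗[k] A)
    (SA : A →ₗ[k] A) (h : H) : (A ⊗[k] A) ⊗[k] H :=
  (TensorProduct.assoc k A A H).symm
    ((TensorProduct.map
        (act.flip 1 ∘ₗ LinearMap.mul' k H)
        ((TensorProduct.comm k H A).toLinearMap ∘ₗ
          LinearMap.lTensor H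
            (LinearMap.mul' k A ∘ₗ TensorProduct.map SA WA.εs ∘ₗ
              (TensorProduct.comm k A A).toLinearMap) ∘ₗ
          (TensorProduct.assoc k H A A).toLinearMap ∘ₗ
          LinearMap.rTensor A coact))
      ((TensorProduct.tensorTensorTensorComm k H H H A)
        (WH.comul 1 ⊗ₜ[k] coact h)))

/-- RHS of condition (7):
`εt(1_{H1}⁰ h⁰ · 1_A) ⊗ εt(h¹) εs(1_{H2}¹) 1_{H1}¹ ⊗ 1_{H2}⁰`. -/
def cond7RHS (WH : WeakBialgebra k H) (WA : WeakBialgebra k A)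
    (act : H →ₗ[k] A →ₗ[k] A) (coact : H →ₗ[k] H ⊗[k] A) (h : H) :
    (A ⊗[k] A) ⊗[k] H :=
  (TensorProduct.assoc k A A H).symm
   ((LinearMap.lTensor A (TensorProduct.comm k H A).toLinearMap)
    ((TensorProduct.assoc k A H A)
     ((LinearMap.lTensor (A ⊗[k] H)
        (LinearMap.mul' k A ∘ₗ (TensorProduct.comm k A A).toLinearMap))
      ((TensorProduct.tensorTensorTensorComm k A A H A)
       ((LinearMap.lTensor (A ⊗[k] A) (TensorProduct.comm k A H).toLinearMap)
        ((TensorProduct.map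
            (LinearMap.rTensor A (WA.εt ∘ₗ act.flip 1 ∘ₗ LinearMap.mul' k H) ∘ₗ
              (TensorProduct.assoc k H H A).symm.toLinearMap ∘ₗ
              LinearMap.lTensor H (TensorProduct.comm k A H).toLinearMap ∘ₗ
              (TensorProduct.assoc k H A H).toLinearMap)
            (LinearMap.rTensor H
                (LinearMap.mul' k A ∘ₗ (TensorProduct.comm k A A).toLinearMap ∘ₗ
                  TensorProduct.map WA.εs WA.εt) ∘ₗ
              (TensorProduct.assoc k A A H).symm.toLinearMap ∘ₗ
              LinearMap.lTensor A (TensorProduct.comm k H A).toLinearMap ∘ₗ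
              (TensorProduct.assoc k A H A).toLinearMap ∘ₗ
              LinearMap.rTensor A (TensorProduct.comm k H A).toLinearMap))
          ((TensorProduct.tensorTensorTensorComm k (H ⊗[k] A) (H ⊗[k] A) H A)
            (((TensorProduct.map coact coact) (WH.comul 1)) ⊗ₜ[k] coact h))))))))

/-- LHS of condition (8):
`εs(h₁¹ h₂¹) (S_H(h₁⁰) · 1_A) ⊗ S_H(h₂⁰) h₃`. -/
def cond8LHS (WH : WeakBialgebra k H) (WA : WeakBialgebra k A)
    (act : H →ₗ[k] A →ₗ[k] A) (coact : H →ₗ[k] H ⊗[k] A)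
    (SH : H →ₗ[k] H) (h : H) : A ⊗[k] H :=
  LinearMap.rTensor H (LinearMap.mul' k A)
   ((TensorProduct.assoc k A A H).symm
    ((TensorProduct.map
        (WA.εs ∘ₗ LinearMap.mul' k A)
        (TensorProduct.map (act.flip 1 ∘ₗ SH)
          (LinearMap.mul' k H ∘ₗ LinearMap.rTensor H SH)))
      ((TensorProduct.tensorTensorTensorComm k A H A (H ⊗[k] H))
        ((TensorProduct.map (TensorProduct.comm k H A).toLinearMap
            ((TensorProduct.assoc k A H H).toLinearMap ∘ₗ
              LinearMap.rTensor H (TensorProduct.comm k H A).toLinearMap))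
          ((TensorProduct.map coact (LinearMap.rTensor H coact))
            (twoComul k WH h))))))

/-- RHS of condition (8):
`εs(h¹ 1_{H2}¹) εs(h⁰ 1_{H1} · 1_A) ⊗ 1_{H2}⁰`. -/
def cond8RHS (WH : WeakBialgebra k H) (WA : WeakBialgebra k A)
    (act : H →ₗ[k] A →ₗ[k] A) (coact : H →ₗ[k] H ⊗[k] A) (h : H) :
    A ⊗[k] H :=
  LinearMap.rTensor H (LinearMap.mul' k A ∘ₗ (TensorProduct.comm k A A).toLinearMap)
   ((TensorProduct.assoc k A A H).symm
    ((TensorProduct.map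
        (WA.εs ∘ₗ act.flip 1 ∘ₗ LinearMap.mul' k H)
        (LinearMap.rTensor H (WA.εs ∘ₗ LinearMap.mul' k A) ∘ₗ
          (TensorProduct.assoc k A A H).symm.toLinearMap ∘ₗ
          LinearMap.lTensor A (TensorProduct.comm k H A).toLinearMap))
      ((TensorProduct.tensorTensorTensorComm k H A H (H ⊗[k] A))
        (coact h ⊗ₜ[k] (LinearMap.lTensor H coact) (WH.comul 1)))))

/-- The element `εs(t₁¹ (t₂ · 1_A)) ⊗ t₁⁰` of `A ⊗ H`. -/
def integralWitness (WH : WeakBialgebra k H) (WA : WeakBialgebra k A)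
    (act : H →ₗ[k] A →ₗ[k] A) (coact : H →ₗ[k] H ⊗[k] A) (t : H) :
    A ⊗[k] H :=
  (TensorProduct.comm k H A)
    ((LinearMap.lTensor H (WA.εs ∘ₗ LinearMap.mul' k A))
      ((TensorProduct.assoc k H A A)
        ((LinearMap.rTensor A coact)
          ((LinearMap.lTensor H (act.flip 1)) (WH.comul t)))))

end MatchedPair

end WeakSmash

namespace WeakSmash

section Sweedler

variable {k M N P Q R : Type*} [Field k] [AddCommMonoid M] [Module k M]
  [AddCommMonoid N] [Module k N] [AddCommMonoid P] [Module k P] [AddCommMonoid Q] [Module k Q]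
  [AddCommMonoid R] [Module k R]

attribute [fun_prop] IsLinearMap

/-- The Sweedler sum `∑ F x₁ x₂` over a decomposition `f x = ∑ x₁ ⊗ x₂`. -/
def sw (f : Q →ₗ[k] M ⊗[k] N) (x : Q) (F : M → N → P) : P :=
  ∑ p ∈ (TensorProduct.exists_finset (f x)).choose, F p.1 p.2

@[fun_prop] theorem lin_id : IsLinearMap k (fun x : M => x) := ⟨fun _ _ => rfl, fun _ _ => rfl⟩

@[fun_prop] theorem lin_comp {f : N → P} {g : M → N} (hf : IsLinearMap k f)
    (hg : IsLinearMap k g) : IsLinearMap k (fun x : M => f (g x)) :=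
  ⟨fun _ _ => by rw [hg.map_add, hf.map_add], fun _ _ => by rw [hg.map_smul, hf.map_smul]⟩

@[fun_prop] theorem lin_map (f : N →ₗ[k] P) : IsLinearMap k (fun x => f x) := f.isLinear

@[fun_prop] theorem lin_map₂ (f : M →ₗ[k] N →ₗ[k] P) (b : N) : IsLinearMap k (fun x => f x b) :=
  (f.flip b).isLinear

@[fun_prop] theorem lin_tmul_left (b : N) : IsLinearMap k (fun x : M => x ⊗ₜ[k] b) :=
  ((TensorProduct.mk k M N).flip b).isLinear

@[fun_prop] theorem lin_tmul_right (b : M) : IsLinearMap k (fun x : N => b ⊗ₜ[k] x) :=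
  ((TensorProduct.mk k M N) b).isLinear

@[fun_prop] theorem lin_smul_left (b : M) : IsLinearMap k (fun x : k => x • b) :=
  (LinearMap.toSpanSingleton k M b).isLinear

@[fun_prop] theorem lin_smul_right (b : k) : IsLinearMap k (fun x : M => b • x) :=
  (LinearMap.lsmul k M b).isLinear

section
variable {B : Type*} [Ring B]

@[simp] theorem sw_mul (f : Q →ₗ[k] M ⊗[k] N) (x : Q) (F : M → N → B) (y : B) :
    sw f x F * y = sw f x (fun a b => F a b * y) := Finset.sum_mul ..

@[simp] theorem mul_sw (f : Q →ₗ[k] M ⊗[k] N) (x : Q) (F : M → N → B) (y : B) :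
    y * sw f x F = sw f x (fun a b => y * F a b) := Finset.mul_sum ..

variable [Algebra k B]

@[fun_prop] theorem lin_mul_left (b : B) : IsLinearMap k (fun x : B => x * b) :=
  (LinearMap.mulRight k b).isLinear

@[fun_prop] theorem lin_mul_right (b : B) : IsLinearMap k (fun x : B => b * x) :=
  (LinearMap.mulLeft k b).isLinear

end

/-- The linear map on a tensor product induced by a bilinear function. -/
def ev (F : M → N → P) (h1 : ∀ a, IsLinearMap k (fun b => F a b) := by intros; fun_prop)
    (h2 : ∀ b, IsLinearMap k (fun a => F a b) := by intros; fun_prop) : M ⊗[k] N →ₗ[k] P :=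
  TensorProduct.lift (LinearMap.mk₂ k F (fun a b c => (h2 c).map_add a b)
    (fun a b c => (h2 c).map_smul a b) (fun a b c => (h1 a).map_add b c)
    (fun a b c => (h1 b).map_smul a c))

@[simp] theorem ev_tmul (F : M → N → P) (h1 : ∀ a, IsLinearMap k (fun b => F a b))
    (h2 : ∀ b, IsLinearMap k (fun a => F a b)) (a : M) (b : N) : ev F h1 h2 (a ⊗ₜ b) = F a b := by
  simp [ev]

@[simp] theorem map_sw (L : P →ₗ[k] R) (f : Q →ₗ[k] M ⊗[k] N) (x : Q) (F : M → N → P) :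
    L (sw f x F) = sw f x (fun a b => L (F a b)) := map_sum ..

@[simp] theorem equiv_sw (L : P ≃ₗ[k] R) (f : Q →ₗ[k] M ⊗[k] N) (x : Q) (F : M → N → P) :
    L (sw f x F) = sw f x (fun a b => L (F a b)) := map_sum ..

@[simp] theorem smul_sw (f : Q →ₗ[k] M ⊗[k] N) (x : Q) (F : M → N → P) (y : k) :
    y • sw f x F = sw f x (fun a b => y • F a b) := Finset.smul_sum

@[simp] theorem sw_smul (f : Q →ₗ[k] M ⊗[k] N) (x : Q) (F : M → N → k) (y : P) :
    sw f x F • y = sw f x (fun a b => F a b • y) := Finset.sum_smul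

@[simp] theorem sw_tmul (f : Q →ₗ[k] M ⊗[k] N) (x : Q) (F : M → N → P) (y : R) :
    sw f x F ⊗ₜ[k] y = sw f x (fun a b => F a b ⊗ₜ[k] y) := TensorProduct.sum_tmul ..

@[simp] theorem tmul_sw (f : Q →ₗ[k] M ⊗[k] N) (x : Q) (F : M → N → P) (y : R) :
    y ⊗ₜ[k] sw f x F = sw f x (fun a b => y ⊗ₜ[k] F a b) := TensorProduct.tmul_sum ..

@[simp] theorem smul_tmul_left (r : k) (x : M) (y : N) : (r • x) ⊗ₜ[k] y = r • (x ⊗ₜ[k] y) :=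
  (TensorProduct.smul_tmul' r x y).symm

theorem expand (f : Q →ₗ[k] M ⊗[k] N) (x : Q) : f x = sw f x (fun a b => a ⊗ₜ[k] b) :=
  (TensorProduct.exists_finset (f x)).choose_spec

theorem sw_eq_ev (f : Q →ₗ[k] M ⊗[k] N) (x : Q) (F : M → N → P)
    (h1 : ∀ a, IsLinearMap k (fun b => F a b)) (h2 : ∀ b, IsLinearMap k (fun a => F a b)) :
    sw f x F = ev F h1 h2 (f x) := by
  rw [expand f x, map_sw]; simp only [ev_tmul]

theorem sw_congr {T : Type*} [AddCommMonoid T] {F G : M → N → T}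
    (f : Q →ₗ[k] M ⊗[k] N) (x : Q) (h : ∀ a b, F a b = G a b) :
    sw f x F = sw f x G := by
  have : F = G := by ext; apply h
  rw [this]

theorem sw_swap {T Q' M' N' : Type*} [AddCommMonoid T] [AddCommMonoid M'] [Module k M']
    [AddCommMonoid N'] [Module k N']
    [AddCommMonoid Q'] [Module k Q'] (f : Q →ₗ[k] M ⊗[k] N) (x : Q) (g : Q' →ₗ[k] M' ⊗[k] N')
    (y : Q') (F : M → N → M' → N' → T) :
    sw f x (fun a b => sw g y (fun c d => F a b c d)) =
      sw g y (fun c d => sw f x (fun a b => F a b c d)) := Finset.sum_comm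

@[fun_prop] theorem lin_sw_left (f : Q →ₗ[k] M ⊗[k] N) {F : M → N → P}
    (h1 : ∀ a, IsLinearMap k (fun b => F a b)) (h2 : ∀ b, IsLinearMap k (fun a => F a b)) :
    IsLinearMap k (fun x => sw f x (fun a b => F a b)) := by
  simp only [sw_eq_ev _ _ _ h1 h2]
  exact lin_comp (LinearMap.isLinear _) f.isLinear

@[fun_prop] theorem lin_sw_right {Q' : Type*} [AddCommMonoid Q'] [Module k Q']
    (f : Q →ₗ[k] M ⊗[k] N) (y : Q) {F : Q' → M → N → P}
    (h1 : ∀ a b, IsLinearMap k (fun x => F x a b)) :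
    IsLinearMap k (fun x => sw f y (fun a b => F x a b)) := by
  constructor
  · intro x y; simp only [sw, (h1 _ _).map_add, Finset.sum_add_distrib]
  · intro x y; simp only [sw, (h1 _ _).map_smul, Finset.smul_sum]

/-- The linear map on a threefold tensor product induced by a trilinear function. -/
def ev₃ (F : M → N → P → R)
    (h1 : ∀ a b, IsLinearMap k (fun c => F a b c) := by intros; fun_prop)
    (h2 : ∀ a c, IsLinearMap k (fun b => F a b c) := by intros; fun_prop)
    (h3 : ∀ b c, IsLinearMap k (fun a => F a b c) := by intros; fun_prop) :
    M ⊗[k] (N ⊗[k] P) →ₗ[k] R :=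
  TensorProduct.lift (LinearMap.mk₂ k (fun a t => ev (F a) (h1 a) (h2 a) t)
    (fun a b c => by
      have e := fun a => sw_eq_ev LinearMap.id c (F a) (h1 a) (h2 a)
      simp only [LinearMap.id_apply] at e
      simp only [← e, sw, (h3 _ _).map_add, Finset.sum_add_distrib])
    (fun a b c => by
      have e := fun a => sw_eq_ev LinearMap.id c (F a) (h1 a) (h2 a)
      simp only [LinearMap.id_apply] at e
      simp only [← e, sw, (h3 _ _).map_smul, Finset.smul_sum])
    (fun a b c => map_add _ _ _) (fun a b c => map_smul _ _ _))

@[simp] theorem ev₃_tmul (F : M → N → P → R) (h1 : ∀ a b, IsLinearMap k (fun c => F a b c))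
    (h2 : ∀ a c, IsLinearMap k (fun b => F a b c)) (h3 : ∀ b c, IsLinearMap k (fun a => F a b c))
    (a : M) (b : N) (c : P) : ev₃ F h1 h2 h3 (a ⊗ₜ (b ⊗ₜ c)) = F a b c := by
  simp [ev₃, ev_tmul]

end Sweedler

namespace WeakBialgebra

variable {k H P : Type*} [Field k] [Ring H] [Algebra k H] [AddCommMonoid P] [Module k P]
  (W : WeakBialgebra k H)

theorem sw_coassoc (h : H) {F : H → H → H → P}
    (h1 : ∀ a b, IsLinearMap k (fun c => F a b c))
    (h2 : ∀ a c, IsLinearMap k (fun b => F a b c))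
    (h3 : ∀ b c, IsLinearMap k (fun a => F a b c)) :
    sw W.comul h (fun a b => sw W.comul a fun c d => F c d b) =
      sw W.comul h (fun a b => sw W.comul b fun c d => F a c d) := by
  have := congrArg (ev₃ F) (W.coassoc h)
  simpa [expand W.comul] using this

theorem sw_counit_left (h : H) {F : H → P} (h1 : IsLinearMap k F) :
    sw W.comul h (fun a b => W.counit a • F b) = F h := by
  simpa [expand W.comul] using congrArg h1.mk' (W.counit_comul h)

theorem sw_counit_right (h : H) {F : H → P} (h1 : IsLinearMap k F) :
    sw W.comul h (fun a b => W.counit b • F a) = F h := by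
  simpa [expand W.comul] using congrArg h1.mk' (W.comul_counit h)

theorem sw_comul_mul (h g : H) {F : H → H → P}
    (h1 : ∀ a, IsLinearMap k (fun b => F a b)) (h2 : ∀ b, IsLinearMap k (fun a => F a b)) :
    sw W.comul (h * g) F =
      sw W.comul h fun a b => sw W.comul g fun c d => F (a * c) (b * d) := by
  rw [sw_eq_ev _ _ _ h1 h2, W.comul_mul, sw_swap]
  simp [expand W.comul]

theorem counit_mul_mul' (h g l : H) :
    W.counit (h * g * l) = sw W.comul g fun a b => W.counit (h * b) * W.counit (a * l) := by
  rw [W.counit_weak']; simp [expand W.comul]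

theorem εt_eq (h : H) : W.εt h = sw W.comul 1 fun a b => W.counit (a * h) • b := by
  simp [εt, expand W.comul]

theorem εs_eq (h : H) : W.εs h = sw W.comul 1 fun a b => W.counit (h * b) • a := by
  simp [εs, expand W.comul]

theorem sw_one_left (F : H → H → H → P)
    (h1 : ∀ a b, IsLinearMap k (fun c => F a b c) := by intros; fun_prop)
    (h2 : ∀ a c, IsLinearMap k (fun b => F a b c) := by intros; fun_prop)
    (h3 : ∀ b c, IsLinearMap k (fun a => F a b c) := by intros; fun_prop) :
    (sw W.comul 1 fun a b => sw W.comul 1 fun c d => F a (b * c) d) =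
      sw W.comul 1 fun a b => sw W.comul b fun c d => F a c d := by
  rw [sw_swap]
  have := congrArg (ev₃ F) W.comul_one_left
  simpa [expand W.comul] using this

theorem sw_one_right (F : H → H → H → P)
    (h1 : ∀ a b, IsLinearMap k (fun c => F a b c) := by intros; fun_prop)
    (h2 : ∀ a c, IsLinearMap k (fun b => F a b c) := by intros; fun_prop)
    (h3 : ∀ b c, IsLinearMap k (fun a => F a b c) := by intros; fun_prop) :
    (sw W.comul 1 fun a b => sw W.comul 1 fun c d => F a (c * b) d) =
      sw W.comul 1 fun a b => sw W.comul b fun c d => F a c d := by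
  have := congrArg (ev₃ F) W.comul_one_right
  simp [expand W.comul] at this
  rw [← this]

end WeakBialgebra

namespace WeakBialgebra

variable {k H P : Type*} [Field k] [Ring H] [Algebra k H] [AddCommMonoid P] [Module k P]
  (W : WeakBialgebra k H)

theorem sw_one_mul (h : H) (F : H → H → P)
    (h1 : ∀ a, IsLinearMap k (fun b => F a b) := by intros; fun_prop)
    (h2 : ∀ b, IsLinearMap k (fun a => F a b) := by intros; fun_prop) :
    (sw W.comul 1 fun a b => sw W.comul h fun c d => F (a * c) (b * d)) = sw W.comul h F := by
  rw [← W.sw_comul_mul _ _ h1 h2, one_mul]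

theorem sw_mul_one (h : H) (F : H → H → P)
    (h1 : ∀ a, IsLinearMap k (fun b => F a b) := by intros; fun_prop)
    (h2 : ∀ b, IsLinearMap k (fun a => F a b) := by intros; fun_prop) :
    (sw W.comul h fun a b => sw W.comul 1 fun c d => F (a * c) (b * d)) = sw W.comul h F := by
  rw [← W.sw_comul_mul _ _ h1 h2, mul_one]

theorem sw_εt_right (h : H) (F : H → H → P)
    (h1 : ∀ a, IsLinearMap k (fun b => F a b) := by intros; fun_prop)
    (h2 : ∀ b, IsLinearMap k (fun a => F a b) := by intros; fun_prop) :
    sw W.comul h (fun a b => F a (W.εt b)) = sw W.comul 1 fun a b => F (a * h) b := by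
  suffices e : sw W.comul h (fun a b => a ⊗ₜ[k] (W.εt b)) =
      sw W.comul 1 fun a b => (a * h) ⊗ₜ[k] b by
    have := congrArg (ev F) e
    simpa using this
  symm
  calc _ = sw W.comul 1 fun a b => sw W.comul a fun a1 a2 => sw W.comul h fun c d =>
          W.counit (a2 * d) • ((a1 * c) ⊗ₜ[k] b) := by
        refine sw_congr _ _ fun a b => ?_
        rw [← W.sw_comul_mul a h (F := fun x y => W.counit y • (x ⊗ₜ[k] b)) (by fun_prop)
          (by fun_prop), W.sw_counit_right _ (by fun_prop)]
    _ = sw W.comul 1 fun a b => sw W.comul b fun a2 b => sw W.comul h fun c d =>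
          W.counit (a2 * d) • ((a * c) ⊗ₜ[k] b) :=
        W.sw_coassoc 1 (F := fun a1 a2 b => sw W.comul h fun c d =>
          W.counit (a2 * d) • ((a1 * c) ⊗ₜ[k] b)) (by fun_prop) (by fun_prop) (by fun_prop)
    _ = sw W.comul 1 fun c d => sw W.comul 1 fun a b => sw W.comul h fun x y =>
          W.counit (c * (b * y)) • ((a * x) ⊗ₜ[k] d) := by
        rw [← W.sw_one_right fun a a2 b => sw W.comul h fun c d =>
          W.counit (a2 * d) • ((a * c) ⊗ₜ[k] b), sw_swap]
        simp only [mul_assoc]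
    _ = sw W.comul 1 fun c d => sw W.comul h fun x y => W.counit (c * y) • (x ⊗ₜ[k] d) :=
        sw_congr _ _ fun c d => W.sw_one_mul h fun x y => W.counit (c * y) • (x ⊗ₜ[k] d)
    _ = _ := by
        rw [sw_swap]
        simp [εt_eq]

theorem sw_εs_left (h : H) (F : H → H → P)
    (h1 : ∀ a, IsLinearMap k (fun b => F a b) := by intros; fun_prop)
    (h2 : ∀ b, IsLinearMap k (fun a => F a b) := by intros; fun_prop) :
    sw W.comul h (fun a b => F (W.εs a) b) = sw W.comul 1 fun a b => F a (h * b) := by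
  suffices e : sw W.comul h (fun a b => (W.εs a) ⊗ₜ[k] b) =
      sw W.comul 1 fun a b => a ⊗ₜ[k] (h * b) by
    have := congrArg (ev F) e
    simpa using this
  symm
  calc _ = sw W.comul 1 fun a b => sw W.comul b fun b1 b2 => sw W.comul h fun c d =>
          W.counit (c * b1) • (a ⊗ₜ[k] (d * b2)) := by
        refine sw_congr _ _ fun a b => ?_
        rw [sw_swap, ← W.sw_comul_mul h b (F := fun x y => W.counit x • (a ⊗ₜ[k] y)) (by fun_prop)
          (by fun_prop), W.sw_counit_left _ (by fun_prop)]
    _ = sw W.comul 1 fun a b => sw W.comul h fun x y => sw W.comul 1 fun c d =>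
          W.counit (x * c * b) • (a ⊗ₜ[k] (y * d)) := by
        rw [← W.sw_one_right fun a b1 b2 => sw W.comul h fun c d =>
          W.counit (c * b1) • (a ⊗ₜ[k] (d * b2))]
        refine sw_congr _ _ fun a b => ?_
        rw [sw_swap]
        simp only [mul_assoc]
    _ = sw W.comul 1 fun a b => sw W.comul h fun x y => W.counit (x * b) • (a ⊗ₜ[k] y) :=
        sw_congr _ _ fun a b => W.sw_mul_one h fun x y => W.counit (x * b) • (a ⊗ₜ[k] y)
    _ = _ := by
        rw [sw_swap]
        simp [εs_eq]

theorem sw_comul_εt (h : H) {F : H → H → P}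
    (h1 : ∀ a, IsLinearMap k (fun b => F a b)) (h2 : ∀ b, IsLinearMap k (fun a => F a b)) :
    sw W.comul (W.εt h) F = sw W.comul 1 fun a b => F (a * W.εt h) b := by
  suffices e : sw W.comul (W.εt h) (fun a b => a ⊗ₜ[k] b) =
      sw W.comul 1 fun a b => (a * W.εt h) ⊗ₜ[k] b by
    have := congrArg (ev F) e
    simpa using this
  rw [← expand, εt_eq, map_sw]
  simp only [map_smul]
  have := W.sw_one_right fun a b c => W.counit (a * h) • (b ⊗ₜ[k] c)
  simp [expand W.comul] at this ⊢
  rw [← this, sw_swap]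

theorem sw_comul_εs (h : H) {F : H → H → P}
    (h1 : ∀ a, IsLinearMap k (fun b => F a b)) (h2 : ∀ b, IsLinearMap k (fun a => F a b)) :
    sw W.comul (W.εs h) F = sw W.comul 1 fun a b => F a (b * W.εs h) := by
  suffices e : sw W.comul (W.εs h) (fun a b => a ⊗ₜ[k] b) =
      sw W.comul 1 fun a b => a ⊗ₜ[k] (b * W.εs h) by
    have := congrArg (ev F) e
    simpa using this
  rw [← expand, εs_eq, map_sw]
  simp only [map_smul]
  have := W.sw_one_left fun a b c => W.counit (h * c) • (a ⊗ₜ[k] b)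
  simp [expand W.comul] at this ⊢
  rw [this]
  exact W.sw_coassoc 1 (F := fun a b c => W.counit (h * c) • (a ⊗ₜ[k] b)) (by fun_prop)
    (by fun_prop) (by fun_prop)

theorem εs_one : W.εs 1 = 1 := by
  have := W.sw_counit_right 1 lin_id
  simpa [εs_eq]

variable {W} {S : H →ₗ[k] H}

theorem IsAntipode.sw_mul (hS : W.IsAntipode S) (h : H) :
    sw W.comul h (fun a b => a * S b) = W.εt h := by
  rw [← hS.mul_antipode]; simp [expand W.comul]

theorem IsAntipode.mul_sw (hS : W.IsAntipode S) (h : H) :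
    sw W.comul h (fun a b => S a * b) = W.εs h := by
  rw [← hS.antipode_mul]; simp [expand W.comul]

theorem IsAntipode.sw_mul_εt (hS : W.IsAntipode S) (h : H) :
    sw W.comul h (fun a b => S a * W.εt b) = S h := by
  rw [← hS.antipode_mid]; simp [expand W.comul, ← hS.sw_mul]

theorem IsAntipode.sw_εs_mul (hS : W.IsAntipode S) (h : H) :
    sw W.comul h (fun a b => W.εs a * S b) = S h := by
  rw [← hS.antipode_mid]; simp [expand W.comul, ← hS.mul_sw]
  rw [W.sw_coassoc h (F := fun a b c => S a * b * S c) (by fun_prop) (by fun_prop) (by fun_prop)]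
  simp only [mul_assoc]

end WeakBialgebra

namespace WeakBialgebra

section
variable {k H P : Type*} [Field k] [Ring H] [Algebra k H] [AddCommMonoid P] [Module k P]
  {W : WeakBialgebra k H}

theorem Cocomm.sw_comm (hW : W.Cocomm) (h : H) {F : H → H → P}
    (h1 : ∀ a, IsLinearMap k (fun b => F a b)) (h2 : ∀ b, IsLinearMap k (fun a => F a b)) :
    sw W.comul h F = sw W.comul h fun a b => F b a := by
  rw [sw_eq_ev _ _ _ h1 h2, ← hW h]
  simp [expand W.comul]

theorem Cocomm.sw_εt_left (hW : W.Cocomm) (h : H) (F : H → H → P)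
    (h1 : ∀ a, IsLinearMap k (fun b => F a b) := by intros; fun_prop)
    (h2 : ∀ b, IsLinearMap k (fun a => F a b) := by intros; fun_prop) :
    sw W.comul h (fun a b => F (W.εt a) b) = sw W.comul 1 fun a b => F a (b * h) := by
  rw [hW.sw_comm _ (by fun_prop) (by fun_prop), W.sw_εt_right h fun a b => F b a,
    hW.sw_comm _ (by fun_prop) (by fun_prop)]

theorem Cocomm.sw_εs_right (hW : W.Cocomm) (h : H) (F : H → H → P)
    (h1 : ∀ a, IsLinearMap k (fun b => F a b) := by intros; fun_prop)
    (h2 : ∀ b, IsLinearMap k (fun a => F a b) := by intros; fun_prop) :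
    sw W.comul h (fun a b => F a (W.εs b)) = sw W.comul 1 fun a b => F (h * a) b := by
  rw [hW.sw_comm _ (by fun_prop) (by fun_prop), W.sw_εs_left h fun a b => F b a,
    hW.sw_comm _ (by fun_prop) (by fun_prop)]
end

section
variable {k A P : Type*} [Field k] [CommRing A] [Algebra k A] [AddCommMonoid P] [Module k P]
  (W : WeakBialgebra k A)

theorem counit_mul_εt (x y : A) : W.counit (x * W.εt y) = W.counit (x * y) := by
  have := W.counit_mul_mul' x 1 y
  simp only [mul_one] at this
  simp [this, εt_eq, mul_comm]

theorem counit_mul_εs (x y : A) : W.counit (x * W.εs y) = W.counit (x * y) := by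
  have := W.counit_mul_mul' y 1 x
  simp only [mul_one] at this
  simp [mul_comm x y, this, εs_eq, mul_comm x]

theorem sw_counit_mul_right (x y : A) :
    sw W.comul x (fun a b => W.counit (y * b) • a) = W.εs y * x := by
  have := W.sw_εt_right x fun a b => W.counit (y * b) • a
  simp only [counit_mul_εt] at this
  simp [this, εs_eq]

theorem sw_counit_mul_left (x y : A) :
    sw W.comul x (fun a b => W.counit (a * y) • b) = x * W.εt y := by
  have := W.sw_εs_left x fun a b => W.counit (a * y) • b
  simp only [mul_comm _ y, counit_mul_εs] at this
  simp only [mul_comm _ y, this, εt_eq]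
  simp

theorem sw_counit_mul_left' (x y : A) :
    sw W.comul x (fun a b => W.counit (y * a) • b) = W.εt y * x := by
  rw [mul_comm, ← sw_counit_mul_left]; simp only [mul_comm y]

theorem εs_mul_εs (x y : A) : W.εs (x * W.εs y) = W.εs x * W.εs y := by
  rw [← sw_counit_mul_right, sw_comul_εs _ _ (by fun_prop) (by fun_prop), εs_eq]
  simp only [mul_assoc, mul_comm (W.εs y)]

theorem εs_mul (x y : A) : W.εs (x * y) = W.εs x * W.εs y := by
  rw [← εs_mul_εs, εs_eq, εs_eq]
  simp only [mul_right_comm x (W.εs y), counit_mul_εs, mul_right_comm x y]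

theorem εt_mul (x y : A) : W.εt (x * y) = W.εt x * W.εt y := by
  rw [mul_comm (W.εt x), ← sw_counit_mul_left, sw_comul_εt _ _ (by fun_prop) (by fun_prop), εt_eq]
  simp only [← mul_assoc, mul_right_comm _ (W.εt y) x, counit_mul_εt]

theorem εs_εs (x : A) : W.εs (W.εs x) = W.εs x := by
  simpa [εs_one] using W.εs_mul_εs 1 x

theorem εt_εs (x : A) : W.εt (W.εs x) = W.εt x := by
  rw [εt_eq W x, εt_eq]
  simp only [counit_mul_εs]

theorem sw_comul_mul_εs (x y : A) (hy : W.εs y = y) {F : A → A → P}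
    (h1 : ∀ a, IsLinearMap k (fun b => F a b)) (h2 : ∀ b, IsLinearMap k (fun a => F a b)) :
    sw W.comul (y * x) F = sw W.comul x fun a b => F a (y * b) := by
  rw [W.sw_comul_mul _ _ h1 h2, ← hy, W.sw_comul_εs y (F := fun a b => sw W.comul x fun c d =>
    F (a * c) (b * d)) (by fun_prop) (by fun_prop), ← W.sw_one_mul x fun a b => F a (W.εs y * b)]
  simp only [mul_left_comm, mul_assoc]

theorem sw_comul_mul_εt (x y : A) (hy : W.εt y = y) {F : A → A → P}
    (h1 : ∀ a, IsLinearMap k (fun b => F a b)) (h2 : ∀ b, IsLinearMap k (fun a => F a b)) :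
    sw W.comul (y * x) F = sw W.comul x fun a b => F (y * a) b := by
  rw [W.sw_comul_mul _ _ h1 h2, ← hy, W.sw_comul_εt y (F := fun a b => sw W.comul x fun c d =>
    F (a * c) (b * d)) (by fun_prop) (by fun_prop), ← W.sw_one_mul x fun a b => F (W.εt y * a) b]
  simp only [mul_left_comm, mul_assoc]

variable {W} {S : A →ₗ[k] A}

theorem IsAntipode.map_mul (hS : W.IsAntipode S) (x y : A) : S (x * y) = S x * S y := by
  calc S (x * y) = sw W.comul x fun a b => sw W.comul y fun c d => S (a * c) * W.εt (b * d) := by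
        rw [← hS.sw_mul_εt, W.sw_comul_mul _ _ (by fun_prop) (by fun_prop)]
    _ = sw W.comul x fun a b => sw W.comul b fun b1 b2 => sw W.comul y fun c d =>
          sw W.comul d fun d1 d2 => S (a * c) * (b1 * d1) * (S b2 * S d2) := by
        refine sw_congr _ _ fun a b => ?_
        rw [sw_swap]
        refine sw_congr _ _ fun c d => ?_
        rw [εt_mul, ← hS.sw_mul, ← hS.sw_mul]
        simp only [WeakSmash.sw_mul, WeakSmash.mul_sw]
        rw [sw_swap]
        refine sw_congr _ _ fun _ _ => sw_congr _ _ fun _ _ => by ring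
    _ = sw W.comul x fun a b => sw W.comul a fun a1 a2 => sw W.comul y fun c d =>
          sw W.comul c fun c1 c2 => S (a1 * c1) * (a2 * c2) * (S b * S d) := by
        rw [W.sw_coassoc x (F := fun a1 a2 b => sw W.comul y fun c d =>
          sw W.comul c fun c1 c2 => S (a1 * c1) * (a2 * c2) * (S b * S d)) (by fun_prop)
          (by fun_prop) (by fun_prop)]
        refine sw_congr _ _ fun _ _ => sw_congr _ _ fun _ _ => ?_
        exact (W.sw_coassoc y (by fun_prop) (by fun_prop) (by fun_prop)).symm
    _ = sw W.comul x fun a b => sw W.comul y fun c d => W.εs (a * c) * (S b * S d) := by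
        refine sw_congr _ _ fun a b => ?_
        rw [sw_swap]
        refine sw_congr _ _ fun c d => ?_
        rw [← hS.mul_sw, W.sw_comul_mul _ _ (by fun_prop) (by fun_prop)]
        simp only [WeakSmash.sw_mul]
    _ = _ := by
        rw [← hS.sw_εs_mul x, ← hS.sw_εs_mul y]
        simp only [WeakSmash.sw_mul, WeakSmash.mul_sw]
        rw [sw_swap]
        refine sw_congr _ _ fun _ _ => sw_congr _ _ fun _ _ => ?_
        rw [εs_mul]; ring

theorem IsAntipode.map_εs (hS : W.IsAntipode S) {x : A} (hx : W.εs x = x) : S x = W.εt x := by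
  rw [← hS.sw_mul, ← hS.sw_εs_mul, ← hx, W.sw_comul_εs x (F := fun a b => W.εs a * S b)
    (by fun_prop) (by fun_prop), W.sw_comul_εs x (F := fun a b => a * S b) (by fun_prop)
      (by fun_prop)]
  have := W.sw_εs_left 1 fun a b => a * S (b * W.εs x)
  simpa using this

end

end WeakBialgebra

/-- A compatible weak matched pair, bundled. -/
structure CompatiblePair (k H A : Type*) [Field k] [Ring H] [Algebra k H] [CommRing A]
    [Algebra k A] where
  WH : WeakBialgebra k H
  WA : WeakBialgebra k A
  act : H →ₗ[k] A →ₗ[k] A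
  coact : H →ₗ[k] H ⊗[k] A
  isCompatible : IsCompatiblePair k WH WA act coact

namespace CompatiblePair

variable {k H A P : Type*} [Field k] [Ring H] [Algebra k H] [CommRing A] [Algebra k A]
  [AddCommMonoid P] [Module k P] (p : CompatiblePair k H A)

/-- The map `h ↦ h · 1`. -/
def a : H →ₗ[k] A := p.act.flip 1

/-- The map `h ↦ ε(h⁰) h¹`. -/
def b : H →ₗ[k] A := coactCounit k p.WH p.coact

theorem cocomm : p.WH.Cocomm := p.isCompatible.cocomm

theorem act_one (h : H) : p.act h 1 = p.a h := rfl

theorem one_act (x : A) : p.act 1 x = x := p.isCompatible.pair.moduleAlgebra.one_act x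

theorem act_act (h g : H) (x : A) : p.act h (p.act g x) = p.act (h * g) x :=
  p.isCompatible.pair.moduleAlgebra.act_act h g x

theorem act_a (h g : H) : p.act h (p.a g) = p.a (h * g) := p.act_act h g 1

theorem a_unit : p.a 1 = 1 := p.one_act 1

theorem a_εt (h : H) : p.a (p.WH.εt h) = p.a h :=
  (p.isCompatible.pair.moduleAlgebra.act_unit h).symm

theorem act_mul (h : H) (x y : A) :
    p.act h (x * y) = sw p.WH.comul h fun u v => p.act u x * p.act v y := by
  rw [p.isCompatible.pair.moduleAlgebra.act_mul]; simp [expand p.WH.comul]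

theorem sw_a_mul_act (h : H) (x : A) :
    sw p.WH.comul h (fun u v => p.a u * p.act v x) = p.act h x := by
  simpa [act_one] using (p.act_mul h 1 x).symm

theorem b_eq (h : H) : p.b h = sw p.coact h fun u x => p.WH.counit u • x := by
  simp [b, coactCounit, expand p.coact]

theorem εs_b (h : H) : p.WA.εs (p.b h) = p.b h :=
  (p.isCompatible.pair.comoduleCoalgebra.coact_counit h).symm

theorem sw_counit_coact (h : H) {F : H → P} (h1 : IsLinearMap k F) :
    sw p.coact h (fun u x => p.WA.counit x • F u) = F h := by
  simpa [expand p.coact] using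
    congrArg h1.mk' (p.isCompatible.pair.comoduleCoalgebra.counit_coact h)

theorem sw_comul_coact (h : H) (F : H → H → A → P)
    (h1 : ∀ a b, IsLinearMap k (fun c => F a b c) := by intros; fun_prop)
    (h2 : ∀ a c, IsLinearMap k (fun b => F a b c) := by intros; fun_prop)
    (h3 : ∀ b c, IsLinearMap k (fun a => F a b c) := by intros; fun_prop) :
    (sw p.coact h fun u x => sw p.WH.comul u fun u1 u2 => F u1 u2 x) =
      sw p.WH.comul h fun v w => sw p.coact v fun v0 x => sw p.coact w fun w0 y =>
        F v0 w0 (x * y) := by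
  have := congrArg ((ev₃ F).comp (TensorProduct.assoc k H H A).toLinearMap)
    (p.isCompatible.pair.comoduleCoalgebra.comul_coact h)
  simp [expand p.coact, expand p.WH.comul] at this
  rw [this]
  exact sw_congr _ _ fun _ _ => sw_swap ..

theorem sw_coact_coact (h : H) (F : H → A → A → P)
    (h1 : ∀ a b, IsLinearMap k (fun c => F a b c) := by intros; fun_prop)
    (h2 : ∀ a c, IsLinearMap k (fun b => F a b c) := by intros; fun_prop)
    (h3 : ∀ b c, IsLinearMap k (fun a => F a b c) := by intros; fun_prop) :
    (sw p.coact h fun u x => sw p.coact u fun v y => F v y x) =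
      sw p.coact h fun u x => sw p.WA.comul x fun y z => F u y z := by
  have := congrArg (ev₃ F) (p.isCompatible.pair.comoduleCoalgebra.coact_coact h)
  simpa [expand p.coact, expand p.WA.comul] using this

theorem sw_coact_eq (h : H) (F : H → A → P)
    (h1 : ∀ a, IsLinearMap k (fun b => F a b) := by intros; fun_prop)
    (h2 : ∀ b, IsLinearMap k (fun a => F a b) := by intros; fun_prop) :
    sw p.coact h F = sw p.WH.comul h fun v w => sw p.coact v fun u x => F u (x * p.b w) := by
  suffices e : sw p.coact h (fun u x => u ⊗ₜ[k] x) =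
      sw p.WH.comul h fun v w => sw p.coact v fun u x => u ⊗ₜ[k] (x * p.b w) by
    have := congrArg (ev F) e
    simpa using this
  have := p.sw_comul_coact h fun u v x => p.WH.counit v • (u ⊗ₜ[k] x)
  simp only [p.WH.sw_counit_right _ (lin_tmul_left _)] at this
  simp [this, b_eq]

theorem b_conv_b (h : H) : sw p.WH.comul h (fun u v => p.b u * p.b v) = p.b h := by
  rw [p.b_eq h, p.sw_coact_eq h fun u x => p.WH.counit u • x]
  simp only [p.b_eq, sw_mul, mul_sw, smul_sw, Algebra.smul_mul_assoc,
    Algebra.mul_smul_comm]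
  refine sw_congr _ _ fun u v => ?_
  rw [sw_swap]
  refine sw_congr _ _ fun x y => sw_congr _ _ fun z t => ?_
  rw [smul_comm]

theorem counit_b (h : H) : p.WA.counit (p.b h) = p.WH.counit h := by
  rw [b_eq, ← p.sw_counit_coact h (F := fun x => p.WH.counit x) (by fun_prop)]
  simp [mul_comm]

theorem sw_b_coact (h : H) (F : A → A → P)
    (h1 : ∀ a, IsLinearMap k (fun b => F a b) := by intros; fun_prop)
    (h2 : ∀ b, IsLinearMap k (fun a => F a b) := by intros; fun_prop) :
    sw p.coact h (fun u x => F (p.b u) x) = sw p.WA.comul (p.b h) F := by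
  suffices e : sw p.coact h (fun u x => p.b u ⊗ₜ[k] x) =
      sw p.WA.comul (p.b h) fun x y => x ⊗ₜ[k] y by
    have := congrArg (ev F) e
    simpa using this
  have := p.sw_coact_coact h fun u x y => p.WH.counit u • (x ⊗ₜ[k] y)
  rw [← expand, b_eq, map_sw]
  simp only [map_smul]
  simp [expand p.WA.comul, ← this, b_eq]

theorem sw_coact_εs (h : H) (F : H → A → P)
    (h1 : ∀ a, IsLinearMap k (fun b => F a b) := by intros; fun_prop)
    (h2 : ∀ b, IsLinearMap k (fun a => F a b) := by intros; fun_prop) :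
    sw p.coact h (fun u x => F u (p.WA.εs x)) = sw p.WH.comul h fun u v => F u (p.b v) := by
  suffices e : sw p.coact h (fun u x => u ⊗ₜ[k] (p.WA.εs x)) =
      sw p.WH.comul h fun u v => u ⊗ₜ[k] (p.b v) by
    have := congrArg (ev F) e
    simpa using this
  symm
  calc _ = sw p.coact h fun z t => sw p.WH.comul z fun u v =>
          p.WA.counit t • (u ⊗ₜ[k] (p.b v)) := by
        rw [← p.sw_counit_coact h (F := fun h => sw p.WH.comul h fun u v => u ⊗ₜ[k] (p.b v))
          (by fun_prop)]
        simp
    _ = sw p.WH.comul h fun v w => sw p.coact v fun u x => sw p.coact w fun w0 y =>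
          p.WA.counit (x * y) • (u ⊗ₜ[k] (p.b w0)) :=
        p.sw_comul_coact h fun u v t => p.WA.counit t • (u ⊗ₜ[k] (p.b v))
    _ = sw p.WH.comul h fun v w => sw p.coact v fun u x =>
          u ⊗ₜ[k] (p.WA.εs (x * p.b w)) := by
        refine sw_congr _ _ fun v w => sw_congr _ _ fun u x => ?_
        rw [p.sw_b_coact w fun s t => p.WA.counit (x * t) • (u ⊗ₜ[k] s), p.WA.εs_mul, εs_b,
          ← p.WA.sw_counit_mul_right]
        simp
    _ = _ := (p.sw_coact_eq h fun u x => u ⊗ₜ[k] (p.WA.εs x)).symm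

theorem sw_one_coact (F : H → A → H → P)
    (h1 : ∀ a b, IsLinearMap k (fun c => F a b c) := by intros; fun_prop)
    (h2 : ∀ a c, IsLinearMap k (fun b => F a b c) := by intros; fun_prop)
    (h3 : ∀ b c, IsLinearMap k (fun a => F a b c) := by intros; fun_prop) :
    (sw p.WH.comul 1 fun u v => sw p.coact u fun z x => F z x v) =
      sw p.WH.comul 1 fun u v => sw p.WH.comul 1 fun u' v' => F u (p.b u') (v * v') := by
  have := congrArg ((ev₃ F).comp (TensorProduct.assoc k H A H).toLinearMap)
    p.isCompatible.pair.cond5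
  simp [expand p.coact, expand p.WH.comul] at this
  rw [this, sw_swap]; rfl

theorem sw_coact_one (F : H → A → P)
    (h1 : ∀ a, IsLinearMap k (fun b => F a b) := by intros; fun_prop)
    (h2 : ∀ b, IsLinearMap k (fun a => F a b) := by intros; fun_prop) :
    sw p.coact 1 F = sw p.WH.comul 1 fun u v => F u (p.b v) := by
  suffices e : sw p.coact 1 (fun u x => u ⊗ₜ[k] x) =
      sw p.WH.comul 1 fun u v => u ⊗ₜ[k] (p.b v) by
    have := congrArg (ev F) e
    simpa using this
  have := p.sw_one_coact fun z x v => p.WH.counit v • (z ⊗ₜ[k] x)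
  rw [← p.WH.sw_counit_right 1 (F := fun h => sw p.coact h (fun u x => u ⊗ₜ[k] x)) (by fun_prop)]
  have e := p.cocomm.sw_εs_right 1 fun u v => u ⊗ₜ[k] (p.b v)
  simp [p.WH.εs_eq] at e this ⊢
  rw [this, e]

theorem εs_act (h : H) (x : A) : p.WA.εs (p.act h x) = p.WA.εs (p.a h) * p.WA.εs x :=
  p.isCompatible.pair.cond4 h x

theorem sw_one_act_act (h g : H) (F : A → A → P)
    (h1 : ∀ a, IsLinearMap k (fun b => F a b) := by intros; fun_prop)
    (h2 : ∀ b, IsLinearMap k (fun a => F a b) := by intros; fun_prop) :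
    sw p.WA.comul 1 (fun x y => F (p.act h x) (p.act g y)) =
      sw p.WA.comul 1 fun x y => F (p.a h * x) (p.a g * y) := by
  have := congrArg (ev F) (p.isCompatible.compat2 h g)
  simpa [expand p.WA.comul, act_one] using this

theorem act_εt (h : H) (x : A) : p.act (p.WH.εt h) x = p.a h * x := by
  rw [← p.one_act (p.a h * x), p.act_mul, ← a_εt, ← p.sw_a_mul_act,
    p.WH.sw_comul_εt _ (by fun_prop) (by fun_prop)]
  simp only [act_a]

theorem sw_one_act (x : A) (F : A → H → P)
    (h1 : ∀ a, IsLinearMap k (fun b => F a b) := by intros; fun_prop)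
    (h2 : ∀ b, IsLinearMap k (fun a => F a b) := by intros; fun_prop) :
    sw p.WH.comul 1 (fun u v => F (p.act u x) v) = sw p.WH.comul 1 fun u v => F (p.a u * x) v := by
  have := p.cocomm.sw_εt_left 1 fun u v => F (p.act u x) v
  simpa [act_εt] using this.symm

theorem sw_a_comul (h : H) (F : A → H → P)
    (h1 : ∀ a, IsLinearMap k (fun b => F a b) := by intros; fun_prop)
    (h2 : ∀ b, IsLinearMap k (fun a => F a b) := by intros; fun_prop) :
    sw p.WH.comul h (fun u v => F (p.a u) v) = sw p.WH.comul 1 fun u v => F (p.a u) (v * h) := by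
  simpa [a_εt] using p.cocomm.sw_εt_left h fun u v => F (p.a u) v

theorem a_conv_εs_a (h : H) :
    sw p.WH.comul h (fun u v => p.a u * p.WA.εs (p.a v)) = p.a h := by
  rw [← p.act_one h, p.isCompatible.compat1]
  have := fun u v => p.sw_one_act_act u v fun x y => p.WA.counit y • x
  simp [expand p.WA.comul, expand p.WH.comul]
  rw [sw_swap]
  refine sw_congr _ _ fun u v => ?_
  rw [this]
  simp [p.WA.εs_eq]

theorem εs_a (h : H) : p.WA.εs (p.a h) = p.a h := by
  have e := p.a_conv_εs_a 1
  rw [a_unit] at e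
  conv_rhs => rw [← p.a_conv_εs_a h, p.sw_a_comul h fun x v => x * p.WA.εs (p.a v)]
  rw [← one_mul (p.WA.εs (p.a h)), ← e, sw_mul]
  simp only [mul_assoc, ← p.WA.εs_mul]
  rw [p.cocomm.sw_comm 1 (by fun_prop) (by fun_prop), ← p.sw_one_act (p.a h) fun x v =>
    p.a v * p.WA.εs x, p.cocomm.sw_comm _ (by fun_prop) (by fun_prop)]
  simp only [act_a]

end CompatiblePair

namespace CompatiblePair

variable {k H A P : Type*} [Field k] [Ring H] [Algebra k H] [CommRing A] [Algebra k A]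
  [AddCommMonoid P] [Module k P] (p : CompatiblePair k H A)

theorem sw_apply {M N Q R : Type*} [AddCommMonoid M] [Module k M] [AddCommMonoid N] [Module k N]
    [AddCommMonoid Q] [Module k Q] [AddCommMonoid R] [Module k R] (f : Q →ₗ[k] M ⊗[k] N) (x : Q)
    (L : M → N → R →ₗ[k] P) (y : R) : (sw f x L) y = sw f x fun a b => L a b y :=
  LinearMap.sum_apply ..

theorem sw_cond3 (h g : H) (x : A) (F : A → H → A → P)
    (h1 : ∀ a b, IsLinearMap k (fun c => F a b c) := by intros; fun_prop)
    (h2 : ∀ a c, IsLinearMap k (fun b => F a b c) := by intros; fun_prop)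
    (h3 : ∀ b c, IsLinearMap k (fun a => F a b c) := by intros; fun_prop) :
    (sw p.WH.comul h fun u v => sw p.coact (v * g) fun z y =>
        sw p.WA.comul (p.act u x) fun x1 x2 => F x1 z (x2 * y)) =
      sw p.WH.comul h fun u t => sw p.WH.comul t fun v t' => sw p.WH.comul t' fun w w' =>
        sw p.coact g fun g0 g1 => sw p.coact w fun w0 z => sw p.WA.comul x fun x1 x2 =>
        sw p.coact u fun u0 y =>
          F (p.act u0 x1) (w0 * g0) ((y * p.act v x2) * (z * p.act w' g1)) := by
  have := congrArg ((ev₃ F).comp (TensorProduct.assoc k A H A).toLinearMap)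
    (p.isCompatible.pair.cond3 h g x)
  simpa [mpLHS, mpRHS, pairMapA, pairMapH, threeComul, expand p.coact, expand p.WA.comul,
    expand p.WH.comul, sw_apply] using this

theorem sw_cond7 {S : A →ₗ[k] A} {h : H}
    (h7 : cond7LHS k p.WH p.WA p.act p.coact S h = cond7RHS k p.WH p.WA p.act p.coact h)
    (F : A → A → H → P)
    (h1 : ∀ a b, IsLinearMap k (fun c => F a b c) := by intros; fun_prop)
    (h2 : ∀ a c, IsLinearMap k (fun b => F a b c) := by intros; fun_prop)
    (h3 : ∀ b c, IsLinearMap k (fun a => F a b c) := by intros; fun_prop) :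
    (sw p.coact h fun h0 y => sw p.WH.comul 1 fun u v => sw p.coact v fun v0 x =>
        F (p.a (u * h0)) (S y * p.WA.εs x) v0) =
      sw p.coact h fun h0 y => sw p.WH.comul 1 fun u v => sw p.coact v fun v0 x =>
        sw p.coact u fun u0 x' =>
          F (p.WA.εt (p.a (u0 * h0))) (p.WA.εt y * p.WA.εs x * x') v0 := by
  have := congrArg ((ev₃ F).comp (TensorProduct.assoc k A A H).toLinearMap) h7
  simpa [cond7LHS, cond7RHS, expand p.coact, expand p.WH.comul, act_one] using this

theorem sw_cond8 {S : H →ₗ[k] H} {h : H}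
    (h8 : cond8LHS k p.WH p.WA p.act p.coact S h = cond8RHS k p.WH p.WA p.act p.coact h)
    (F : A → H → P)
    (h1 : ∀ a, IsLinearMap k (fun b => F a b) := by intros; fun_prop)
    (h2 : ∀ b, IsLinearMap k (fun a => F a b) := by intros; fun_prop) :
    (sw p.WH.comul h fun u t => sw p.WH.comul t fun v w => sw p.coact v fun v0 y =>
        sw p.coact u fun u0 x => F (p.WA.εs (x * y) * p.a (S u0)) (S v0 * w)) =
      sw p.WH.comul 1 fun u v => sw p.coact v fun v0 y => sw p.coact h fun h0 x =>
        F (p.WA.εs (x * y) * p.WA.εs (p.a (h0 * u))) v0 := by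
  have := congrArg (ev F) h8
  simpa [cond8LHS, cond8RHS, twoComul, expand p.coact, expand p.WH.comul, act_one] using this

end CompatiblePair

section
variable {k H P : Type*} [Field k] [Ring H] [Algebra k H] [AddCommMonoid P] [Module k P]
  {W : WeakBialgebra k H}

theorem WeakBialgebra.Cocomm.sw_comm₃ (hW : W.Cocomm) (h : H) (F : H → H → H → P)
    (h1 : ∀ a b, IsLinearMap k (fun c => F a b c) := by intros; fun_prop)
    (h2 : ∀ a c, IsLinearMap k (fun b => F a b c) := by intros; fun_prop)
    (h3 : ∀ b c, IsLinearMap k (fun a => F a b c) := by intros; fun_prop) :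
    (sw W.comul h fun a t => sw W.comul t fun b c => F a b c) =
      sw W.comul h fun a t => sw W.comul t fun b c => F b a c := by
  rw [← W.sw_coassoc h (F := F) h1 h2 h3, ← W.sw_coassoc h (F := fun a b c => F b a c)
    (by fun_prop) (by fun_prop) (by fun_prop)]
  exact sw_congr _ _ fun a b => hW.sw_comm a (by fun_prop) (by fun_prop)
end

namespace CompatiblePair

variable {k H A P : Type*} [Field k] [Ring H] [Algebra k H] [CommRing A] [Algebra k A]
  [AddCommMonoid P] [Module k P] (p : CompatiblePair k H A)

theorem sw_one_coact_b (F : H → A → H → P)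
    (h1 : ∀ a b, IsLinearMap k (fun c => F a b c) := by intros; fun_prop)
    (h2 : ∀ a c, IsLinearMap k (fun b => F a b c) := by intros; fun_prop)
    (h3 : ∀ b c, IsLinearMap k (fun a => F a b c) := by intros; fun_prop) :
    (sw p.WH.comul 1 fun u v => sw p.coact u fun u0 x => sw p.WH.comul v fun v1 v2 =>
        F u0 (x * p.b v2) v1) =
      sw p.WH.comul 1 fun u v => sw p.WH.comul v fun v1 v2 => F u (p.b v2) v1 := by
  calc _ = sw p.WH.comul 1 fun u v => sw p.WH.comul v fun v1 v2 => sw p.coact u fun u0 x =>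
        F u0 (x * p.b v1) v2 := by
        refine sw_congr _ _ fun u v => ?_
        rw [sw_swap, p.cocomm.sw_comm v (by fun_prop) (by fun_prop)]
    _ = sw p.WH.comul 1 fun t v => sw p.coact t fun t0 x => F t0 x v := by
        rw [← p.WH.sw_coassoc 1 (by fun_prop) (by fun_prop) (by fun_prop)]
        exact sw_congr _ _ fun t v => (p.sw_coact_eq t fun t0 x => F t0 x v).symm
    _ = sw p.WH.comul 1 fun u v => sw p.WH.comul 1 fun c d => F u (p.b d) (v * c) := by
        rw [p.sw_one_coact fun u x v => F u x v]
        exact sw_congr _ _ fun u v => p.cocomm.sw_comm 1 (by fun_prop) (by fun_prop)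
    _ = _ := p.WH.sw_one_left fun u c d => F u (p.b d) c

theorem sw_one_counit_b (F : H → H → P)
    (h1 : ∀ a, IsLinearMap k (fun b => F a b) := by intros; fun_prop)
    (h2 : ∀ b, IsLinearMap k (fun a => F a b) := by intros; fun_prop) :
    (sw p.WH.comul 1 fun u v => sw p.WH.comul v fun v1 v2 => sw p.WH.comul 1 fun w w' =>
        p.WA.counit (p.b w' * p.b v2) • F (u * w) v1) = sw p.WH.comul 1 F := by
  calc _ = sw p.WH.comul 1 fun v1 b => sw p.WH.comul 1 fun c v2 => sw p.WH.comul 1 fun w w' =>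
        p.WA.counit (p.b w' * p.b v2) • F (b * c * w) v1 := by
        rw [p.cocomm.sw_comm₃ 1 fun u v1 v2 => sw p.WH.comul 1 fun w w' =>
          p.WA.counit (p.b w' * p.b v2) • F (u * w) v1]
        exact (p.WH.sw_one_left fun v1 u v2 => sw p.WH.comul 1 fun w w' =>
          p.WA.counit (p.b w' * p.b v2) • F (u * w) v1).symm
    _ = sw p.WH.comul 1 fun v1 b => sw p.WH.comul 1 fun c s => sw p.WH.comul s fun w' v2 =>
        p.WA.counit (p.b w' * p.b v2) • F (b * c) v1 := by
        refine sw_congr _ _ fun v1 b => ?_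
        rw [p.cocomm.sw_comm 1 (by fun_prop) (by fun_prop)]
        simp only [mul_assoc]
        rw [p.WH.sw_one_left fun v2 c w' => p.WA.counit (p.b w' * p.b v2) • F (b * c) v1,
          p.cocomm.sw_comm 1 (by fun_prop) (by fun_prop),
          p.WH.sw_coassoc 1 (by fun_prop) (by fun_prop) (by fun_prop)]
    _ = _ := by
        have (s : H) (z : P) : (sw p.WH.comul s fun w' v2 =>
            p.WA.counit (p.b w' * p.b v2) • z) = p.WH.counit s • z := by
          rw [← p.counit_b, ← p.b_conv_b, map_sw, sw_smul]
        simp only [this]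
        rw [p.cocomm.sw_comm 1 (F := F) (by fun_prop) (by fun_prop)]
        refine sw_congr _ _ fun v1 b => ?_
        rw [p.WH.sw_counit_right 1 (F := fun c => F (b * c) v1) (by fun_prop), mul_one]

section
variable {p} {S : A →ₗ[k] A}

theorem sw_cond7_simplified
    (h7 : ∀ h, cond7LHS k p.WH p.WA p.act p.coact S h = cond7RHS k p.WH p.WA p.act p.coact h)
    (h : H) (F : A → A → H → P)
    (h1 : ∀ a b, IsLinearMap k (fun c => F a b c) := by intros; fun_prop)
    (h2 : ∀ a c, IsLinearMap k (fun b => F a b c) := by intros; fun_prop)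
    (h3 : ∀ b c, IsLinearMap k (fun a => F a b c) := by intros; fun_prop) :
    (sw p.coact h fun h0 y => sw p.WH.comul 1 fun u v => sw p.WH.comul v fun v1 v2 =>
        F (p.a (u * h0)) (S y * p.b v2) v1) =
      sw p.coact h fun h0 y => sw p.WH.comul 1 fun u v => sw p.WH.comul v fun v1 v2 =>
        F (p.WA.εt (p.a (u * h0))) (p.WA.εt y * p.b v2) v1 := by
  calc _ = _ := by
        refine sw_congr _ _ fun h0 y => sw_congr _ _ fun u v => ?_
        exact (p.sw_coact_εs v fun v1 z => F (p.a (u * h0)) (S y * z) v1).symm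
    _ = _ := p.sw_cond7 (h7 h) F
    _ = _ := by
        refine sw_congr _ _ fun h0 y => ?_
        have := p.sw_one_coact_b fun u x v => F (p.WA.εt (p.a (u * h0))) (p.WA.εt y * x) v
        rw [← this]
        refine sw_congr _ _ fun u v => ?_
        rw [p.sw_coact_εs v fun v1 z => sw p.coact u fun u0 x => F (p.WA.εt (p.a (u0 * h0)))
          (p.WA.εt y * z * x) v1, sw_swap]
        refine sw_congr _ _ fun u0 x => sw_congr _ _ fun v1 v2 => ?_
        rw [mul_assoc, mul_comm x]

theorem sw_cond7_counit
    (h7 : ∀ h, cond7LHS k p.WH p.WA p.act p.coact S h = cond7RHS k p.WH p.WA p.act p.coact h)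
    (h : H) (F : A → A → P)
    (h1 : ∀ a, IsLinearMap k (fun b => F a b) := by intros; fun_prop)
    (h2 : ∀ b, IsLinearMap k (fun a => F a b) := by intros; fun_prop) :
    (sw p.coact h fun h0 y => sw p.WH.comul 1 fun u v => F (p.a (u * h0)) (S y * p.b v)) =
      sw p.coact h fun h0 y => sw p.WH.comul 1 fun u v =>
        F (p.WA.εt (p.a (u * h0))) (p.WA.εt y * p.b v) := by
  have := sw_cond7_simplified h7 h fun x y v => p.WH.counit v • F x y
  have e (v x y) : (sw p.WH.comul v fun v1 v2 => p.WH.counit v1 • F x (y * p.b v2)) =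
    F x (y * p.b v) := p.WH.sw_counit_left v (F := fun v2 => F x (y * p.b v2)) (by fun_prop)
  simpa only [e] using this

theorem εt_a
    (h7 : ∀ h, cond7LHS k p.WH p.WA p.act p.coact S h = cond7RHS k p.WH p.WA p.act p.coact h)
    (hS : p.WA.IsAntipode S) (h : H) : p.WA.εt (p.a h) = p.a h := by
  have e2 : p.a h = sw p.WH.comul 1 fun u v => p.WH.counit (v * h) • p.a u := by
    rw [p.cocomm.sw_comm 1 (by fun_prop) (by fun_prop), ← p.a_εt h, p.WH.εt_eq]
    simp
  have key (F : A → A) (hF : IsLinearMap k F) (T : A → A) (hT : IsLinearMap k T)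
      (hT' : ∀ x, T (p.b x) = p.WA.εt (p.b x)) : (sw p.coact 1 fun h0 y =>
      sw p.WH.comul 1 fun u v => sw p.WH.comul v fun v1 v2 =>
        p.WA.counit (T y * p.b v2) • p.WH.counit (v1 * h) • F (p.a (u * h0))) = F (p.a h) := by
    rw [p.sw_coact_one fun h0 y => sw p.WH.comul 1 fun u v => sw p.WH.comul v fun v1 v2 =>
        p.WA.counit (T y * p.b v2) • p.WH.counit (v1 * h) • F (p.a (u * h0))]
    have := congrArg hF.mk' e2
    simp only [map_sw, map_smul] at this
    refine Eq.trans ?_ this.symm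
    simp only [hT', mul_comm (p.WA.εt _), p.WA.counit_mul_εt]
    have := p.sw_one_counit_b fun u v => p.WH.counit (v * h) • F (p.a u)
    refine Eq.trans ?_ this
    rw [sw_swap]
    refine sw_congr _ _ fun u v => ?_
    rw [sw_swap]
    refine sw_congr _ _ fun v1 v2 => sw_congr _ _ fun w w' => ?_
    rw [mul_comm]
  have := sw_cond7_simplified h7 1 fun x y v => p.WA.counit y • p.WH.counit (v * h) • x
  rw [key _ lin_id _ (lin_map S) fun x => hS.map_εs (p.εs_b x),
    key _ (lin_map p.WA.εt) _ (lin_map p.WA.εt) fun x => rfl] at this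
  exact this.symm
end

theorem sw_coact_εt (h : H) (F : H → A → P)
    (h1 : ∀ a, IsLinearMap k (fun b => F a b) := by intros; fun_prop)
    (h2 : ∀ b, IsLinearMap k (fun a => F a b) := by intros; fun_prop) :
    sw p.coact h (fun u x => F u (p.WA.εt x)) =
      sw p.WH.comul h fun u v => F u (p.WA.εt (p.b v)) := by
  simpa [p.WA.εt_εs] using p.sw_coact_εs h fun u x => F u (p.WA.εt x)

/-- `b(1₁) ⊗ 1₂` is fixed by `εt` in its first leg. -/
theorem sw_one_εt_b {S : A →ₗ[k] A} (hS : p.WA.IsAntipode S) (F : A → H → P)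
    (h1 : ∀ a, IsLinearMap k (fun b => F a b) := by intros; fun_prop)
    (h2 : ∀ b, IsLinearMap k (fun a => F a b) := by intros; fun_prop) :
    sw p.WH.comul 1 (fun u v => F (p.WA.εt (p.b u)) v) =
      sw p.WH.comul 1 fun u v => F (p.b u) v := by
  have key (G : H → A → A → P) (h1 : ∀ a b, IsLinearMap k (fun c => G a b c))
      (h2 : ∀ a c, IsLinearMap k (fun b => G a b c))
      (h3 : ∀ b c, IsLinearMap k (fun a => G a b c)) :
      (sw p.WH.comul 1 fun u v => sw p.WA.comul (p.b v) fun x y => G u x y) =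
      sw p.WH.comul 1 fun u v => sw p.WH.comul v fun v1 v2 => G u (p.b v1) (p.b v2) := by
    rw [← p.sw_coact_one fun u z => sw p.WA.comul z fun x y => G u x y, ← p.sw_coact_coact 1 G,
      p.sw_coact_one fun u x => sw p.coact u fun v y => G v y x,
      p.sw_one_coact fun u x v => G u x (p.b v),
      ← sw_congr _ _ fun u v => (p.cocomm.sw_comm v (F := fun v1 v2 => G u (p.b v2) (p.b v1))
        (by fun_prop) (by fun_prop)), ← p.WH.sw_one_left fun u v1 v2 => G u (p.b v2) (p.b v1)]
    exact sw_congr _ _ fun u v => p.cocomm.sw_comm 1 (by fun_prop) (by fun_prop)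
  have hF (u : H) : IsLinearMap k fun x => F x u := h2 u
  rw [p.cocomm.sw_comm 1 (by fun_prop) (by fun_prop),
    p.cocomm.sw_comm 1 (F := fun u v => F (p.b u) v) (by fun_prop) (by fun_prop)]
  calc _ = sw p.WH.comul 1 fun u v => sw p.WA.comul (p.b v) fun x y => F (x * S y) u := by
        refine sw_congr _ _ fun u v => ?_
        rw [← hS.sw_mul]
        exact map_sw (hF u).mk' _ _ _
    _ = sw p.WH.comul 1 fun u v => sw p.WH.comul v fun v1 v2 => F (S (p.b v1) * p.b v2) u := by
        rw [key _ (by fun_prop) (by fun_prop) (by fun_prop)]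
        refine sw_congr _ _ fun u v => ?_
        rw [p.cocomm.sw_comm v (by fun_prop) (by fun_prop)]
        simp only [mul_comm]
    _ = sw p.WH.comul 1 fun u v => sw p.WA.comul (p.b v) fun x y => F (S x * y) u :=
        (key (fun u x y => F (S x * y) u) (by fun_prop) (by fun_prop) (by fun_prop)).symm
    _ = _ := by
        refine sw_congr _ _ fun u v => ?_
        conv_rhs => rw [← p.εs_b, ← hS.mul_sw]
        exact (map_sw (hF u).mk' _ _ _).symm

end CompatiblePair

namespace CompatiblePair

variable {k H A P : Type*} [Field k] [Ring H] [Algebra k H] [CommRing A] [Algebra k A]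
  [AddCommMonoid P] [Module k P] (p : CompatiblePair k H A)

/-- The convolution product `h ↦ a(h₁) b(h₂)`. -/
def c : H →ₗ[k] A := LinearMap.mul' k A ∘ₗ TensorProduct.map p.a p.b ∘ₗ p.WH.comul

theorem c_eq (h : H) : p.c h = sw p.WH.comul h fun u v => p.a u * p.b v := by
  simp [c, expand p.WH.comul]

theorem sw_a_mul_a (h : H) : sw p.WH.comul h (fun u v => p.a u * p.a v) = p.a h :=
  p.sw_a_mul_act h 1

theorem sw_a_mul_c (h : H) : sw p.WH.comul h (fun u v => p.a u * p.c v) = p.c h := by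
  simp only [c_eq, mul_sw, ← mul_assoc]
  rw [← p.WH.sw_coassoc h (by fun_prop) (by fun_prop) (by fun_prop)]
  simp only [← sw_mul, sw_a_mul_a]

theorem sw_b_mul_c (h : H) : sw p.WH.comul h (fun u v => p.b u * p.c v) = p.c h := by
  rw [p.cocomm.sw_comm h (by fun_prop) (by fun_prop)]
  simp only [c_eq, mul_sw]
  rw [p.WH.sw_coassoc h (F := fun c d b => p.b b * (p.a c * p.b d)) (by fun_prop) (by fun_prop)
    (by fun_prop)]
  refine sw_congr _ _ fun u v => ?_
  rw [← p.b_conv_b v, mul_sw]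
  exact sw_congr _ _ fun u v => by ring

theorem sw_act_act_εs (h g : H) {y : A} (hy : p.WA.εs y = y) (F : A → A → P)
    (h1 : ∀ a, IsLinearMap k (fun b => F a b) := by intros; fun_prop)
    (h2 : ∀ b, IsLinearMap k (fun a => F a b) := by intros; fun_prop) :
    sw p.WA.comul y (fun x1 x2 => F (p.act h x1) (p.act g x2)) =
      sw p.WA.comul 1 fun x1 x2 => F (p.a h * x1) (p.act g y * x2) := by
  have hF (x : A) : IsLinearMap k (fun b => F x b) := h1 x
  have e (x : A) (f : H → H → A) : F x (sw p.WH.comul g f) =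
      sw p.WH.comul g fun u v => F x (f u v) :=
    map_sw (hF x).mk' _ _ _
  conv_lhs => rw [← mul_one y]
  rw [p.WA.sw_comul_mul_εs 1 y hy (by fun_prop) (by fun_prop)]
  simp only [act_mul, e]
  rw [sw_swap]
  rw [sw_congr _ _ fun u v => p.sw_one_act_act h v fun x z => F x (p.act u y * z), sw_swap]
  refine sw_congr _ _ fun x1 x2 => ?_
  rw [← e]
  congr 1
  rw [p.cocomm.sw_comm g (by fun_prop) (by fun_prop), ← p.sw_a_mul_act g y, sw_mul]
  exact sw_congr _ _ fun u v => by ring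

theorem sw_cond3_εs (h g : H) {y : A} (hy : p.WA.εs y = y) (F : A → H → A → P)
    (h1 : ∀ a b, IsLinearMap k (fun c => F a b c) := by intros; fun_prop)
    (h2 : ∀ a c, IsLinearMap k (fun b => F a b c) := by intros; fun_prop)
    (h3 : ∀ b c, IsLinearMap k (fun a => F a b c) := by intros; fun_prop) :
    (sw p.WH.comul h fun u v => sw p.coact (v * g) fun z t =>
        sw p.WA.comul (p.act u y) fun x1 x2 => F x1 z (x2 * t)) =
      sw p.WH.comul h fun u q => sw p.WH.comul q fun v q' => sw p.WH.comul q' fun w w' =>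
        sw p.coact g fun g0 g1 => sw p.coact w fun w0 z => sw p.coact u fun u0 t =>
        sw p.WA.comul 1 fun x1 x2 =>
          F (p.a u0 * x1) (w0 * g0) ((t * (p.act v y * x2)) * (z * p.act w' g1)) := by
  rw [p.sw_cond3 h g y F]
  refine sw_congr _ _ fun u q => sw_congr _ _ fun v q' => sw_congr _ _ fun w w' =>
    sw_congr _ _ fun g0 g1 => sw_congr _ _ fun w0 z => ?_
  rw [sw_swap]
  refine sw_congr _ _ fun u0 t => ?_
  rw [p.sw_act_act_εs u0 v hy fun x1 x2 => F x1 (w0 * g0) ((t * x2) * (z * p.act w' g1))]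

theorem sw_cond3_act (h g : H) {y : A} (hy : p.WA.εs y = y) (F : A → H → A → P)
    (h1 : ∀ a b, IsLinearMap k (fun c => F a b c) := by intros; fun_prop)
    (h2 : ∀ a c, IsLinearMap k (fun b => F a b c) := by intros; fun_prop)
    (h3 : ∀ b c, IsLinearMap k (fun a => F a b c) := by intros; fun_prop) :
    (sw p.WH.comul h fun u v => sw p.coact (v * g) fun z t =>
        sw p.WA.comul (p.act u y) fun x1 x2 => F x1 z (x2 * t)) =
      sw p.WH.comul h fun s r => sw p.WH.comul s fun u v => sw p.coact (v * g) fun z t =>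
        sw p.WA.comul (p.a u) fun x1 x2 => F x1 z (x2 * t * p.act r y) := by
  rw [p.sw_cond3_εs h g hy F]
  have e (s r : H) := p.sw_cond3_εs s g p.WA.εs_one fun x z t => F x z (t * p.act r y)
  simp only [act_one] at e
  rw [sw_congr _ _ e]
  set K : H → A → H → P := fun u m q' => sw p.WH.comul q' fun w w' =>
        sw p.coact g fun g0 g1 => sw p.coact w fun w0 z => sw p.coact u fun u0 t =>
        sw p.WA.comul 1 fun x1 x2 =>
          F (p.a u0 * x1) (w0 * g0) ((t * (m * x2)) * (z * p.act w' g1)) with hK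
  have K1 : ∀ a b, IsLinearMap k (fun c => K a b c) := by intros; fun_prop
  have K2 : ∀ a c, IsLinearMap k (fun b => K a b c) := by intros; fun_prop
  have K3 : ∀ b c, IsLinearMap k (fun a => K a b c) := by intros; fun_prop
  symm
  calc _ = sw p.WH.comul h fun s r => sw p.WH.comul s fun u q => sw p.WH.comul q fun v q' =>
          K u (p.a v * p.act r y) q' := by
        refine sw_congr _ _ fun s r => sw_congr _ _ fun u q => sw_congr _ _ fun v q' =>
          sw_congr _ _ fun w w' => sw_congr _ _ fun g0 g1 => sw_congr _ _ fun w0 z =>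
          sw_congr _ _ fun u0 t => sw_congr _ _ fun x1 x2 => ?_
        congr 1; ring
    _ = sw p.WH.comul h fun u q => sw p.WH.comul q fun v q' => sw p.WH.comul q' fun t r =>
          K u (p.a v * p.act r y) t := by
        rw [p.WH.sw_coassoc h (F := fun u q r => sw p.WH.comul q fun v q' =>
          K u (p.a v * p.act r y) q') (by fun_prop) (by fun_prop) (by fun_prop)]
        refine sw_congr _ _ fun u q => ?_
        rw [p.WH.sw_coassoc q (F := fun v t r => K u (p.a v * p.act r y) t) (by fun_prop)
          (by fun_prop) (by fun_prop)]
    _ = _ := by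
        refine sw_congr _ _ fun u q => ?_
        rw [sw_congr _ _ fun v q' => p.cocomm.sw_comm q' (by fun_prop) (by fun_prop),
          ← p.WH.sw_coassoc q (F := fun v r t => K u (p.a v * p.act r y) t) (by fun_prop)
          (by fun_prop) (by fun_prop)]
        refine sw_congr _ _ fun m t => ?_
        rw [← p.sw_a_mul_act m y]
        exact (map_sw (K2 u t).mk' _ _ _).symm

/-- Multiplication by elements fixed by `εs` is compatible with the action after twisting by `c`. -/
theorem sw_c_mul_act (h : H) {y : A} (hy : p.WA.εs y = y) :
    sw p.WH.comul h (fun u v => p.c u * p.act v y) = p.c h * y := by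
  have := p.sw_cond3_act h 1 hy fun x z t => p.WH.counit z • p.WA.counit t • x
  have key (v : H) (r x : A) : (sw p.coact v fun z t => sw p.WA.comul x fun x1 x2 =>
      p.WH.counit z • p.WA.counit (x2 * t * r) • x1) = x * p.b v * p.WA.εs r := by
    rw [← p.εs_b, b_eq, map_sw, mul_sw, sw_mul]
    refine sw_congr _ _ fun z t => ?_
    have := p.WA.sw_counit_mul_right x (t * r)
    rw [map_smul, Algebra.mul_smul_comm, Algebra.smul_mul_assoc, mul_assoc, ← p.WA.εs_mul,
      mul_comm x, ← this, smul_sw]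
    exact sw_congr _ _ fun a b => by rw [mul_comm b, mul_right_comm, mul_assoc]
  have key' (v : H) (x : A) : (sw p.coact v fun z t => sw p.WA.comul x fun x1 x2 =>
      p.WH.counit z • p.WA.counit (x2 * t) • x1) = x * p.b v := by
    simpa [p.WA.εs_one] using key v 1 x
  simp only [mul_one, key, key', p.εs_act, p.εs_a, hy] at this
  calc _ = sw p.WH.comul h fun u v => p.act u y * p.b v := by
        simp only [c_eq, sw_mul]
        rw [p.WH.sw_coassoc h (F := fun u w v => p.a u * p.b w * p.act v y) (by fun_prop)
          (by fun_prop) (by fun_prop),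
          sw_congr _ _ fun u v => p.cocomm.sw_comm v (by fun_prop) (by fun_prop),
          ← p.WH.sw_coassoc h (F := fun u w v => p.a u * p.b v * p.act w y) (by fun_prop)
          (by fun_prop) (by fun_prop)]
        refine sw_congr _ _ fun u v => ?_
        rw [← p.sw_a_mul_act, sw_mul]
        exact sw_congr _ _ fun _ _ => by ring
    _ = _ := by
        rw [this, ← p.sw_a_mul_c, p.cocomm.sw_comm h (F := fun u v => p.a u * p.c v) (by fun_prop)
          (by fun_prop), sw_mul]
        refine sw_congr _ _ fun u v => ?_
        rw [p.c_eq, mul_sw, sw_mul]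
        exact sw_congr _ _ fun _ _ => by ring

end CompatiblePair

namespace CompatiblePair

variable {k H A P : Type*} [Field k] [Ring H] [Algebra k H] [CommRing A] [Algebra k A]
  [AddCommMonoid P] [Module k P] {p : CompatiblePair k H A}

/-- The matched pair condition at `x = 1` with the counit applied to the first leg. -/
theorem sw_a_coact_mul (hta : ∀ h, p.WA.εt (p.a h) = p.a h) (h g : H) (F : H → A → P)
    (h1 : ∀ a, IsLinearMap k (fun b => F a b) := by intros; fun_prop)
    (h2 : ∀ b, IsLinearMap k (fun a => F a b) := by intros; fun_prop) :
    (sw p.WH.comul h fun u v => sw p.coact (v * g) fun z t => F z (p.a u * t)) =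
      sw p.WH.comul h fun s w => sw p.coact s fun s0 x => sw p.coact g fun g0 g1 =>
        sw p.WH.comul 1 fun e f => F (f * (s0 * g0)) (p.a e * (x * p.act w g1)) := by
  have := p.sw_cond3_εs h g p.WA.εs_one fun x z t => p.WA.counit x • F z t
  have key (z : H) (x y : A) {t r : A} : (sw p.WA.comul 1 fun x1 x2 =>
      p.WA.counit (x * x1) • F z (t * (y * x2) * r)) = F z (t * (y * p.WA.εt x) * r) := by
    have e := congrArg (fun w => F z (t * (y * w) * r)) (p.WA.sw_counit_mul_left' 1 x)
    have l : IsLinearMap k (fun w => F z (t * (y * w) * r)) := by fun_prop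
    rw [mul_one] at e
    rw [← e]
    have := map_sw l.mk' p.WA.comul 1 fun a b => p.WA.counit (x * a) • b
    simp only [IsLinearMap.mk'_apply] at this
    rw [this]
    exact sw_congr _ _ fun a b => (l.map_smul _ _).symm
  have key2 (z : H) (x t : A) : (sw p.WA.comul x fun x1 x2 =>
      p.WA.counit x1 • F z (x2 * t)) = F z (x * t) := by
    have := congrArg (ev (fun (r : k) x2 => r • F z (x2 * t)))
      (congrArg (TensorProduct.lid k A).symm (p.WA.counit_comul x))
    simpa [expand p.WA.comul] using this
  simp only [key, key2, hta, act_one] at this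
  rw [this]
  calc _ = sw p.WH.comul h fun u q => sw p.WH.comul q fun w w' =>
        sw p.coact g fun g0 g1 => sw p.coact w fun w0 z => sw p.coact u fun u0 t =>
          F (w0 * g0) ((t * p.a u0) * (z * p.act w' g1)) := by
        refine sw_congr _ _ fun u q => ?_
        rw [p.cocomm.sw_comm₃ q fun v w w' => sw p.coact g fun g0 g1 => sw p.coact w fun w0 z =>
          sw p.coact u fun u0 t => F (w0 * g0) ((t * (p.a v * p.a u0)) * (z * p.act w' g1))]
        refine sw_congr _ _ fun w q' => ?_
        rw [sw_swap]
        refine sw_congr _ _ fun g0 g1 => ?_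
        rw [sw_swap]
        refine sw_congr _ _ fun w0 z => ?_
        rw [sw_swap]
        refine sw_congr _ _ fun u0 t => ?_
        have l : IsLinearMap k (fun y => F (w0 * g0) ((t * p.a u0) * (z * y))) := by fun_prop
        rw [← p.sw_a_mul_act]
        refine Eq.trans (sw_congr _ _ fun v w' => ?_) (map_sw l.mk' _ _ _).symm
        rw [IsLinearMap.mk'_apply]
        congr 1; ring
    _ = sw p.WH.comul h fun s w' => sw p.WH.comul s fun u w =>
        sw p.coact g fun g0 g1 => sw p.coact w fun w0 z => sw p.coact u fun u0 t =>
          F (w0 * g0) ((t * p.a u0) * (z * p.act w' g1)) :=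
        (p.WH.sw_coassoc h (by fun_prop) (by fun_prop) (by fun_prop)).symm
    _ = _ := by
        refine sw_congr _ _ fun s w' => ?_
        rw [sw_swap, sw_swap p.coact s]
        refine sw_congr _ _ fun g0 g1 => ?_
        have e1 (s0 : H) (x : A) := p.sw_a_comul s0 fun y w0 => F (w0 * g0) (y * (x * p.act w' g1))
        simp only [mul_assoc] at e1
        rw [← sw_congr _ _ e1,
          p.sw_comul_coact s fun u0 w0 x => F (w0 * g0) (p.a u0 * (x * p.act w' g1))]
        refine sw_congr _ _ fun v w => ?_
        rw [sw_swap]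
        refine sw_congr _ _ fun _ _ => sw_congr _ _ fun _ _ => ?_
        congr 1; ring

theorem sw_one_a_mul_a (F : A → H → P)
    (h1 : ∀ a, IsLinearMap k (fun b => F a b) := by intros; fun_prop)
    (h2 : ∀ b, IsLinearMap k (fun a => F a b) := by intros; fun_prop) :
    (sw p.WH.comul 1 fun e f => sw p.WH.comul 1 fun u v => F (p.a e * p.a u) (f * v)) =
      sw p.WH.comul 1 fun u v => F (p.a u) v := by
  refine (sw_swap ..).trans ?_
  rw [← p.WH.sw_one_mul 1 fun u v => F (p.a u) v]
  refine Eq.trans ?_ (sw_swap ..)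
  refine sw_congr _ _ fun u v => ?_
  rw [← p.sw_one_act (p.a u) fun x f => F x (f * v)]
  simp only [act_a]

theorem sw_a_coact (hta : ∀ h, p.WA.εt (p.a h) = p.a h) (g : H) (F : H → A → P)
    (h1 : ∀ a, IsLinearMap k (fun b => F a b) := by intros; fun_prop)
    (h2 : ∀ b, IsLinearMap k (fun a => F a b) := by intros; fun_prop) :
    (sw p.WH.comul g fun u v => sw p.coact v fun z t => F z (p.a u * t)) =
      sw p.WH.comul 1 fun e f => sw p.coact g fun g0 g1 => F (f * g0) (p.c 1 * (p.a e * g1)) := by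
  have e := p.sw_a_comul g fun x v => sw p.coact v fun z t => F z (x * t)
  rw [e, sw_a_coact_mul hta 1 g F, p.sw_one_coact fun s0 x w => sw p.coact g fun g0 g1 =>
        sw p.WH.comul 1 fun e f => F (f * (s0 * g0)) (p.a e * (x * p.act w g1))]
  simp only [← act_act]
  have e2 (g0 : H) (g1 : A) (v : H) (G : A → P) (hG : IsLinearMap k G) :
      (sw p.WH.comul 1 fun u' v' => G (p.b u' * p.act v (p.act v' g1))) =
        sw p.WH.comul 1 fun u' v' => G (p.b v' * p.act v (p.a u' * g1)) := by
    rw [← p.sw_one_act g1 fun y v' => G (p.b v' * p.act v y)]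
    exact p.cocomm.sw_comm 1 (by fun_prop) (by fun_prop)
  calc _ = sw p.coact g fun g0 g1 => sw p.WH.comul 1 fun c d => sw p.WH.comul 1 fun e f =>
        sw p.WH.comul 1 fun u v => F (f * (u * g0)) (p.a e * (p.b d * p.act v (p.a c * g1))) := by
        refine (sw_congr _ _ fun u v => sw_swap ..).trans ((sw_swap ..).trans ?_)
        refine sw_congr _ _ fun g0 g1 => ?_
        refine Eq.trans ?_ ((sw_congr _ _ fun c d => sw_swap ..).trans (sw_swap ..)).symm
        refine sw_congr _ _ fun u v => ?_
        exact e2 g0 g1 v (fun y => sw p.WH.comul 1 fun e f => F (f * (u * g0)) (p.a e * y))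
          (by fun_prop)
    _ = sw p.coact g fun g0 g1 => sw p.WH.comul 1 fun c d => sw p.WH.comul 1 fun e f =>
        sw p.WH.comul 1 fun u v => F (f * v * g0) (p.a e * p.a u * (p.a c * p.b d) * g1) := by
        refine sw_congr _ _ fun g0 g1 => sw_congr _ _ fun c d => sw_congr _ _ fun e f => ?_
        rw [p.cocomm.sw_comm 1 (by fun_prop) (by fun_prop),
          p.sw_one_act (p.a c * g1) fun y v => F (f * (v * g0)) (p.a e * (p.b d * y))]
        refine sw_congr _ _ fun u v => ?_
        rw [mul_assoc f]
        congr 1; ring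
    _ = _ := by
        rw [sw_swap p.WH.comul 1 p.coact g]
        refine sw_congr _ _ fun g0 g1 => ?_
        have e3 (c d : H) := p.sw_one_a_mul_a fun x f => F (f * g0) (x * (p.a c * p.b d) * g1)
        simp only [e3]
        rw [sw_swap]
        refine sw_congr _ _ fun u v => ?_
        rw [c_eq]
        have l : IsLinearMap k (fun y => F (v * g0) (p.a u * y * g1)) := by fun_prop
        refine (map_sw l.mk' _ _ _).symm.trans ?_
        rw [IsLinearMap.mk'_apply]
        congr 1; ring

end CompatiblePair

theorem lin_apply_sw {k M N P Q R : Type*} [Field k] [AddCommMonoid M] [Module k M]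
    [AddCommMonoid N] [Module k N] [AddCommMonoid P] [Module k P] [AddCommMonoid Q] [Module k Q]
    [AddCommMonoid R] [Module k R] {G : P → R} (hG : IsLinearMap k G) (f : Q →ₗ[k] M ⊗[k] N)
    (x : Q) (F : M → N → P) : G (sw f x F) = sw f x fun a b => G (F a b) :=
  map_sw hG.mk' f x F

namespace CompatiblePair

variable {k H A P : Type*} [Field k] [Ring H] [Algebra k H] [CommRing A] [Algebra k A]
  [AddCommMonoid P] [Module k P] {p : CompatiblePair k H A}

theorem c_eq_coact (hta : ∀ h, p.WA.εt (p.a h) = p.a h) (g : H) :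
    p.c g = sw p.coact g fun g0 g1 => p.c 1 * (p.a g0 * g1) := by
  have e := p.sw_a_coact hta g fun z t => p.WH.counit z • t
  have e1 (g0 : H) (g1 : A) : (sw p.WH.comul 1 fun e f =>
      p.WH.counit (f * g0) • (p.c 1 * (p.a e * g1))) = p.c 1 * (p.a g0 * g1) := by
    rw [p.cocomm.sw_comm 1 (by fun_prop) (by fun_prop)]
    conv_rhs => rw [← p.a_εt, p.WH.εt_eq]
    simp
  rw [sw_swap] at e
  simp only [e1] at e
  rw [← e, c_eq]
  simp [b_eq]

theorem c_one_mul_self (hta : ∀ h, p.WA.εt (p.a h) = p.a h) : p.c 1 * p.c 1 = p.c 1 := by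
  conv_rhs => rw [p.c_eq_coact hta, p.sw_coact_one fun g0 g1 => p.c 1 * (p.a g0 * g1)]
  conv_lhs => rw [c_eq p 1]
  rw [← c_eq, c_eq p 1, mul_sw]

theorem c_one_mul (hta : ∀ h, p.WA.εt (p.a h) = p.a h) (h : H) : p.c 1 * p.c h = p.c h := by
  rw [p.c_eq_coact hta h, mul_sw]
  simp only [← mul_assoc, c_one_mul_self hta]

theorem sw_mul_c (hta : ∀ h, p.WA.εt (p.a h) = p.a h) (h g : H) (G : A → H → P)
    (h1 : ∀ a, IsLinearMap k (fun b => G a b) := by intros; fun_prop)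
    (h2 : ∀ b, IsLinearMap k (fun a => G a b) := by intros; fun_prop) :
    (sw p.WH.comul (h * g) fun m z => G (p.c m) z) =
      sw p.WH.comul h fun u v => sw p.WH.comul g fun y z => G (p.c u * p.b y) (v * z) := by
  have e := p.sw_a_coact_mul hta h g fun z t => G (p.WA.εs t) z
  simp only [p.WA.εs_mul, εs_a, εs_act] at e
  calc _ = sw p.WH.comul (h * g) fun m z => sw p.WH.comul m fun u w => G (p.a u * p.b w) z := by
        refine sw_congr _ _ fun m z => ?_
        rw [c_eq, lin_apply_sw (h2 z)]
    _ = sw p.WH.comul (h * g) fun u v => sw p.WH.comul v fun z w => G (p.a u * p.b w) z := by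
        rw [p.WH.sw_coassoc (h * g) (by fun_prop) (by fun_prop) (by fun_prop)]
        exact sw_congr _ _ fun u v => p.cocomm.sw_comm _ (by fun_prop) (by fun_prop)
    _ = sw p.WH.comul h fun u v => sw p.WH.comul (v * g) fun z w => G (p.a u * p.b w) z := by
        rw [p.sw_a_comul (h * g) fun x v => sw p.WH.comul v fun z w => G (x * p.b w) z,
          p.sw_a_comul h fun x v => sw p.WH.comul (v * g) fun z w => G (x * p.b w) z]
        simp only [mul_assoc]
    _ = sw p.WH.comul h fun s w => sw p.WH.comul s fun s0 s1 => sw p.WH.comul g fun g0 y =>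
          sw p.WH.comul 1 fun e f =>
            G (p.a e * (p.b s1 * (p.a w * p.b y))) (f * (s0 * g0)) := by
        have e1 (u v : H) := p.sw_coact_εs (v * g) fun z t => G (p.a u * t) z
        simp only [e1] at e
        rw [e]
        refine sw_congr _ _ fun s w => ?_
        rw [p.sw_coact_εs s fun s0 x => sw p.coact g fun g0 g1 =>
          sw p.WH.comul 1 fun e f => G (p.a e * (x * (p.a w * p.WA.εs g1))) (f * (s0 * g0))]
        refine sw_congr _ _ fun s0 s1 => ?_
        rw [p.sw_coact_εs g fun g0 y =>
          sw p.WH.comul 1 fun e f => G (p.a e * (p.b s1 * (p.a w * y))) (f * (s0 * g0))]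
    _ = sw p.WH.comul h fun t s0 => sw p.WH.comul g fun y z =>
          sw p.WH.comul 1 fun e f => G (p.a e * (p.c t * p.b y)) (f * s0 * z) := by
        rw [p.WH.sw_coassoc h (by fun_prop) (by fun_prop) (by fun_prop),
          p.cocomm.sw_comm h (by fun_prop) (by fun_prop)]
        refine sw_congr _ _ fun t s0 => ?_
        rw [sw_swap, p.cocomm.sw_comm g (by fun_prop) (by fun_prop)]
        refine sw_congr _ _ fun y z => ?_
        rw [sw_swap]
        refine sw_congr _ _ fun e f => ?_
        have l : IsLinearMap k fun c => G (p.a e * (c * p.b y)) (f * s0 * z) := by fun_prop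
        rw [c_eq, lin_apply_sw l, p.cocomm.sw_comm t (by fun_prop) (by fun_prop)]
        refine sw_congr _ _ fun u v => ?_
        rw [mul_assoc f]
        congr 1; ring
    _ = sw p.WH.comul h fun t s0 => sw p.WH.comul s0 fun e f => sw p.WH.comul g fun y z =>
          G (p.a e * p.c t * p.b y) (f * z) := by
        refine sw_congr _ _ fun t s0 => ?_
        rw [p.sw_a_comul s0 fun x f => sw p.WH.comul g fun y z => G (x * p.c t * p.b y) (f * z),
          sw_swap]
        simp only [mul_assoc]
    _ = _ := by
        rw [← p.WH.sw_coassoc h (by fun_prop) (by fun_prop) (by fun_prop)]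
        refine sw_congr _ _ fun m v => ?_
        rw [sw_swap]
        conv_rhs => rw [← p.sw_a_mul_c]
        simp only [sw_mul]
        refine sw_congr _ _ fun y z => ?_
        rw [lin_apply_sw (h2 (v * z))]
        exact p.cocomm.sw_comm m (by fun_prop) (by fun_prop)

end CompatiblePair

namespace CompatiblePair

variable {k H A P : Type*} [Field k] [Ring H] [Algebra k H] [CommRing A] [Algebra k A]
  [AddCommMonoid P] [Module k P] {p : CompatiblePair k H A} {S : H →ₗ[k] H}

theorem sw_c_mul_c (h : H) : sw p.WH.comul h (fun u v => p.c u * p.c v) = p.c h := by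
  calc _ = sw p.WH.comul h fun s v => sw p.WH.comul s fun u w => p.a u * (p.b w * p.c v) := by
        refine sw_congr _ _ fun s v => ?_
        rw [c_eq p s, sw_mul]
        simp only [mul_assoc]
    _ = _ := by
        rw [p.WH.sw_coassoc h (by fun_prop) (by fun_prop) (by fun_prop)]
        simp only [← mul_sw, sw_b_mul_c, sw_a_mul_c]

theorem c_εt (h : H) : p.c (p.WH.εt h) = p.c 1 * p.a h := by
  rw [c_eq, p.WH.sw_comul_εt _ (by fun_prop) (by fun_prop), c_eq, sw_mul]
  simp only [← act_a, a_εt]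
  rw [p.sw_one_act (p.a h) fun x v => x * p.b v]
  refine sw_congr _ _ fun u v => ?_
  ring

theorem c_mul (hta : ∀ h, p.WA.εt (p.a h) = p.a h) (h g : H) :
    p.c (h * g) = sw p.WH.comul h fun u v => sw p.WH.comul g fun y z =>
      p.WH.counit (v * z) • (p.c u * p.b y) := by
  have e := p.sw_mul_c hta h g fun x z => p.WH.counit z • x
  rwa [p.WH.sw_counit_right _ (F := fun h => p.c h) (by fun_prop)] at e

theorem sw_c_mul_c_εt (hta : ∀ h, p.WA.εt (p.a h) = p.a h) (hS : p.WH.IsAntipode S) (h : H) :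
    sw p.WH.comul h (fun u v => p.c u * p.c (p.WH.εt v)) = p.c (p.WH.εt h) := by
  have e (h : H) : p.c (p.WH.εt h) = sw p.WH.comul h fun u v => sw p.WH.comul u fun u1 u2 =>
      sw p.WH.comul (S v) fun y z => p.WH.counit (u2 * z) • (p.c u1 * p.b y) := by
    rw [← hS.sw_mul, map_sw]
    exact sw_congr _ _ fun u v => c_mul hta u (S v)
  simp only [e, mul_sw, Algebra.mul_smul_comm, ← mul_assoc]
  have e1 (r : H) (x : A) := p.WH.sw_coassoc r (F := fun u1 u2 v => sw p.WH.comul (S v) fun y z =>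
    p.WH.counit (u2 * z) • (x * p.c u1 * p.b y)) (by fun_prop) (by fun_prop) (by fun_prop)
  have e2 (r : H) := p.WH.sw_coassoc r (F := fun u1 u2 v => sw p.WH.comul (S v) fun y z =>
    p.WH.counit (u2 * z) • (p.c u1 * p.b y)) (by fun_prop) (by fun_prop) (by fun_prop)
  simp only [e1, e2]
  rw [← p.WH.sw_coassoc h (F := fun u1 u2 v => sw p.WH.comul v fun c d =>
    sw p.WH.comul (S d) fun y z => p.WH.counit (c * z) • (p.c u1 * p.c u2 * p.b y))
    (by fun_prop) (by fun_prop) (by fun_prop)]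
  refine sw_congr _ _ fun u v => ?_
  have l : IsLinearMap k fun x => sw p.WH.comul v fun c d =>
    sw p.WH.comul (S d) fun y z => p.WH.counit (c * z) • (x * p.b y) := by fun_prop
  conv_rhs => rw [← sw_c_mul_c u]
  exact (lin_apply_sw l ..).symm

theorem c_eq_mul_a (hta : ∀ h, p.WA.εt (p.a h) = p.a h) (hS : p.WH.IsAntipode S) (h : H) :
    p.c h = p.c 1 * p.a h := by
  have e := sw_c_mul_c_εt hta hS h
  simp only [c_εt, mul_left_comm _ (p.c 1)] at e
  rw [← mul_sw] at e
  rw [← e, p.cocomm.sw_comm h (by fun_prop) (by fun_prop)]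
  simp only [mul_comm (p.c _) (p.a _)]
  rw [sw_a_mul_c, c_one_mul hta]

theorem εs_c (h : H) : p.WA.εs (p.c h) = p.c h := by
  rw [c_eq, map_sw]
  simp only [p.WA.εs_mul, εs_a, εs_b]

theorem εt_c (hta : ∀ h, p.WA.εt (p.a h) = p.a h) (hS : p.WH.IsAntipode S) {S' : A →ₗ[k] A}
    (hS' : p.WA.IsAntipode S') (h : H) : p.WA.εt (p.c h) = p.c h := by
  have e : p.WA.εt (p.c 1) = p.c 1 := by
    rw [c_eq, map_sw]
    simp only [p.WA.εt_mul, hta]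
    rw [p.cocomm.sw_comm 1 (by fun_prop) (by fun_prop),
      p.cocomm.sw_comm 1 (F := fun u v => p.a u * p.b v) (by fun_prop) (by fun_prop)]
    exact p.sw_one_εt_b hS' fun x v => p.a v * x
  rw [c_eq_mul_a hta hS, p.WA.εt_mul, e, hta]

theorem sw_c_comul (hta : ∀ h, p.WA.εt (p.a h) = p.a h) (hS : p.WH.IsAntipode S) (h : H)
    (F : A → H → P)
    (h1 : ∀ a, IsLinearMap k (fun b => F a b) := by intros; fun_prop)
    (h2 : ∀ b, IsLinearMap k (fun a => F a b) := by intros; fun_prop) :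
    sw p.WH.comul h (fun u v => F (p.c u) v) = sw p.WH.comul 1 fun u v => F (p.c u) (v * h) := by
  have e := c_eq_mul_a hta hS
  rw [sw_congr _ _ fun u v => congrArg (F · v) (e u),
    sw_congr _ _ fun u v => congrArg (F · (v * h)) (e u)]
  exact p.sw_a_comul h fun x v => F (p.c 1 * x) v

theorem a_antipode (hS : p.WH.IsAntipode S) (h : H) : p.a (S h) = p.a (p.WH.εs h) := by
  rw [← hS.sw_mul_εt, ← hS.mul_sw, map_sw, map_sw]
  refine sw_congr _ _ fun u v => ?_
  rw [← act_a, ← act_a, a_εt]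

theorem sw_b_mul_act (h : H) {y : A} (hy : p.WA.εs y = y) :
    sw p.WH.comul h (fun u v => p.b u * p.act v y) = p.c h * y := by
  rw [← p.sw_c_mul_act h hy]
  calc _ = sw p.WH.comul h fun u v => sw p.WH.comul v fun v w => p.b u * (p.a v * p.act w y) := by
        refine sw_congr _ _ fun u v => ?_
        rw [← mul_sw, sw_a_mul_act]
    _ = _ := by
        rw [← p.WH.sw_coassoc h (F := fun u v w => p.b u * (p.a v * p.act w y))
          (by fun_prop) (by fun_prop) (by fun_prop)]
        refine sw_congr _ _ fun u v => ?_
        rw [c_eq, sw_mul, p.cocomm.sw_comm u (by fun_prop) (by fun_prop)]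
        refine sw_congr _ _ fun _ _ => ?_
        ring

end CompatiblePair

namespace WeakBialgebra
variable {k H : Type*} [Field k] [Ring H] [Algebra k H] (W : WeakBialgebra k H)

theorem sw_mul_εs (h : H) : sw W.comul h (fun u v => u * W.εs v) = h := by
  conv_rhs => rw [← W.sw_counit_right h lin_id]
  rw [← W.sw_mul_one h fun a b => W.counit b • a]
  simp only [εs_eq, mul_sw, Algebra.mul_smul_comm]

theorem counit_εs' (h : H) : W.counit (W.εs h) = W.counit h := by
  rw [εs_eq]
  have := W.counit_mul_mul' h 1 1
  simp at this ⊢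
  simp [this, mul_comm]

end WeakBialgebra

namespace CompatiblePair

variable {k H A P : Type*} [Field k] [Ring H] [Algebra k H] [CommRing A] [Algebra k A]
  [AddCommMonoid P] [Module k P] {p : CompatiblePair k H A} {S : H →ₗ[k] H}

theorem sw_cond8_simplified (hS : p.WH.IsAntipode S) {h : H}
    (h8 : cond8LHS k p.WH p.WA p.act p.coact S h = cond8RHS k p.WH p.WA p.act p.coact h)
    (F : A → H → P)
    (h1 : ∀ a, IsLinearMap k (fun b => F a b) := by intros; fun_prop)
    (h2 : ∀ b, IsLinearMap k (fun a => F a b) := by intros; fun_prop) :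
    (sw p.WH.comul h fun m t => sw p.WH.comul t fun u q =>
      F (p.b m * p.a (p.WH.εs u)) (p.WH.εs q)) =
      sw p.WH.comul 1 fun u v => F (p.c h * p.c u) v := by
  have e := p.sw_cond8 h8 F
  simp only [p.WA.εs_mul, a_antipode hS, εs_a] at e
  have eL (u t : H) : (sw p.WH.comul t fun v w => sw p.coact v fun v0 y => sw p.coact u fun u0 x =>
      F (p.WA.εs x * p.WA.εs y * p.a (p.WH.εs u0)) (S v0 * w)) =
      sw p.WH.comul t fun v1 q => sw p.WH.comul u fun u1 u0 =>
        F (p.b u1 * p.b v1 * p.a (p.WH.εs u0)) (p.WH.εs q) := by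
    calc _ = sw p.WH.comul t fun v w => sw p.WH.comul v fun v0 v1 => sw p.WH.comul u fun u1 u0 =>
          F (p.b u1 * p.b v1 * p.a (p.WH.εs u0)) (S v0 * w) := by
          refine sw_congr _ _ fun v w => ?_
          rw [p.sw_coact_εs v fun v0 y => sw p.coact u fun u0 x =>
            F (p.WA.εs x * y * p.a (p.WH.εs u0)) (S v0 * w)]
          refine sw_congr _ _ fun v0 v1 => ?_
          rw [p.sw_coact_εs u fun u0 x => F (x * p.b v1 * p.a (p.WH.εs u0)) (S v0 * w)]
          exact p.cocomm.sw_comm u (by fun_prop) (by fun_prop)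
      _ = _ := by
          rw [p.WH.sw_coassoc t (by fun_prop) (by fun_prop) (by fun_prop),
            p.cocomm.sw_comm₃ t fun v0 v1 w => sw p.WH.comul u fun u1 u0 =>
              F (p.b u1 * p.b v1 * p.a (p.WH.εs u0)) (S v0 * w)]
          refine sw_congr _ _ fun v1 q => ?_
          rw [sw_swap]
          refine sw_congr _ _ fun u1 u0 => ?_
          rw [← hS.mul_sw q, lin_apply_sw (h1 _)]
  have eR (u : H) (v0 : H) (y : A) : (sw p.coact h fun h0 x =>
      F (p.WA.εs x * p.WA.εs y * p.a (h0 * u)) v0) = F (p.c h * p.a u * p.WA.εs y) v0 := by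
    rw [p.sw_coact_εs h fun h0 x => F (x * p.WA.εs y * p.a (h0 * u)) v0,
      p.cocomm.sw_comm h (by fun_prop) (by fun_prop), ← p.sw_b_mul_act h (p.εs_a u)]
    have l : IsLinearMap k fun x => F (x * p.WA.εs y) v0 := by fun_prop
    rw [lin_apply_sw l]
    refine sw_congr _ _ fun a b => ?_
    rw [act_a]
    congr 1; ring
  simp only [eL, eR] at e
  have eR' (u v : H) := p.sw_coact_εs v fun v0 y => F (p.c h * p.a u * y) v0
  simp only [eR'] at e
  calc _ = sw p.WH.comul h fun u t => sw p.WH.comul t fun v1 q => sw p.WH.comul u fun u1 u0 =>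
          F (p.b u1 * p.b v1 * p.a (p.WH.εs u0)) (p.WH.εs q) := by
        refine Eq.trans ?_ (sw_congr _ _ fun u t => sw_swap ..)
        rw [p.WH.sw_coassoc h (F := fun u1 u0 t => sw p.WH.comul t fun v1 q =>
          F (p.b u1 * p.b v1 * p.a (p.WH.εs u0)) (p.WH.εs q))
          (by fun_prop) (by fun_prop) (by fun_prop)]
        have e3 (u1 s : H) := p.cocomm.sw_comm₃ s fun u0 v1 q =>
          F (p.b u1 * p.b v1 * p.a (p.WH.εs u0)) (p.WH.εs q)
        simp only [e3]
        rw [← p.WH.sw_coassoc h (F := fun u1 a t => sw p.WH.comul t fun b q =>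
          F (p.b u1 * p.b a * p.a (p.WH.εs b)) (p.WH.εs q))
          (by fun_prop) (by fun_prop) (by fun_prop)]
        refine sw_congr _ _ fun m t => ?_
        have l : IsLinearMap k fun x => sw p.WH.comul t fun b q =>
          F (x * p.a (p.WH.εs b)) (p.WH.εs q) := by fun_prop
        conv_lhs => rw [← p.b_conv_b m]
        rw [lin_apply_sw l]
    _ = _ := e
    _ = sw p.WH.comul 1 fun u v => sw p.WH.comul u fun x y => F (p.c h * (p.a x * p.b y)) v := by
        rw [p.WH.sw_coassoc 1 (by fun_prop) (by fun_prop) (by fun_prop)]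
        refine sw_congr _ _ fun u v => ?_
        rw [p.cocomm.sw_comm v (by fun_prop) (by fun_prop)]
        simp only [mul_assoc]
    _ = _ := by
        refine sw_congr _ _ fun u v => ?_
        have l : IsLinearMap k fun x => F (p.c h * x) v := by fun_prop
        rw [c_eq p u, lin_apply_sw l]

theorem sw_b_mul_a_εs (hta : ∀ h, p.WA.εt (p.a h) = p.a h) (hS : p.WH.IsAntipode S) {h : H}
    (h8 : cond8LHS k p.WH p.WA p.act p.coact S h = cond8RHS k p.WH p.WA p.act p.coact h) :
    sw p.WH.comul h (fun u v => p.b u * p.a (p.WH.εs v)) = p.c h := by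
  have e := sw_cond8_simplified hS h8 fun x z => p.WH.counit z • x
  have e1 (m t : H) := p.WH.sw_counit_right t (F := fun u => p.b m * p.a (p.WH.εs u)) (by fun_prop)
  have e2 := p.WH.sw_counit_right 1 (F := fun u => p.c h * p.c u) (by fun_prop)
  simp only [p.WH.counit_εs', e1, e2] at e
  rw [e, mul_comm, c_one_mul hta]

theorem sw_c_εs (hta : ∀ h, p.WA.εt (p.a h) = p.a h) (hS : p.WH.IsAntipode S)
    (h8 : ∀ h, cond8LHS k p.WH p.WA p.act p.coact S h = cond8RHS k p.WH p.WA p.act p.coact h)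
    (h : H) (F : A → H → P)
    (h1 : ∀ a, IsLinearMap k (fun b => F a b) := by intros; fun_prop)
    (h2 : ∀ b, IsLinearMap k (fun a => F a b) := by intros; fun_prop) :
    (sw p.WH.comul h fun u v => F (p.c u) (p.WH.εs v)) =
      sw p.WH.comul 1 fun u v => F (p.c h * p.c u) v := by
  rw [← sw_cond8_simplified hS (h8 h) F, ← p.WH.sw_coassoc h
    (F := fun m u q => F (p.b m * p.a (p.WH.εs u)) (p.WH.εs q))
    (by fun_prop) (by fun_prop) (by fun_prop)]
  refine sw_congr _ _ fun u v => ?_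
  rw [← sw_b_mul_a_εs hta hS (h8 u), lin_apply_sw (h2 _)]

theorem sw_c_εt (hta : ∀ h, p.WA.εt (p.a h) = p.a h) (hS : p.WH.IsAntipode S)
    (h : H) (F : A → H → P)
    (h1 : ∀ a, IsLinearMap k (fun b => F a b) := by intros; fun_prop)
    (h2 : ∀ b, IsLinearMap k (fun a => F a b) := by intros; fun_prop) :
    (sw p.WH.comul h fun u v => F (p.c u) (p.WH.εt v)) =
      sw p.WH.comul 1 fun u v => F (p.c h * p.c u) v := by
  have e := c_eq_mul_a hta hS
  rw [p.WH.sw_εt_right h fun u v => F (p.c u) v]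
  rw [sw_congr _ _ fun u v => congrArg (F · v) (e (u * h)),
    sw_congr _ _ fun u v => congrArg (F · v) (congrArg (p.c h * ·) (e u))]
  simp only [← act_a]
  rw [p.sw_one_act (p.a h) fun x v => F (p.c 1 * x) v, e h]
  refine sw_congr _ _ fun u v => ?_
  congr 1
  calc _ = p.c 1 * (p.a u * p.a h) := rfl
    _ = p.c 1 * p.c 1 * (p.a u * p.a h) := by rw [c_one_mul_self hta]
    _ = _ := by ring

theorem sw_c_mul_c_one (hta : ∀ h, p.WA.εt (p.a h) = p.a h) (hS : p.WH.IsAntipode S)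
    (h8 : ∀ h, cond8LHS k p.WH p.WA p.act p.coact S h = cond8RHS k p.WH p.WA p.act p.coact h)
    (h : H) (F : A → H → P)
    (h1 : ∀ a, IsLinearMap k (fun b => F a b) := by intros; fun_prop)
    (h2 : ∀ b, IsLinearMap k (fun a => F a b) := by intros; fun_prop) :
    (sw p.WH.comul h fun u v => sw p.WH.comul 1 fun y z => F (p.c u * p.c y) (v * z)) =
      sw p.WH.comul h fun u v => F (p.c u) v := by
  have e (u v : H) := sw_c_εs hta hS h8 u fun x z => F x (v * z)
  simp only [← e]
  rw [p.WH.sw_coassoc h (F := fun u z v => F (p.c u) (v * p.WH.εs z))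
    (by fun_prop) (by fun_prop) (by fun_prop)]
  refine sw_congr _ _ fun u v => ?_
  rw [p.cocomm.sw_comm v (by fun_prop) (by fun_prop)]
  conv_rhs => rw [← p.WH.sw_mul_εs v, lin_apply_sw (h1 _)]

end CompatiblePair

namespace CompatiblePair

variable {k H A P : Type*} [Field k] [Ring H] [Algebra k H] [CommRing A] [Algebra k A]
  [AddCommMonoid P] [Module k P] {p : CompatiblePair k H A} {S : H →ₗ[k] H}

theorem sw_c_coact (hta : ∀ h, p.WA.εt (p.a h) = p.a h) (hS : p.WH.IsAntipode S)
    (h : H) (G : H → A → P)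
    (h1 : ∀ a, IsLinearMap k (fun b => G a b) := by intros; fun_prop)
    (h2 : ∀ b, IsLinearMap k (fun a => G a b) := by intros; fun_prop) :
    (sw p.WH.comul h fun u v => sw p.coact v fun z t => G z (p.c u * t)) =
      sw p.coact h fun h0 t => sw p.WH.comul h0 fun u z => G z (p.c u * t) := by
  have e := c_eq_mul_a hta hS
  have e1 (h0 : H) (t : A) := sw_c_comul hta hS h0 fun x z => G z (x * t)
  have e2 := p.sw_a_coact hta h fun z t => G z (p.c 1 * t)
  simp only [e1]
  simp only [← mul_assoc, ← e, c_one_mul hta] at e2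
  rw [e2, sw_swap]

theorem sw_c_mul_b (h : H) : sw p.WH.comul h (fun u v => p.c u * p.b v) = p.c h := by
  rw [p.cocomm.sw_comm h (by fun_prop) (by fun_prop)]
  simp only [mul_comm (p.c _)]
  exact p.sw_b_mul_c h

theorem sw_one_c_mul_b (hta : ∀ h, p.WA.εt (p.a h) = p.a h) (F : A → H → P)
    (h1 : ∀ a, IsLinearMap k (fun b => F a b) := by intros; fun_prop)
    (h2 : ∀ b, IsLinearMap k (fun a => F a b) := by intros; fun_prop) :
    (sw p.WH.comul 1 fun u v => sw p.WH.comul 1 fun y z => F (p.c u * p.b y) (v * z)) =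
      sw p.WH.comul 1 fun u v => F (p.c u) v := by
  rw [← sw_mul_c hta 1 1 F, mul_one]

theorem sw_c_mul_antipode {S' : A →ₗ[k] A} (hS' : p.WA.IsAntipode S')
    (h7 : ∀ h, cond7LHS k p.WH p.WA p.act p.coact S' h = cond7RHS k p.WH p.WA p.act p.coact h)
    (hS : p.WH.IsAntipode S) (h : H) :
    sw p.coact h (fun h0 y => p.c h0 * S' y) = p.c h := by
  have hta := εt_a h7 hS'
  have e := sw_cond7_counit h7 h fun x y => p.c 1 * (x * y)
  have key (h0 : H) (z : A) : (sw p.WH.comul 1 fun u v =>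
      p.c 1 * (p.a (u * h0) * (z * p.b v))) = p.c h0 * z := by
    simp only [← act_a]
    rw [p.sw_one_act (p.a h0) fun x v => p.c 1 * (x * (z * p.b v)), c_eq_mul_a hta hS h0]
    calc _ = p.a h0 * z * p.c 1 * sw p.WH.comul 1 (fun u v => p.a u * p.b v) := by
          rw [mul_sw]
          refine sw_congr _ _ fun u v => ?_
          ring
      _ = _ := by
          rw [← c_eq, mul_assoc, c_one_mul_self hta]
          ring
  simp only [hta, key] at e
  rw [e, p.sw_coact_εt h fun x y => p.c x * y]
  calc _ = p.WA.εt (sw p.WH.comul h fun u v => p.c u * p.b v) := by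
        simp only [map_sw, p.WA.εt_mul, εt_c hta hS hS']
    _ = p.WA.εt (p.c h) := by
        rw [sw_c_mul_b]
    _ = _ := εt_c hta hS hS' h

end CompatiblePair

namespace CompatiblePair

variable {k H A P : Type*} [Field k] [Ring H] [Algebra k H] [CommRing A] [Algebra k A]
  [AddCommMonoid P] [Module k P] (p : CompatiblePair k H A) {S : H →ₗ[k] H} {S' : A →ₗ[k] A}

/-- The multiplication of the smash product as a bilinear map. -/
def mul : A ⊗[k] H →ₗ[k] A ⊗[k] H →ₗ[k] A ⊗[k] H := TensorProduct.curry (smashMul k p.WH p.act)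

/-- The projection onto `A ♯♯ H`. -/
def proj : A ⊗[k] H →ₗ[k] A ⊗[k] H := projBoth k p.WH p.WA p.act p.coact

/-- The antipode of `A ♯♯ H`. -/
def antipode (S : H →ₗ[k] H) (S' : A →ₗ[k] A) : A ⊗[k] H →ₗ[k] A ⊗[k] H :=
  smashAntipode k p.WH p.WA p.act p.coact S S'

/-- The comultiplication of the smash coproduct. -/
def comul : A ⊗[k] H →ₗ[k] (A ⊗[k] H) ⊗[k] (A ⊗[k] H) := smashComul k p.WH p.WA p.coact

theorem smashMul_tmul (U V : A ⊗[k] H) : smashMul k p.WH p.act (U ⊗ₜ V) = p.mul U V := rfl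

theorem mul_tmul (x y : A) (h g : H) :
    p.mul (x ⊗ₜ h) (y ⊗ₜ g) = sw p.WH.comul h fun u v => (x * p.act u y) ⊗ₜ (v * g) := by
  simp [mul, smashMul, expand p.WH.comul]

theorem comul_tmul (x : A) (h : H) :
    p.comul (x ⊗ₜ h) = sw p.WA.comul x fun x1 x2 => sw p.WH.comul h fun u v =>
      sw p.coact u fun z t => (x1 ⊗ₜ z) ⊗ₜ ((x2 * t) ⊗ₜ v) := by
  simp [comul, smashComul, expand p.WH.comul, expand p.WA.comul, expand p.coact]
  refine Eq.trans ?_ (sw_swap ..)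
  exact sw_congr _ _ fun u v => sw_swap ..

theorem projUnder_tmul (x : A) (h : H) :
    projUnder k p.WH p.act (x ⊗ₜ h) = sw p.WH.comul h fun u v => (x * p.a u) ⊗ₜ v := by
  change p.mul (x ⊗ₜ h) (1 ⊗ₜ 1) = _
  simp [mul_tmul, act_one]

theorem projBar_tmul (x : A) (h : H) :
    projBar k p.WH p.WA p.coact (x ⊗ₜ h) = sw p.WH.comul h fun u v => (x * p.b v) ⊗ₜ u := by
  have e := p.comul_tmul x h
  simp only [comul] at e
  simp [projBar, e, smashCounit]
  have e1 (a b : A) : (sw p.WH.comul h fun u v => sw p.coact u fun z t =>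
      (p.WA.counit (b * t) * p.WH.counit v) • a ⊗ₜ[k] z) =
      sw p.coact h fun z t => p.WA.counit (t * b) • a ⊗ₜ[k] z := by
    rw [← p.WH.sw_counit_right h (F := fun u => sw p.coact u fun z t =>
      p.WA.counit (t * b) • a ⊗ₜ[k] z) (by fun_prop)]
    simp only [smul_sw, smul_smul, mul_comm]
  simp only [e1]
  rw [sw_swap]
  have e2 (t : A) (z : H) : (sw p.WA.comul x fun a b => p.WA.counit (t * b) • a ⊗ₜ[k] z) =
      (x * p.WA.εs t) ⊗ₜ[k] z := by
    rw [mul_comm x, ← p.WA.sw_counit_mul_right]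
    simp
  simp only [e2]
  exact p.sw_coact_εs h fun z t => (x * t) ⊗ₜ[k] z

theorem proj_tmul (x : A) (h : H) :
    p.proj (x ⊗ₜ h) = sw p.WH.comul h fun u v => (x * p.c u) ⊗ₜ v := by
  simp only [proj, projBoth, LinearMap.comp_apply, projUnder_tmul, map_sw, projBar_tmul]
  rw [sw_congr _ _ fun a b => p.cocomm.sw_comm b (F := fun u v => (x * p.a a * p.b v) ⊗ₜ[k] u)
    (by fun_prop) (by fun_prop), ← p.WH.sw_coassoc h
    (F := fun a v u => (x * p.a a * p.b v) ⊗ₜ[k] u)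
    (by fun_prop) (by fun_prop) (by fun_prop)]
  refine sw_congr _ _ fun u v => ?_
  rw [c_eq, mul_sw, sw_tmul]
  simp only [_root_.mul_assoc]

theorem antipode_tmul (x : A) (h : H) :
    p.antipode S S' (x ⊗ₜ h) = sw p.coact h fun z t =>
      p.mul (p.proj (1 ⊗ₜ S z)) (p.proj (S' (x * t) ⊗ₜ 1)) := by
  simp [antipode, smashAntipode, expand p.coact, mul, proj]

theorem mul_assoc (U V W : A ⊗[k] H) : p.mul (p.mul U V) W = p.mul U (p.mul V W) := by
  induction U with
  | zero => simp
  | add U U' h h' => simp [h, h']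
  | tmul x h =>
    induction V with
    | zero => simp
    | add U U' h h' => simp [h, h']
    | tmul y g =>
      induction W with
      | zero => simp
      | add U U' h h' => simp [h, h']
      | tmul z l =>
        simp only [mul_tmul, sw_apply, map_sw]
        calc _ = sw p.WH.comul h fun a b => sw p.WH.comul b fun u v => sw p.WH.comul g fun c d =>
              (x * p.act a y * p.act u (p.act c z)) ⊗ₜ[k] (v * (d * l)) := by
              refine sw_congr _ _ fun a b => ?_
              rw [p.WH.sw_comul_mul _ _ (by fun_prop) (by fun_prop)]
              simp only [act_act, _root_.mul_assoc]
          _ = _ := by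
              rw [← p.WH.sw_coassoc h (F := fun a u v => sw p.WH.comul g fun c d =>
                (x * p.act a y * p.act u (p.act c z)) ⊗ₜ[k] (v * (d * l)))
                (by fun_prop) (by fun_prop) (by fun_prop)]
              conv_rhs => rw [sw_swap]
              refine sw_congr _ _ fun u v => ?_
              rw [sw_swap]
              refine sw_congr _ _ fun c d => ?_
              rw [p.act_mul, mul_sw, sw_tmul]
              simp only [_root_.mul_assoc]

end CompatiblePair

namespace CompatiblePair

variable {k H A P : Type*} [Field k] [Ring H] [Algebra k H] [CommRing A] [Algebra k A]
  [AddCommMonoid P] [Module k P] {p : CompatiblePair k H A} {S : H →ₗ[k] H} {S' : A →ₗ[k] A}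

/-- Antipodes satisfying the two conditions that make `A ♯♯ H` a weak Hopf algebra. -/
structure IsHopf (p : CompatiblePair k H A) (S : H →ₗ[k] H) (S' : A →ₗ[k] A) : Prop where
  antipodeH : p.WH.IsAntipode S
  antipodeA : p.WA.IsAntipode S'
  cond7 : ∀ h, cond7LHS k p.WH p.WA p.act p.coact S' h = cond7RHS k p.WH p.WA p.act p.coact h
  cond8 : ∀ h, cond8LHS k p.WH p.WA p.act p.coact S h = cond8RHS k p.WH p.WA p.act p.coact h

namespace IsHopf

theorem εt_a (hp : p.IsHopf S S') (h : H) : p.WA.εt (p.a h) = p.a h :=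
  CompatiblePair.εt_a hp.cond7 hp.antipodeA h

theorem sw_c_comul (hp : p.IsHopf S S') (h : H) (F : A → H → P)
    (h1 : ∀ a, IsLinearMap k (fun b => F a b) := by intros; fun_prop)
    (h2 : ∀ b, IsLinearMap k (fun a => F a b) := by intros; fun_prop) :
    sw p.WH.comul h (fun u v => F (p.c u) v) = sw p.WH.comul 1 fun u v => F (p.c u) (v * h) :=
  CompatiblePair.sw_c_comul hp.εt_a hp.antipodeH h F

theorem proj_tmul (hp : p.IsHopf S S') (x : A) (h : H) :
    p.proj (x ⊗ₜ h) = sw p.WH.comul 1 fun u v => (x * p.c u) ⊗ₜ (v * h) := by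
  rw [p.proj_tmul]
  exact hp.sw_c_comul h fun y v => (x * y) ⊗ₜ v

theorem sw_proj_mul_c (x : A) (h : H) :
    sw p.WH.comul h (fun u v => p.proj ((x * p.c u) ⊗ₜ v)) = p.proj (x ⊗ₜ h) := by
  simp only [p.proj_tmul]
  rw [← p.WH.sw_coassoc h (F := fun u v w => (x * p.c u * p.c v) ⊗ₜ[k] w)
    (by fun_prop) (by fun_prop) (by fun_prop)]
  refine sw_congr _ _ fun u v => ?_
  rw [← sw_c_mul_c u, mul_sw, sw_tmul]
  simp only [_root_.mul_assoc]

theorem sw_c_mul_act' (hp : p.IsHopf S S') (h : H) (y : A) :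
    sw p.WH.comul h (fun u v => p.c u * p.act v y) = p.c 1 * p.act h y := by
  rw [← p.sw_a_mul_act h y, mul_sw]
  refine sw_congr _ _ fun u v => ?_
  rw [c_eq_mul_a hp.εt_a hp.antipodeH u, _root_.mul_assoc]

theorem proj_mul_tmul (hp : p.IsHopf S S') (x y : A) (h : H) :
    p.mul (p.proj (x ⊗ₜ 1)) (y ⊗ₜ h) = p.proj ((x * y) ⊗ₜ h) := by
  rw [p.proj_tmul, hp.proj_tmul]
  simp only [map_sw, sw_apply, mul_tmul]
  rw [← p.WH.sw_coassoc 1 (F := fun u v w => (x * p.c u * p.act v y) ⊗ₜ[k] (w * h))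
    (by fun_prop) (by fun_prop) (by fun_prop)]
  have e (u v : H) : (sw p.WH.comul u fun u v' => (x * p.c u * p.act v' y) ⊗ₜ[k] (v * h)) =
      (x * (p.c 1 * p.act u y)) ⊗ₜ[k] (v * h) := by
    rw [← hp.sw_c_mul_act', mul_sw, sw_tmul]
    simp only [_root_.mul_assoc]
  simp only [e]
  rw [p.sw_one_act y fun y v => (x * (p.c 1 * y)) ⊗ₜ[k] (v * h)]
  refine sw_congr _ _ fun u v => ?_
  rw [c_eq_mul_a hp.εt_a hp.antipodeH u]
  congr 1; ring

theorem proj_mul_proj (hp : p.IsHopf S S') (x y : A) (h : H) :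
    p.mul (p.proj (x ⊗ₜ 1)) (p.proj (y ⊗ₜ h)) = p.proj ((x * y) ⊗ₜ h) := by
  rw [p.proj_tmul y, map_sw, ← sw_proj_mul_c (x * y)]
  simp only [hp.proj_mul_tmul, _root_.mul_assoc]

theorem one_proj_mul_tmul (hp : p.IsHopf S S') {y : A} (hy : p.WA.εs y = y) (g h : H) :
    p.mul (p.proj (1 ⊗ₜ g)) (y ⊗ₜ h) = p.proj (y ⊗ₜ (g * h)) := by
  rw [p.proj_tmul, hp.proj_tmul]
  simp only [map_sw, sw_apply, mul_tmul, one_mul]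
  rw [← p.WH.sw_coassoc g (F := fun u v w => (p.c u * p.act v y) ⊗ₜ[k] (w * h))
    (by fun_prop) (by fun_prop) (by fun_prop)]
  have e (u v : H) : (sw p.WH.comul u fun u v' => (p.c u * p.act v' y) ⊗ₜ[k] (v * h)) =
      (p.c u * y) ⊗ₜ[k] (v * h) := by
    rw [← p.sw_c_mul_act u hy, sw_tmul]
  simp only [e]
  rw [hp.sw_c_comul g fun x v => (x * y) ⊗ₜ[k] (v * h)]
  refine sw_congr _ _ fun u v => ?_
  rw [mul_comm y, _root_.mul_assoc v]

theorem sw_proj_mul_antipode (hp : p.IsHopf S S') (x : A) (h : H) :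
    sw p.WH.comul h (fun u v => p.mul (p.proj (x ⊗ₜ u)) (p.proj (1 ⊗ₜ S v))) =
      p.proj ((x * p.c h) ⊗ₜ 1) := by
  have e (m n : H) : p.mul (p.proj (x ⊗ₜ m)) (p.proj (1 ⊗ₜ n)) =
      sw p.WH.comul m fun u v => (x * p.c u) ⊗ₜ (v * n) := by
    rw [p.proj_tmul, hp.proj_tmul]
    simp only [map_sw, sw_apply, mul_tmul, one_mul]
    have e2 (s t : H) : (sw p.WH.comul m fun u v => sw p.WH.comul v fun v1 v2 =>
        (x * p.c u * p.act v1 (p.c s)) ⊗ₜ[k] (v2 * (t * n))) =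
        sw p.WH.comul m fun u v => (x * (p.c u * p.c s)) ⊗ₜ[k] (v * t * n) := by
      rw [← p.WH.sw_coassoc m (F := fun u v w => (x * p.c u * p.act v (p.c s)) ⊗ₜ[k] (w * (t * n)))
        (by fun_prop) (by fun_prop) (by fun_prop)]
      refine sw_congr _ _ fun u v => ?_
      rw [← p.sw_c_mul_act u (p.εs_c s), mul_sw, sw_tmul]
      simp only [_root_.mul_assoc]
    simp only [e2]
    rw [sw_swap]
    exact sw_c_mul_c_one hp.εt_a hp.antipodeH hp.cond8 m fun y v => (x * y) ⊗ₜ (v * n)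
  simp only [e]
  rw [p.WH.sw_coassoc h (F := fun u v w => (x * p.c u) ⊗ₜ[k] (v * S w))
    (by fun_prop) (by fun_prop) (by fun_prop), p.proj_tmul]
  have e3 := sw_c_εt hp.εt_a hp.antipodeH h fun y v => (x * y) ⊗ₜ[k] v
  simp only [← _root_.mul_assoc] at e3
  rw [← e3]
  simp only [← hp.antipodeH.sw_mul, tmul_sw]

end IsHopf

end CompatiblePair

namespace CompatiblePair

variable {k H A P : Type*} [Field k] [Ring H] [Algebra k H] [CommRing A] [Algebra k A]
  [AddCommMonoid P] [Module k P] {p : CompatiblePair k H A} {S : H →ₗ[k] H} {S' : A →ₗ[k] A}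

namespace IsHopf

theorem εt_c (hp : p.IsHopf S S') (h : H) : p.WA.εt (p.c h) = p.c h :=
  CompatiblePair.εt_c hp.εt_a hp.antipodeH hp.antipodeA h

theorem comul_proj_aux (x : A) (h : H) :
    p.comul (p.proj (x ⊗ₜ h)) = sw p.WA.comul x fun x1 x2 => sw p.WH.comul h fun w v2 =>
      sw p.WH.comul w fun u v1 => sw p.coact v1 fun z t =>
        (x1 ⊗ₜ z) ⊗ₜ[k] ((x2 * (p.c u * t)) ⊗ₜ v2) := by
  rw [p.proj_tmul]
  simp only [map_sw, p.comul_tmul, mul_comm x]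
  have e (u v : H) := p.WA.sw_comul_mul_εs x _ (p.εs_c u) (F := fun x1 x2 =>
    sw p.WH.comul v fun v1 v2 => sw p.coact v1 fun z t =>
      (x1 ⊗ₜ[k] z) ⊗ₜ[k] ((x2 * t) ⊗ₜ[k] v2)) (by fun_prop) (by fun_prop)
  simp only [e]
  rw [sw_swap]
  refine sw_congr _ _ fun x1 x2 => ?_
  rw [p.WH.sw_coassoc h (F := fun u v1 v2 => sw p.coact v1 fun z t =>
        (x1 ⊗ₜ z) ⊗ₜ[k] ((x2 * (p.c u * t)) ⊗ₜ v2)) (by fun_prop) (by fun_prop) (by fun_prop)]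
  refine sw_congr _ _ fun u v => sw_congr _ _ fun v1 v2 => sw_congr _ _ fun z t => ?_
  congr 2; ring

theorem comul_proj_right (x : A) (h : H) :
    p.comul (p.proj (x ⊗ₜ h)) = sw p.WA.comul x fun x1 x2 => sw p.WH.comul h fun u v =>
      sw p.coact u fun z t => (x1 ⊗ₜ z) ⊗ₜ (p.proj ((x2 * t) ⊗ₜ v)) := by
  rw [comul_proj_aux]
  refine sw_congr _ _ fun x1 x2 => ?_
  simp only [p.proj_tmul, tmul_sw]
  have e (w v2 : H) := p.cocomm.sw_comm w (F := fun u v1 => sw p.coact v1 fun z t =>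
        (x1 ⊗ₜ[k] z) ⊗ₜ[k] ((x2 * (p.c u * t)) ⊗ₜ[k] v2)) (by fun_prop) (by fun_prop)
  simp only [e]
  rw [p.WH.sw_coassoc h (F := fun v1 u v2 => sw p.coact v1 fun z t =>
        (x1 ⊗ₜ[k] z) ⊗ₜ[k] ((x2 * (p.c u * t)) ⊗ₜ[k] v2))
          (by fun_prop) (by fun_prop) (by fun_prop)]
  refine sw_congr _ _ fun u v => ?_
  rw [sw_swap]
  simp only [_root_.mul_assoc, mul_comm]

theorem comul_proj_left (hp : p.IsHopf S S') (x : A) (h : H) :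
    p.comul (p.proj (x ⊗ₜ h)) = sw p.WA.comul x fun x1 x2 => sw p.WH.comul h fun u v =>
      sw p.coact u fun z t => (p.proj (x1 ⊗ₜ z)) ⊗ₜ ((x2 * t) ⊗ₜ v) := by
  rw [comul_proj_aux]
  have e (x1 x2 : A) (w v2 : H) := sw_c_coact hp.εt_a hp.antipodeH w fun z t =>
    (x1 ⊗ₜ[k] z) ⊗ₜ[k] ((x2 * t) ⊗ₜ[k] v2)
  simp only [e, p.proj_tmul, sw_tmul]
  rw [sw_swap]
  conv_rhs => rw [sw_swap]
  refine sw_congr _ _ fun u v => ?_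
  rw [sw_swap]
  conv_rhs => rw [sw_swap]
  refine sw_congr _ _ fun z t => ?_
  rw [sw_swap]
  conv_rhs => rw [sw_swap]
  refine sw_congr _ _ fun z1 z2 => ?_
  have e1 := p.WA.sw_comul_mul_εs x _ (p.εs_c z1) (F := fun x1 x2 =>
    (x1 ⊗ₜ[k] z2) ⊗ₜ[k] ((x2 * t) ⊗ₜ[k] v)) (by fun_prop) (by fun_prop)
  have e2 := p.WA.sw_comul_mul_εt x _ (hp.εt_c z1) (F := fun x1 x2 =>
    (x1 ⊗ₜ[k] z2) ⊗ₜ[k] ((x2 * t) ⊗ₜ[k] v)) (by fun_prop) (by fun_prop)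
  simp only [mul_comm _ (p.c z1), ← e2, e1, _root_.mul_assoc, mul_left_comm]

end IsHopf

end CompatiblePair

namespace CompatiblePair

variable {k H A P : Type*} [Field k] [Ring H] [Algebra k H] [CommRing A] [Algebra k A]
  [AddCommMonoid P] [Module k P] {p : CompatiblePair k H A} {S : H →ₗ[k] H} {S' : A →ₗ[k] A}

namespace IsHopf

theorem sw_c_mul_antipode (hp : p.IsHopf S S') (h : H) :
    sw p.coact h (fun z y => p.c z * S' y) = p.c h :=
  CompatiblePair.sw_c_mul_antipode hp.antipodeA hp.cond7 hp.antipodeH h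

theorem mul_antipode (hp : p.IsHopf S S') (x : A) (h : H) :
    ev (fun U V => p.mul U (p.antipode S S' V)) (by intros; fun_prop) (by intros; fun_prop)
      (p.comul (p.proj (x ⊗ₜ h))) = p.proj ((p.WA.εt x * p.c h) ⊗ₜ 1) := by
  rw [hp.comul_proj_left]
  simp only [map_sw, ev_tmul, p.antipode_tmul]
  have e (x1 x2 : A) : (sw p.WH.comul h fun u v => sw p.coact u fun z t => sw p.coact v fun z' t' =>
      p.mul (p.proj (x1 ⊗ₜ z)) (p.mul (p.proj (1 ⊗ₜ S z')) (p.proj (S' (x2 * t * t') ⊗ₜ 1)))) =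
      p.proj ((x1 * S' x2 * p.c h) ⊗ₜ 1) := by
    simp only [_root_.mul_assoc x2]
    rw [← p.sw_comul_coact h fun z z' t => p.mul (p.proj (x1 ⊗ₜ z))
      (p.mul (p.proj (1 ⊗ₜ S z')) (p.proj (S' (x2 * t) ⊗ₜ 1)))]
    simp only [← p.mul_assoc]
    rw [← hp.sw_c_mul_antipode h, mul_sw, sw_tmul, map_sw]
    refine sw_congr _ _ fun z t => ?_
    have e2 : (sw p.WH.comul z fun u v => p.mul (p.mul (p.proj (x1 ⊗ₜ u)) (p.proj (1 ⊗ₜ S v)))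
        (p.proj (S' (x2 * t) ⊗ₜ 1))) =
        p.mul (p.proj ((x1 * p.c z) ⊗ₜ 1)) (p.proj (S' (x2 * t) ⊗ₜ 1)) := by
      rw [← hp.sw_proj_mul_antipode, map_sw, sw_apply]
    rw [e2, hp.proj_mul_proj, hp.antipodeA.map_mul]
    congr 2; ring
  simp only [e]
  rw [← hp.antipodeA.sw_mul, sw_mul, sw_tmul, map_sw]

theorem sw_proj_mul_b (x : A) (h : H) :
    sw p.WH.comul h (fun u v => p.proj ((x * p.b u) ⊗ₜ v)) = p.proj (x ⊗ₜ h) := by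
  simp only [p.proj_tmul]
  rw [← p.WH.sw_coassoc h (F := fun u v w => (x * p.b u * p.c v) ⊗ₜ[k] w)
    (by fun_prop) (by fun_prop) (by fun_prop)]
  refine sw_congr _ _ fun u v => ?_
  rw [← sw_b_mul_c _ u, mul_sw, sw_tmul]
  simp only [_root_.mul_assoc]

theorem antipode_mul (hp : p.IsHopf S S') (x : A) (h : H) :
    ev (fun U V => p.mul (p.antipode S S' U) V) (by intros; fun_prop) (by intros; fun_prop)
      (p.comul (p.proj (x ⊗ₜ h))) = p.proj ((p.WA.εs x * p.c h) ⊗ₜ 1) := by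
  rw [comul_proj_right]
  simp only [map_sw, ev_tmul, p.antipode_tmul, sw_apply, p.mul_assoc, hp.proj_mul_proj]
  have e (u v : H) (x1 x2 : A) : (sw p.coact u fun z t => sw p.coact z fun z' t' =>
      p.mul (p.proj (1 ⊗ₜ S z')) (p.proj ((S' (x1 * t') * (x2 * t)) ⊗ₜ v))) =
      sw p.WH.comul u fun u1 u2 =>
        p.mul (p.proj (1 ⊗ₜ S u1)) (p.proj ((S' x1 * x2 * p.b u2) ⊗ₜ v)) := by
    rw [← p.sw_coact_εs u fun u1 t =>
        p.mul (p.proj (1 ⊗ₜ S u1)) (p.proj ((S' x1 * x2 * t) ⊗ₜ v)),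
      p.sw_coact_coact u fun z' t' t =>
        p.mul (p.proj (1 ⊗ₜ S z')) (p.proj ((S' (x1 * t') * (x2 * t)) ⊗ₜ v))]
    refine sw_congr _ _ fun z t => ?_
    rw [← hp.antipodeA.mul_sw t, mul_sw, sw_tmul, map_sw, map_sw]
    refine sw_congr _ _ fun t1 t2 => ?_
    rw [hp.antipodeA.map_mul]
    congr 3; ring
  simp only [e]
  have e2 (y : A) : (sw p.WH.comul h fun u v => sw p.WH.comul u fun u1 u2 =>
      p.mul (p.proj (1 ⊗ₜ S u1)) (p.proj ((y * p.b u2) ⊗ₜ v))) =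
      sw p.WH.comul h fun u v => p.mul (p.proj (1 ⊗ₜ S u)) (p.proj (y ⊗ₜ v)) := by
    rw [p.WH.sw_coassoc h (F := fun u1 u2 v =>
      p.mul (p.proj (1 ⊗ₜ S u1)) (p.proj ((y * p.b u2) ⊗ₜ v)))
      (by fun_prop) (by fun_prop) (by fun_prop)]
    refine sw_congr _ _ fun u v => ?_
    rw [← sw_proj_mul_b y v, map_sw]
  have e3 (y : A) : (sw p.WH.comul h fun u v => p.mul (p.proj (1 ⊗ₜ S u)) (p.proj (y ⊗ₜ v))) =
      sw p.WH.comul h fun u v => sw p.WH.comul v fun v1 v2 =>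
        p.mul (p.proj (1 ⊗ₜ S v1)) ((y * p.c u) ⊗ₜ v2) := by
    simp only [p.proj_tmul y, map_sw]
    exact p.cocomm.sw_comm₃ h fun u v1 v2 => p.mul (p.proj (1 ⊗ₜ S u)) ((y * p.c v1) ⊗ₜ v2)
  have e4 : (sw p.WA.comul x fun x1 x2 => sw p.WH.comul h fun u v =>
      p.mul (p.proj (1 ⊗ₜ S u)) (p.proj ((S' x1 * x2) ⊗ₜ v))) =
      sw p.WH.comul h fun u v => p.mul (p.proj (1 ⊗ₜ S u)) (p.proj (p.WA.εs x ⊗ₜ v)) := by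
    rw [sw_swap, ← hp.antipodeA.mul_sw]
    simp only [sw_tmul, map_sw]
  have e5 (y : A) (hy : p.WA.εs y = y) (v : H) : (sw p.WH.comul v fun v1 v2 =>
      p.mul (p.proj (1 ⊗ₜ S v1)) (y ⊗ₜ v2)) = p.proj (y ⊗ₜ p.WH.εs v) := by
    simp only [hp.one_proj_mul_tmul hy]
    rw [← hp.antipodeH.mul_sw, tmul_sw, map_sw]
  have e6 (u : H) : p.WA.εs (p.WA.εs x * p.c u) = p.WA.εs x * p.c u := by
    rw [p.WA.εs_mul, p.WA.εs_εs, p.εs_c]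
  simp only [e2]
  rw [e4, e3]
  simp only [e5 _ (e6 _)]
  rw [sw_c_εs hp.εt_a hp.antipodeH hp.cond8 h fun y v => p.proj ((p.WA.εs x * y) ⊗ₜ v),
    ← sw_proj_mul_c]
  simp only [_root_.mul_assoc]

end IsHopf

end CompatiblePair

theorem WeakBialgebra.Cocomm.sw_one_mul_comm {k H P : Type*} [Field k] [Ring H] [Algebra k H]
    [AddCommMonoid P] [Module k P] {W : WeakBialgebra k H} (hW : W.Cocomm) (F : H → H → H → P)
    (h1 : ∀ a b, IsLinearMap k (fun c => F a b c) := by intros; fun_prop)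
    (h2 : ∀ a c, IsLinearMap k (fun b => F a b c) := by intros; fun_prop)
    (h3 : ∀ b c, IsLinearMap k (fun a => F a b c) := by intros; fun_prop) :
    (sw W.comul 1 fun u v => sw W.comul 1 fun u' v' => F u u' (v * v')) =
      sw W.comul 1 fun u v => sw W.comul 1 fun u' v' => F u u' (v' * v) := by
  have e (u v : H) := hW.sw_comm 1 (F := fun u' v' => F u u' (v * v')) (by fun_prop) (by fun_prop)
  have e' (u v : H) := hW.sw_comm 1 (F := fun u' v' => F u u' (v' * v)) (by fun_prop) (by fun_prop)
  simp only [e, e']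
  rw [W.sw_one_left fun u w u' => F u u' w, W.sw_one_right fun u w u' => F u u' w]

namespace CompatiblePair

variable {k H A P : Type*} [Field k] [Ring H] [Algebra k H] [CommRing A] [Algebra k A]
  [AddCommMonoid P] [Module k P] {p : CompatiblePair k H A} {S : H →ₗ[k] H} {S' : A →ₗ[k] A}

namespace IsHopf

theorem antipode_proj (hp : p.IsHopf S S') (x : A) (h : H) :
    p.antipode S S' (p.proj (x ⊗ₜ h)) = sw p.WH.comul h fun u v => sw p.coact u fun z t =>
      p.mul (p.proj (1 ⊗ₜ S z)) (p.proj ((S' (x * t) * p.c v) ⊗ₜ 1)) := by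
  rw [p.proj_tmul, map_sw, p.cocomm.sw_comm h (by fun_prop) (by fun_prop)]
  simp only [p.antipode_tmul]
  refine sw_congr _ _ fun u v => sw_congr _ _ fun z t => ?_
  rw [mul_right_comm, hp.antipodeA.map_mul, hp.antipodeA.map_εs (p.εs_c v), hp.εt_c]

theorem antipode_mul_antipode (hp : p.IsHopf S S') (x : A) (h : H) :
    ev (fun U V => p.mul (p.antipode S S' U)
        (ev (fun U V => p.mul U (p.antipode S S' V)) (by intros; fun_prop) (by intros; fun_prop)
          (p.comul V))) (by intros; fun_prop) (by intros; fun_prop)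
      (p.comul (p.proj (x ⊗ₜ h))) = p.antipode S S' (p.proj (x ⊗ₜ h)) := by
  rw [comul_proj_right, hp.antipode_proj]
  simp only [map_sw, ev_tmul, hp.mul_antipode, p.antipode_tmul, sw_apply, p.mul_assoc,
    hp.proj_mul_proj]
  rw [sw_swap]
  refine sw_congr _ _ fun u v => ?_
  have e (x1 x2 : A) := p.sw_coact_coact u fun z t' t => p.mul (p.proj (1 ⊗ₜ S z))
    (p.proj ((S' (x1 * t') * (p.WA.εt (x2 * t) * p.c v)) ⊗ₜ 1))
  simp only [e]
  rw [sw_swap]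
  refine sw_congr _ _ fun z t => ?_
  rw [← hp.antipodeA.sw_mul_εt (x * t), p.WA.sw_comul_mul _ _ (by fun_prop) (by fun_prop), sw_mul,
    sw_tmul, map_sw, map_sw]
  refine sw_congr _ _ fun x1 x2 => ?_
  simp only [sw_mul, sw_tmul, map_sw, _root_.mul_assoc]

theorem mul_proj (hp : p.IsHopf S S') (x y : A) (h g : H) :
    p.mul (p.proj (x ⊗ₜ h)) (p.proj (y ⊗ₜ g)) = p.mul (p.proj (x ⊗ₜ h)) (y ⊗ₜ g) := by
  rw [hp.proj_tmul y, p.proj_tmul x]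
  simp only [map_sw, sw_apply, mul_tmul]
  have e (w z : H) : (sw p.WH.comul h fun b r => sw p.WH.comul r fun u v =>
      (x * p.c b * p.act u (y * p.c w)) ⊗ₜ[k] (v * (z * g))) =
      sw p.WH.comul h fun a r => sw p.WH.comul r fun u v =>
        (x * p.act a y * (p.c u * p.c w)) ⊗ₜ[k] (v * z * g) := by
    have e1 (b r : H) : (sw p.WH.comul r fun u v =>
        (x * p.c b * p.act u (y * p.c w)) ⊗ₜ[k] (v * (z * g))) =
        sw p.WH.comul r fun a s => sw p.WH.comul s fun u v =>
          (x * p.c b * (p.act a y * p.act u (p.c w))) ⊗ₜ[k] (v * (z * g)) := by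
      rw [← p.WH.sw_coassoc r (F := fun a u v =>
        (x * p.c b * (p.act a y * p.act u (p.c w))) ⊗ₜ[k] (v * (z * g)))
        (by fun_prop) (by fun_prop) (by fun_prop)]
      refine sw_congr _ _ fun u v => ?_
      rw [p.act_mul, mul_sw, sw_tmul]
    simp only [e1]
    rw [p.cocomm.sw_comm₃ h fun b a s => sw p.WH.comul s fun u v =>
          (x * p.c b * (p.act a y * p.act u (p.c w))) ⊗ₜ[k] (v * (z * g))]
    refine sw_congr _ _ fun a r => ?_
    rw [← p.WH.sw_coassoc r (F := fun b u v =>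
        (x * p.c b * (p.act a y * p.act u (p.c w))) ⊗ₜ[k] (v * (z * g)))
        (by fun_prop) (by fun_prop) (by fun_prop)]
    refine sw_congr _ _ fun u v => ?_
    rw [← p.sw_c_mul_act u (p.εs_c w), mul_sw, sw_tmul, _root_.mul_assoc v]
    refine sw_congr _ _ fun b u => ?_
    congr 1; ring
  simp only [e]
  rw [sw_swap]
  conv_rhs => rw [p.cocomm.sw_comm₃ h fun a u v => (x * p.c a * p.act u y) ⊗ₜ[k] (v * g)]
  refine sw_congr _ _ fun a r => ?_
  rw [sw_swap]
  simp only [mul_right_comm x _ (p.act a y)]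
  exact sw_c_mul_c_one hp.εt_a hp.antipodeH hp.cond8 r fun t v => (x * p.act a y * t) ⊗ₜ[k] (v * g)

theorem comul_one (hp : p.IsHopf S S') :
    p.comul (p.proj (1 ⊗ₜ 1)) = sw p.WA.comul 1 fun x y => sw p.WH.comul 1 fun u v =>
      (x ⊗ₜ u) ⊗ₜ p.proj (y ⊗ₜ v) := by
  rw [comul_proj_right]
  refine sw_congr _ _ fun x y => ?_
  rw [p.sw_one_coact fun z t v => (x ⊗ₜ[k] z) ⊗ₜ[k] p.proj ((y * t) ⊗ₜ v),
    p.cocomm.sw_one_mul_comm fun u u' v => (x ⊗ₜ[k] u) ⊗ₜ[k] p.proj ((y * p.b u') ⊗ₜ v)]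
  refine sw_congr _ _ fun u v => ?_
  simp only [hp.proj_tmul, tmul_sw]
  rw [sw_swap]
  have e := sw_one_c_mul_b hp.εt_a fun t w => (x ⊗ₜ[k] u) ⊗ₜ[k] ((y * t) ⊗ₜ[k] (w * v))
  rw [← e]
  refine sw_congr _ _ fun a b => sw_congr _ _ fun c d => ?_
  rw [_root_.mul_assoc b]
  congr 2; ring_nf

end IsHopf

end CompatiblePair

namespace CompatiblePair

variable {k H A P : Type*} [Field k] [Ring H] [Algebra k H] [CommRing A] [Algebra k A]
  [AddCommMonoid P] [Module k P] {p : CompatiblePair k H A} {S : H →ₗ[k] H} {S' : A →ₗ[k] A}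

namespace IsHopf

theorem sw_one_proj_a_mul (hp : p.IsHopf S S') (y : A) (g : H) :
    sw p.WH.comul 1 (fun u v => p.proj ((p.a u * y) ⊗ₜ (v * g))) = p.proj (y ⊗ₜ g) := by
  simp only [hp.proj_tmul]
  have e (u v : H) : (sw p.WH.comul 1 fun w z => (p.a u * y * p.c w) ⊗ₜ[k] (z * (v * g))) =
      sw p.WH.comul 1 fun w z => (y * p.c 1 * (p.a w * p.a u)) ⊗ₜ[k] (z * v * g) := by
    refine sw_congr _ _ fun w z => ?_
    rw [c_eq_mul_a hp.εt_a hp.antipodeH w, _root_.mul_assoc z]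
    congr 1; ring
  simp only [e]
  rw [sw_swap, p.sw_one_a_mul_a fun t v => (y * p.c 1 * t) ⊗ₜ[k] (v * g)]
  refine sw_congr _ _ fun w z => ?_
  rw [c_eq_mul_a hp.εt_a hp.antipodeH w, _root_.mul_assoc]

theorem smashEpsT_eq (hp : p.IsHopf S S') (U : A ⊗[k] H) :
    smashEpsT k p.WH p.WA p.act p.coact U = sw p.WA.comul 1 fun x y => sw p.WH.comul 1 fun u v =>
      smashCounit k p.WH p.WA (p.mul (x ⊗ₜ u) U) • p.proj (y ⊗ₜ v) := by
  change TensorProduct.lid k _ (LinearMap.rTensor _ _ (p.comul (p.proj (1 ⊗ₜ 1)))) = _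
  rw [hp.comul_one]
  simp only [map_sw, equiv_sw]
  rfl

theorem smashEpsS_eq (hp : p.IsHopf S S') (U : A ⊗[k] H) :
    smashEpsS k p.WH p.WA p.act p.coact U = sw p.WA.comul 1 fun x y => sw p.WH.comul 1 fun u v =>
      smashCounit k p.WH p.WA (p.mul U (p.proj (y ⊗ₜ v))) • x ⊗ₜ u := by
  change TensorProduct.rid k _ (LinearMap.lTensor _ _ (p.comul (p.proj (1 ⊗ₜ 1)))) = _
  rw [hp.comul_one]
  simp only [map_sw, equiv_sw]
  rfl

theorem smashEpsT_proj (hp : p.IsHopf S S') (x : A) (h : H) :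
    smashEpsT k p.WH p.WA p.act p.coact (p.proj (x ⊗ₜ h)) =
      p.proj ((p.WA.εt x * p.c h) ⊗ₜ 1) := by
  rw [hp.smashEpsT_eq, p.proj_tmul x]
  simp only [map_sw, mul_tmul, sw_smul, smashCounit, LinearMap.comp_apply, TensorProduct.map_tmul,
    LinearMap.mul'_apply]
  have e (u v h1 h2 : H) : (sw p.WA.comul 1 fun x1 x2 => sw p.WH.comul u fun u1 u2 =>
      (p.WA.counit (x1 * p.act u1 (x * p.c h1)) * p.WH.counit (u2 * h2)) • p.proj (x2 ⊗ₜ v)) =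
      sw p.WH.comul u fun u1 u2 =>
        p.WH.counit (u2 * h2) • p.proj (p.WA.εt (p.act u1 (x * p.c h1)) ⊗ₜ v) := by
    rw [sw_swap]
    refine sw_congr _ _ fun u1 u2 => ?_
    simp only [p.WA.εt_eq, sw_tmul, map_sw, smul_sw, smul_tmul_left, map_smul, smul_smul, mul_comm]
  have e1 (h1 h2 : H) : (sw p.WH.comul 1 fun u v => sw p.WH.comul u fun u1 u2 =>
      p.WH.counit (u2 * h2) • p.proj (p.WA.εt (p.act u1 (x * p.c h1)) ⊗ₜ v)) =
      p.proj ((p.WA.εt x * p.c h1) ⊗ₜ p.WH.εt h2) := by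
    rw [p.WH.sw_coassoc 1 (F := fun u1 u2 v =>
      p.WH.counit (u2 * h2) • p.proj (p.WA.εt (p.act u1 (x * p.c h1)) ⊗ₜ v))
      (by fun_prop) (by fun_prop) (by fun_prop)]
    have e2 (u w : H) := p.cocomm.sw_comm w (F := fun u2 v =>
      p.WH.counit (u2 * h2) • p.proj (p.WA.εt (p.act u (x * p.c h1)) ⊗ₜ v))
      (by fun_prop) (by fun_prop)
    simp only [e2]
    rw [← p.WH.sw_one_left fun u v u2 =>
      p.WH.counit (u2 * h2) • p.proj (p.WA.εt (p.act u (x * p.c h1)) ⊗ₜ v)]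
    have e3 (u w : H) : (sw p.WH.comul 1 fun v u2 => p.WH.counit (u2 * h2) •
        p.proj (p.WA.εt (p.act u (x * p.c h1)) ⊗ₜ (w * v))) =
        p.proj (p.WA.εt (p.act u (x * p.c h1)) ⊗ₜ (w * p.WH.εt h2)) := by
      rw [p.cocomm.sw_comm 1 (by fun_prop) (by fun_prop)]
      simp only [p.WH.εt_eq, mul_sw, tmul_sw, map_sw, mul_smul_comm, TensorProduct.tmul_smul,
        map_smul]
    simp only [e3]
    rw [p.sw_one_act (x * p.c h1) fun y w => p.proj (p.WA.εt y ⊗ₜ (w * p.WH.εt h2))]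
    simp only [p.WA.εt_mul, hp.εt_a, hp.εt_c]
    exact hp.sw_one_proj_a_mul _ _
  calc _ = sw p.WH.comul h fun h1 h2 => sw p.WH.comul 1 fun u v => sw p.WA.comul 1 fun x1 x2 =>
        sw p.WH.comul u fun u1 u2 => (p.WA.counit (x1 * p.act u1 (x * p.c h1)) *
          p.WH.counit (u2 * h2)) • p.proj (x2 ⊗ₜ v) := by
        conv_rhs => rw [sw_swap]
        rw [sw_swap]
        exact sw_congr _ _ fun u v => sw_swap ..
    _ = sw p.WH.comul h fun h1 h2 => p.proj ((p.WA.εt x * p.c h1) ⊗ₜ p.WH.εt h2) := by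
        simp only [e, e1]
    _ = _ := by
        rw [sw_c_εt hp.εt_a hp.antipodeH h fun y v => p.proj ((p.WA.εt x * y) ⊗ₜ v),
          ← sw_proj_mul_c]
        simp only [_root_.mul_assoc]

theorem smashEpsS_proj (hp : p.IsHopf S S') (x : A) (h : H) :
    smashEpsS k p.WH p.WA p.act p.coact (p.proj (x ⊗ₜ h)) =
      p.proj ((p.WA.εs x * p.c h) ⊗ₜ 1) := by
  rw [hp.smashEpsS_eq]
  simp only [hp.mul_proj]
  rw [p.proj_tmul x]
  simp only [map_sw, sw_apply, mul_tmul, sw_smul, smashCounit, LinearMap.comp_apply,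
    TensorProduct.map_tmul, LinearMap.mul'_apply]
  have e (u v : H) : (sw p.WH.comul h fun h1 r => sw p.WH.comul r fun h2 h3 =>
      sw p.WA.comul 1 fun x1 x2 => (p.WA.counit (x * p.c h1 * p.act h2 x2) *
        p.WH.counit (h3 * v)) • x1 ⊗ₜ[k] u) = sw p.WH.comul h fun h1 r =>
      p.WH.counit (r * v) • (p.WA.εs x * p.c h1) ⊗ₜ u := by
    have e1 (h1 h2 h3 : H) : (sw p.WA.comul 1 fun x1 x2 => (p.WA.counit (x * p.c h1 * p.act h2 x2) *
        p.WH.counit (h3 * v)) • x1 ⊗ₜ[k] u) =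
        p.WH.counit (h3 * v) • (p.WA.εs x * (p.a h2 * p.c h1)) ⊗ₜ u := by
      have e2 := p.sw_one_act_act 1 h2 fun x1 x2 => (p.WA.counit (x * p.c h1 * x2) *
        p.WH.counit (h3 * v)) • x1 ⊗ₜ[k] u
      have e3 : p.a 1 = 1 := p.one_act 1
      have e4 : p.WA.εs x * (p.a h2 * p.c h1) = p.WA.εs (x * p.c h1 * p.a h2) := by
        rw [p.WA.εs_mul, p.WA.εs_mul, p.εs_a, p.εs_c, _root_.mul_assoc, mul_comm (p.a h2)]
      simp only [one_act, e3, one_mul] at e2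
      rw [e2, e4, p.WA.εs_eq, sw_tmul, smul_sw]
      refine sw_congr _ _ fun x1 x2 => ?_
      rw [smul_tmul_left, smul_smul, mul_comm, _root_.mul_assoc (x * p.c h1)]
    simp only [e1]
    rw [p.cocomm.sw_comm₃ h fun h1 h2 h3 =>
        p.WH.counit (h3 * v) • (p.WA.εs x * (p.a h2 * p.c h1)) ⊗ₜ[k] u,
      ← p.WH.sw_coassoc h (F := fun h2 h1 h3 =>
        p.WH.counit (h3 * v) • (p.WA.εs x * (p.a h2 * p.c h1)) ⊗ₜ[k] u)
        (by fun_prop) (by fun_prop) (by fun_prop)]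
    refine sw_congr _ _ fun w r => ?_
    rw [← p.sw_a_mul_c w, mul_sw, sw_tmul, smul_sw]
  have e1 := sw_c_εs hp.εt_a hp.antipodeH hp.cond8 h fun y v => (p.WA.εs x * y) ⊗ₜ[k] v
  simp only [← _root_.mul_assoc] at e1
  calc _ = sw p.WH.comul 1 fun u v => sw p.WH.comul h fun h1 r => sw p.WH.comul r fun h2 h3 =>
      sw p.WA.comul 1 fun x1 x2 => (p.WA.counit (x * p.c h1 * p.act h2 x2) *
        p.WH.counit (h3 * v)) • x1 ⊗ₜ[k] u := by
        rw [sw_swap]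
        refine sw_congr _ _ fun u v => ?_
        rw [sw_swap]
        exact sw_congr _ _ fun h1 r => sw_swap ..
    _ = sw p.WH.comul h fun h1 r => (p.WA.εs x * p.c h1) ⊗ₜ p.WH.εs r := by
        simp only [e]
        rw [sw_swap]
        simp only [p.WH.εs_eq, tmul_sw, TensorProduct.tmul_smul]
    _ = _ := by rw [p.proj_tmul, e1]

end IsHopf

end CompatiblePair

namespace CompatiblePair.IsHopf

variable {k H A : Type*} [Field k] [Ring H] [Algebra k H] [CommRing A] [Algebra k A]
  {p : CompatiblePair k H A} {S : H →ₗ[k] H} {S' : A →ₗ[k] A}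

theorem smashMul_lTensor (U : (A ⊗[k] H) ⊗[k] (A ⊗[k] H)) :
    smashMul k p.WH p.act (LinearMap.lTensor _ (p.antipode S S') U) =
      ev (fun U V => p.mul U (p.antipode S S' V)) (by intros; fun_prop) (by intros; fun_prop)
        U := by
  induction U with
  | zero => simp
  | add U V hU hV => simp only [map_add, hU, hV]
  | tmul U V => rw [LinearMap.lTensor_tmul, smashMul_tmul, ev_tmul]

theorem smashMul_rTensor (U : (A ⊗[k] H) ⊗[k] (A ⊗[k] H)) :
    smashMul k p.WH p.act (LinearMap.rTensor _ (p.antipode S S') U) =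
      ev (fun U V => p.mul (p.antipode S S' U) V) (by intros; fun_prop) (by intros; fun_prop)
        U := by
  induction U with
  | zero => simp
  | add U V hU hV => simp only [map_add, hU, hV]
  | tmul U V => rw [LinearMap.rTensor_tmul, smashMul_tmul, ev_tmul]

theorem smashMul_map (U : (A ⊗[k] H) ⊗[k] (A ⊗[k] H)) :
    smashMul k p.WH p.act (TensorProduct.map (p.antipode S S')
      (smashMul k p.WH p.act ∘ₗ LinearMap.lTensor _ (p.antipode S S'))
      (LinearMap.lTensor _ p.comul U)) =
      ev (fun U V => p.mul (p.antipode S S' U)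
        (ev (fun U V => p.mul U (p.antipode S S' V)) (by intros; fun_prop) (by intros; fun_prop)
          (p.comul V))) (by intros; fun_prop) (by intros; fun_prop)
        U := by
  induction U with
  | zero => simp
  | add U V hU hV => simp only [map_add, hU, hV]
  | tmul U V =>
    rw [LinearMap.lTensor_tmul, TensorProduct.map_tmul, LinearMap.comp_apply, smashMul_lTensor,
      smashMul_tmul, ev_tmul]

theorem weakHopf (hp : p.IsHopf S S') (U : A ⊗[k] H) :
    smashMul k p.WH p.act (LinearMap.lTensor _ (p.antipode S S') (p.comul (p.proj U))) =
        smashEpsT k p.WH p.WA p.act p.coact (p.proj U) ∧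
      smashMul k p.WH p.act (LinearMap.rTensor _ (p.antipode S S') (p.comul (p.proj U))) =
        smashEpsS k p.WH p.WA p.act p.coact (p.proj U) ∧
      smashMul k p.WH p.act (TensorProduct.map (p.antipode S S')
        (smashMul k p.WH p.act ∘ₗ LinearMap.lTensor _ (p.antipode S S'))
        (LinearMap.lTensor _ p.comul (p.comul (p.proj U)))) = p.antipode S S' (p.proj U) := by
  simp only [smashMul_lTensor, smashMul_rTensor, smashMul_map]
  induction U with
  | zero => simp [hp.smashEpsT_eq, hp.smashEpsS_eq, sw]
  | add U V hU hV =>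
    obtain ⟨h1, h2, h3⟩ := hU
    obtain ⟨h1', h2', h3'⟩ := hV
    simp only [map_add, h1, h2, h3, h1', h2', h3', and_true]
    simp only [hp.smashEpsT_eq, hp.smashEpsS_eq, sw, map_add, LinearMap.add_apply, add_smul,
      Finset.sum_add_distrib, and_self]
  | tmul x h =>
    rw [hp.mul_antipode, hp.antipode_mul, hp.antipode_mul_antipode, hp.smashEpsT_proj,
      hp.smashEpsS_proj]
    exact ⟨rfl, rfl, rfl⟩

end CompatiblePair.IsHopf

theorem both_weakHopf
    {k H A : Type*} [Field k] [Ring H] [Algebra k H] [Ring A] [Algebra k A]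
    (WH : WeakBialgebra k H) (WA : WeakBialgebra k A)
    (act : H →ₗ[k] A →ₗ[k] A) (coact : H →ₗ[k] H ⊗[k] A)
    (SH : H →ₗ[k] H) (SA : A →ₗ[k] A)
    (hCP : IsCompatiblePair k WH WA act coact)
    (hSH : WH.IsAntipode SH) (hSA : WA.IsAntipode SA)
    (h7 : ∀ h : H, cond7LHS k WH WA act coact SA h = cond7RHS k WH WA act coact h)
    (h8 : ∀ h : H, cond8LHS k WH WA act coact SH h = cond8RHS k WH WA act coact h) :
    ∀ u ∈ LinearMap.range (projBoth k WH WA act coact),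
      smashMul k WH act
          ((LinearMap.lTensor (A ⊗[k] H) (smashAntipode k WH WA act coact SH SA))
            (smashComul k WH WA coact u)) =
        smashEpsT k WH WA act coact u ∧
      smashMul k WH act
          ((LinearMap.rTensor (A ⊗[k] H) (smashAntipode k WH WA act coact SH SA))
            (smashComul k WH WA coact u)) =
        smashEpsS k WH WA act coact u ∧
      smashMul k WH act
          ((TensorProduct.map (smashAntipode k WH WA act coact SH SA)
              (smashMul k WH act ∘ₗ
                LinearMap.lTensor (A ⊗[k] H) (smashAntipode k WH WA act coact SH SA)))
            ((LinearMap.lTensor (A ⊗[k] H) (smashComul k WH WA coact))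
              (smashComul k WH WA coact u))) =
        smashAntipode k WH WA act coact SH SA u := by
  rintro _ ⟨U, rfl⟩
  let I : Ring A := inferInstance
  let _ : CommRing A := { I with mul_comm := hCP.comm }
  let p : CompatiblePair k H A := ⟨WH, WA, act, coact, hCP⟩
  have hp : p.IsHopf SH SA := ⟨hSH, hSA, h7, h8⟩
  exact hp.weakHopf U

end WeakSmash
end
end

section
/- Let (H,A) be a weak matched pair in which H and A are weak Hopf algebras and A is commutative. If α is a left integral in A, then h·α is a left integral in A for every h ∈ H. -/
open TensorProduct

noncomputable section

namespace WeakSmash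

namespace WeakBialgebra

variable {k H : Type*} [Field k] [Ring H] [Algebra k H] (W : WeakBialgebra k H)

theorem counit_mul_εt_s17 (g h : H) : W.counit (g * W.εt h) = W.counit (g * h) := by
  have key : ∀ u : H ⊗[k] H,
      W.counit (g * TensorProduct.lid k H (LinearMap.rTensor H W.counit (u * (h ⊗ₜ[k] 1)))) =
        LinearMap.mul' k k
          ((TensorProduct.map (W.counit ∘ₗ LinearMap.mulLeft k g)
            (W.counit ∘ₗ LinearMap.mulRight k h)) ((TensorProduct.comm k H H) u)) := by
    intro u
    induction u with
    | zero => simp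
    | tmul a b => simp [mul_comm]
    | add u v hu hv => simp only [add_mul, mul_add, map_add, hu, hv]
  have h1 := W.counit_weak' g 1 h
  rw [mul_one] at h1
  exact (key _).trans h1.symm

theorem counit_εs_mul (h g : H) : W.counit (W.εs h * g) = W.counit (h * g) := by
  have key : ∀ u : H ⊗[k] H,
      W.counit (TensorProduct.rid k H (LinearMap.lTensor H W.counit ((1 ⊗ₜ[k] h) * u)) * g) =
        LinearMap.mul' k k
          ((TensorProduct.map (W.counit ∘ₗ LinearMap.mulLeft k h)
            (W.counit ∘ₗ LinearMap.mulRight k g)) ((TensorProduct.comm k H H) u)) := by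
    intro u
    induction u with
    | zero => simp
    | tmul a b => simp
    | add u v hu hv => simp only [add_mul, mul_add, map_add, hu, hv]
  have h1 := W.counit_weak' h 1 g
  rw [mul_one] at h1
  exact (key _).trans h1.symm

theorem εt_congr {h h' : H} (hh : ∀ x, W.counit (x * h) = W.counit (x * h')) :
    W.εt h = W.εt h' := by
  have key : ∀ u : H ⊗[k] H,
      TensorProduct.lid k H (LinearMap.rTensor H W.counit (u * (h ⊗ₜ[k] 1))) =
        TensorProduct.lid k H (LinearMap.rTensor H W.counit (u * (h' ⊗ₜ[k] 1))) := by
    intro u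
    induction u with
    | zero => simp
    | tmul a b => simp [hh]
    | add u v hu hv => simp only [add_mul, map_add, hu, hv]
  exact key _

theorem εs_congr {h h' : H} (hh : ∀ x, W.counit (h * x) = W.counit (h' * x)) :
    W.εs h = W.εs h' := by
  have key : ∀ u : H ⊗[k] H,
      TensorProduct.rid k H (LinearMap.lTensor H W.counit ((1 ⊗ₜ[k] h) * u)) =
        TensorProduct.rid k H (LinearMap.lTensor H W.counit ((1 ⊗ₜ[k] h') * u)) := by
    intro u
    induction u with
    | zero => simp
    | tmul a b => simp [hh]
    | add u v hu hv => simp only [mul_add, map_add, hu, hv]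
  exact key _

theorem εt_εs_s17 (hcomm : ∀ a b : H, a * b = b * a) (h : H) : W.εt (W.εs h) = W.εt h :=
  W.εt_congr fun x => by rw [hcomm x, counit_εs_mul, hcomm]

theorem εs_εt (hcomm : ∀ a b : H, a * b = b * a) (h : H) : W.εs (W.εt h) = W.εs h :=
  W.εs_congr fun x => by rw [hcomm _ x, counit_mul_εt_s17, hcomm]

theorem comul_εt (h : H) : W.comul (W.εt h) = W.comul 1 * (W.εt h ⊗ₜ[k] 1) := by
  let Φ : H ⊗[k] (H ⊗[k] H) →ₗ[k] H ⊗[k] H :=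
    (TensorProduct.lid k (H ⊗[k] H)).toLinearMap ∘ₗ
      LinearMap.rTensor (H ⊗[k] H) (W.counit ∘ₗ LinearMap.mulRight k h)
  have left : ∀ u : H ⊗[k] H, Φ (LinearMap.lTensor H W.comul u) =
      W.comul (TensorProduct.lid k H (LinearMap.rTensor H W.counit (u * (h ⊗ₜ[k] 1)))) := by
    intro u
    induction u with
    | zero => simp
    | tmul a b => simp [Φ]
    | add u v hu hv => simp only [add_mul, map_add, hu, hv]
  have right : ∀ u v : H ⊗[k] H,
      Φ (((1 : H) ⊗ₜ[k] v) * (TensorProduct.assoc k H H H) (u ⊗ₜ[k] (1 : H))) =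
        v * (TensorProduct.lid k H
          (LinearMap.rTensor H W.counit (u * (h ⊗ₜ[k] 1))) ⊗ₜ[k] 1) := by
    intro u v
    induction u with
    | zero => simp
    | tmul a b =>
      simp [Φ, ← TensorProduct.smul_tmul']
    | add u v hu hv =>
      simp only [TensorProduct.add_tmul, add_mul, mul_add, map_add, hu, hv]
  exact (left _).symm.trans ((congrArg Φ W.comul_one_right.symm).trans (right _ _))

theorem IsLeftIntegral.εs_mul {W : WeakBialgebra k H} {α : H} (hα : W.IsLeftIntegral α)
    (hcomm : ∀ a b : H, a * b = b * a) (h : H) : W.εs h * α = h * α := by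
  rw [hα (W.εs h), W.εt_εs_s17 hcomm, ← hα h]

end WeakBialgebra

namespace IsModuleAlgebra

variable {k H A : Type*} [Field k] [Ring H] [Algebra k H] [Ring A] [Algebra k A]
  {W : WeakBialgebra k H} {act : H →ₗ[k] A →ₗ[k] A}

theorem act_one_mul (hM : IsModuleAlgebra k W act) (h : H) (x : A) :
    act h 1 * x = act (W.εt h) x := by
  have key : ∀ u : H ⊗[k] H,
      LinearMap.mul' k A ((TensorProduct.map (act.flip 1) (act.flip x)) (u * (W.εt h ⊗ₜ[k] 1))) =
        LinearMap.mul' k A ((TensorProduct.map (act.flip (act (W.εt h) 1)) (act.flip x)) u) := by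
    intro u
    induction u with
    | zero => simp
    | tmul a b => simp [hM.act_act]
    | add u v hu hv => simp only [add_mul, map_add, hu, hv]
  have h1 := hM.act_mul (W.εt h) 1 x
  rw [one_mul, W.comul_εt, key, ← hM.act_mul, hM.one_act] at h1
  rw [h1, ← hM.act_unit]

/-- The identity `(h · a) x = h₁ · (a (S(h₂) · x))`. -/
theorem act_mul_eq_act_mul_antipode (hM : IsModuleAlgebra k W act) {S : H →ₗ[k] H}
    (hS : W.IsAntipode S) (h : H) (a x : A) :
    act h a * x =
      TensorProduct.lift act
        (LinearMap.lTensor H (LinearMap.mulLeft k a ∘ₗ act.flip x ∘ₗ S) (W.comul h)) := by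
  let G : H ⊗[k] (H ⊗[k] H) →ₗ[k] A := LinearMap.mul' k A ∘ₗ
    TensorProduct.map (act.flip a) (act.flip x ∘ₗ LinearMap.mul' k H ∘ₗ LinearMap.lTensor H S)
  have tail : ∀ (r : H) (v : H ⊗[k] H), G ((TensorProduct.assoc k H H H) (v ⊗ₜ[k] r)) =
      LinearMap.mul' k A
        ((TensorProduct.map (act.flip a) (act.flip (act (S r) x))) v) := by
    intro r v
    induction v with
    | zero => simp
    | tmul p q => simp [G, hM.act_act]
    | add u v hu hv => simp only [TensorProduct.add_tmul, map_add, hu, hv]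
  have left : ∀ u : H ⊗[k] H,
      TensorProduct.lift act (LinearMap.lTensor H (LinearMap.mulLeft k a ∘ₗ act.flip x ∘ₗ S) u) =
        G ((TensorProduct.assoc k H H H) ((LinearMap.rTensor H W.comul) u)) := by
    intro u
    induction u with
    | zero => simp
    | tmul p r => simp [tail, hM.act_mul]
    | add u v hu hv => simp only [map_add, hu, hv]
  have right : ∀ u : H ⊗[k] H, G (LinearMap.lTensor H W.comul u) =
      LinearMap.mul' k A ((TensorProduct.map (act.flip a) (act.flip 1)) u) * x := by
    intro u
    induction u with
    | zero => simp
    | tmul p q => simp [G, hS.mul_antipode, ← hM.act_one_mul, mul_assoc]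
    | add u v hu hv => simp only [map_add, add_mul, hu, hv]
  rw [left, W.coassoc, right, ← hM.act_mul, mul_one]

end IsModuleAlgebra

theorem act_leftIntegral
    {k H A : Type*} [Field k] [Ring H] [Algebra k H] [Ring A] [Algebra k A]
    (WH : WeakBialgebra k H) (WA : WeakBialgebra k A)
    (SH : H →ₗ[k] H) (SA : A →ₗ[k] A)
    (hSH : WH.IsAntipode SH) (hSA : WA.IsAntipode SA)
    (act : H →ₗ[k] A →ₗ[k] A) (coact : H →ₗ[k] H ⊗[k] A)
    (hMP : IsWeakMatchedPair k WH WA act coact)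
    (hcomm : ∀ a b : A, a * b = b * a)
    (α : A) (hα : WA.IsLeftIntegral α) :
    ∀ h : H, WA.IsLeftIntegral (act h α) := by
  intro h x
  have hx : ∀ g : H, α * act g x = α * act g (WA.εt x) := fun g => by
    rw [hcomm α, hcomm α, ← hα.εs_mul hcomm (act g x), ← hα.εs_mul hcomm (act g (WA.εt x)),
      hMP.cond4 g x, hMP.cond4 g (WA.εt x), WA.εs_εt hcomm]
  have hmaps : LinearMap.mulLeft k α ∘ₗ act.flip x ∘ₗ SH =
      LinearMap.mulLeft k α ∘ₗ act.flip (WA.εt x) ∘ₗ SH :=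
    LinearMap.ext fun g => hx (SH g)
  rw [hcomm x, hcomm (WA.εt x), hMP.moduleAlgebra.act_mul_eq_act_mul_antipode hSH, hmaps,
    ← hMP.moduleAlgebra.act_mul_eq_act_mul_antipode hSH]

end WeakSmash
end
end
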